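/- For every ε > 0 there exists n₀ such that for every n ≥ n₀, the number of order-n Latin squares that admit fewer than ((1−ε)·n/e²)^n transversals is at most ε times the total number of order-n Latin squares. (Equivalently, a uniformly random order-n Latin square asymptotically almost surely contains at least ((1−o(1))·n/e²)^n transversals.) -/

import Mathlib

open scoped Classical

noncomputable section

/-- `L` is an order-`n` Latin square: every row and every column is a bijection. -/
def IsLatin (n : ℕ) (L : Fin n → Fin n → Fin n) : Prop :=
  (∀ i : Fin n, Function.Bijective (fun j => L i j)) ∧
  (∀ j : Fin n, Function.Bijective (fun i => L i j))

/-- The number of transversals of `L`: permutations `σ` such that `i ↦ L i (σ i)`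
is a bijection. -/
def numTransversals (n : ℕ) (L : Fin n → Fin n → Fin n) : ℕ :=
  (Finset.univ.filter (fun σ : Equiv.Perm (Fin n) =>
    Function.Bijective (fun i => L i (σ i)))).card

def bphi (r : ℕ) : ℝ := Real.log (r.factorial : ℝ) / r

lemma bphi_step (n r : ℕ) (hr : 1 ≤ r) :
    ((n:ℝ) - r) * bphi r + ((r:ℝ) - 1) * bphi (r-1) = n * bphi r - Real.log r := by
  obtain ⟨s, rfl⟩ : ∃ s, r = s + 1 := ⟨r - 1, by omega⟩
  have hs : ((s+1 : ℕ):ℝ) ≠ 0 := by positivity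
  have h1 : ((s+1 : ℕ):ℝ) * bphi (s+1) = Real.log ((s+1).factorial : ℝ) := by
    unfold bphi; field_simp
  have h2 : (s:ℝ) * bphi s = Real.log (s.factorial : ℝ) := by
    unfold bphi
    rcases Nat.eq_zero_or_pos s with h | h
    · subst h; simp
    · have : (s:ℝ) ≠ 0 := by positivity
      field_simp
  have h3 : Real.log ((s+1).factorial : ℝ) = Real.log ((s+1:ℕ):ℝ) + Real.log (s.factorial : ℝ) := by
    rw [Nat.factorial_succ, Nat.cast_mul, Real.log_mul hs (by positivity)]
  have e : s + 1 - 1 = s := by omega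
  rw [e]
  push_cast at *
  have : ((s:ℝ)+1-1) = s := by ring
  rw [this, h2]
  linarith [h1, h3]

lemma xlogx_jensen {β : Type*} (s : Finset β) (hs : s.Nonempty) (f : β → ℝ) (hf : ∀ b ∈ s, 0 ≤ f b)
    (p : ℝ) (hp : p = ∑ b ∈ s, f b) (hp0 : 0 < p) :
    p * Real.log p ≤ p * Real.log s.card + ∑ b ∈ s, f b * Real.log (f b) := by
  have hc : (0:ℝ) < s.card := by exact_mod_cast hs.card_pos
  have hj := Real.convexOn_mul_log.map_sum_le (t := s) (w := fun _ => (s.card:ℝ)⁻¹) (p := f)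
    (fun _ _ => by positivity) (by simp; field_simp) (fun b hb => hf b hb)
  simp only [smul_eq_mul] at hj
  rw [← Finset.mul_sum, ← Finset.mul_sum, ← hp, Real.log_mul (by positivity) hp0.ne', Real.log_inv] at hj
  have := mul_le_mul_of_nonneg_left hj hc.le
  field_simp at this
  linarith

set_option maxHeartbeats 1000000 in
lemma bregman_log : ∀ (n : ℕ) (α β : Type) [Fintype α] [Fintype β] (N : α → Finset β),
    Fintype.card α = n → (0 < (Finset.univ.filter (fun e : α ≃ β => ∀ a, e a ∈ N a)).card) →
    Real.log ((Finset.univ.filter (fun e : α ≃ β => ∀ a, e a ∈ N a)).card : ℝ) ≤ ∑ a, bphi (N a).card := by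
  intro n
  induction n with
  | zero =>
    intro α β _ _ N hn hp
    have : IsEmpty α := Fintype.card_eq_zero_iff.mp hn
    have : (Finset.univ.filter (fun e : α ≃ β => ∀ a, e a ∈ N a)).card ≤ 1 := by
      refine Finset.card_le_one.mpr ?_
      intro a _ b _
      ext x; exact isEmptyElim x
    have h1 : (Finset.univ.filter (fun e : α ≃ β => ∀ a, e a ∈ N a)).card = 1 := by omega
    rw [h1]; simp
  | succ n ih =>
    intro α β _ _ N hn hp
    set P := Finset.univ.filter (fun e : α ≃ β => ∀ a, e a ∈ N a) with hP
    set q : α → β → ℕ := fun i k => (P.filter (fun e => e i = k)).card with hq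
    have hPm : ∀ e, e ∈ P ↔ ∀ a, e a ∈ N a := by intro e; simp [hP]
    -- IH bound
    have hih : ∀ e ∈ P, ∀ i, Real.log (q i (e i)) ≤ ∑ j ∈ Finset.univ.erase i, bphi ((N j).erase (e i)).card := by
      intro e he i
      have hcard : Fintype.card {a // a ≠ i} = n := by
        simp [hn]
      set N' : {a // a ≠ i} → Finset {b // b ≠ e i} := fun a => (N a.1).subtype (fun b => b ≠ e i) with hN'
      have hNc : ∀ a, (N' a).card = ((N a.1).erase (e i)).card := by
        intro a
        simp only [hN', Finset.card_subtype]
        congr 1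
        ext x; simp [Finset.mem_erase, and_comm]
      have hle : q i (e i) ≤ (Finset.univ.filter (fun e' : {a // a ≠ i} ≃ {b // b ≠ e i} => ∀ a, e' a ∈ N' a)).card := by
        refine Finset.card_le_card_of_injOn
          (fun e' => if h : e' i = e i then e'.subtypeEquiv (fun a => by rw [← h]; simp) else
             e.subtypeEquiv (fun a => by simp)) ?_ ?_
        · intro e' he'
          simp only [Finset.coe_filter, Set.mem_ofPred_eq, hPm] at he'
          simp [he'.2, hN', he'.1]
        · intro e1 h1 e2 h2 h12
          simp only [Finset.coe_filter, Set.mem_ofPred_eq, hPm] at h1 h2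
          simp only [h1.2, h2.2, dite_true] at h12
          ext a
          by_cases ha : a = i
          · subst ha; rw [h1.2, h2.2]
          · have := congrArg (fun e' => (e' ⟨a, ha⟩).1) h12
            simpa using this
      have hqpos : 0 < q i (e i) := by
        refine Finset.card_pos.mpr ⟨e, ?_⟩
        exact Finset.mem_filter.mpr ⟨he, rfl⟩
      have hpos2 := lt_of_lt_of_le hqpos hle
      have := ih _ _ N' hcard (by
        refine lt_of_lt_of_eq hpos2 ?_
        congr!)
      refine le_trans (Real.log_le_log (by exact_mod_cast hqpos) (Nat.cast_le.mpr hle)) (le_trans (le_of_eq (by congr!)) (this.trans ?_))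
      simp only [hNc]
      rw [← Finset.sum_subtype (Finset.univ.erase i) (p := fun a => a ≠ i) (by simp) (fun j => bphi ((N j).erase (e i)).card)]
    have hp' : (0:ℝ) < P.card := by exact_mod_cast hp
    obtain ⟨e0, he0⟩ := Finset.card_pos.mp hp
    have hrow : ∀ i, (P.card:ℝ) = ∑ k ∈ N i, (q i k : ℝ) := by
      intro i
      rw [Finset.card_eq_sum_card_fiberwise (f := fun e : α ≃ β => e i) (t := N i)]
      · push_cast; rfl
      · intro e he; exact (hPm e).mp he i
    have hrow2 : ∀ i, ∑ k ∈ N i, (q i k : ℝ) * Real.log (q i k) = ∑ e ∈ P, Real.log (q i (e i)) := by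
      intro i
      rw [← Finset.sum_fiberwise_of_maps_to (s := P) (t := N i) (g := fun e : α ≃ β => e i)]
      · refine Finset.sum_congr rfl fun k _ => ?_
        rw [Finset.sum_congr rfl (g := fun _ => Real.log (q i k))]
        · rw [Finset.sum_const, nsmul_eq_mul]
        · intro e he; rw [(Finset.mem_filter.mp he).2]
      · intro e he; exact (hPm e).mp he i
    have hj : ∀ i, (P.card:ℝ) * Real.log P.card ≤ P.card * Real.log (N i).card + ∑ e ∈ P, Real.log (q i (e i)) := by
      intro i
      rw [← hrow2]
      exact xlogx_jensen (N i) ⟨e0 i, (hPm e0).mp he0 i⟩ _ (fun _ _ => by positivity) _ (hrow i) hp'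
    have hsum := Finset.sum_le_sum (s := Finset.univ) (fun i _ => hj i)
    rw [Finset.sum_const, Finset.sum_add_distrib, Finset.card_univ, hn, nsmul_eq_mul, ← Finset.mul_sum, Finset.sum_comm] at hsum
    have hinner : ∀ e ∈ P, ∑ i, Real.log (q i (e i)) ≤ ∑ j, (((n+1:ℕ):ℝ) * bphi (N j).card - Real.log (N j).card) := by
      intro e he
      calc ∑ i, Real.log (q i (e i)) ≤ ∑ i, ∑ j ∈ Finset.univ.erase i, bphi ((N j).erase (e i)).card :=
            Finset.sum_le_sum fun i _ => hih e he i
        _ = ∑ j, ∑ i ∈ Finset.univ.erase j, bphi ((N j).erase (e i)).card := by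
            apply Finset.sum_comm'; intro x y; simp [ne_comm]
        _ = _ := by
            refine Finset.sum_congr rfl fun j _ => ?_
            have hjm := (hPm e).mp he j
            have hr : 1 ≤ (N j).card := Finset.card_pos.mpr ⟨_, hjm⟩
            rw [← bphi_step _ _ hr]
            rw [← Finset.sum_filter_add_sum_filter_not (Finset.univ.erase j) (fun i => e i ∈ N j)]
            have hN : (Finset.univ.filter (fun i => e i ∈ N j)).card = (N j).card := by
              rw [← Finset.card_map e.toEmbedding]
              congr 1
              ext b; simp
            have c1 : ((Finset.univ.erase j).filter (fun i => e i ∈ N j)).card = (N j).card - 1 := by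
              rw [Finset.filter_erase, Finset.card_erase_of_mem (by simp [hjm]), hN]
            have c2 : ((Finset.univ.erase j).filter (fun i => ¬ e i ∈ N j)).card = (n+1) - (N j).card := by
              have := Finset.card_filter_add_card_filter_not (s := Finset.univ.erase j) (fun i => e i ∈ N j)
              rw [c1, Finset.card_erase_of_mem (Finset.mem_univ _), Finset.card_univ, hn] at this
              omega
            have hle : (N j).card ≤ n + 1 := by
              have := Finset.card_le_univ (Finset.univ.filter (fun i => e i ∈ N j))
              omega
            rw [Finset.sum_congr rfl (g := fun _ => bphi ((N j).card - 1)) (fun i hi => by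
                rw [Finset.card_erase_of_mem (Finset.mem_filter.mp hi).2]),
              Finset.sum_congr (s₁ := (Finset.univ.erase j).filter (fun i => ¬ e i ∈ N j)) rfl (g := fun _ => bphi ((N j).card)) (fun i hi => by
                rw [Finset.erase_eq_of_notMem (Finset.mem_filter.mp hi).2])]
            rw [Finset.sum_const, Finset.sum_const, c1, c2, nsmul_eq_mul, nsmul_eq_mul, Nat.cast_sub hr, Nat.cast_sub hle]
            push_cast; ring
    have h2 := Finset.sum_le_sum hinner
    rw [Finset.sum_const, nsmul_eq_mul, Finset.sum_sub_distrib, ← Finset.mul_sum] at h2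
    have h3 : ((n+1:ℕ):ℝ) * ((P.card:ℝ) * Real.log P.card) ≤ ((n+1:ℕ):ℝ) * (P.card * ∑ a, bphi (N a).card) := by
      linarith
    have h4 := le_of_mul_le_mul_left h3 (by positivity)
    exact le_of_mul_le_mul_left h4 hp'

structure GClass {n : ℕ} (D : ℕ) (p : MvPolynomial (Fin n) ℝ) : Prop where
  hom : p.IsHomogeneous D
  pos : ∀ d : Fin n →₀ ℕ, d.degree = D → 0 < p.coeff d
  stab : ∀ z : Fin n → ℂ, (∀ i, 0 < (z i).im) → MvPolynomial.aeval z p ≠ 0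

lemma hom_aeval {n D : ℕ} {p : MvPolynomial (Fin n) ℝ} (h : p.IsHomogeneous D) (c : ℂ) (z : Fin n → ℂ) :
    MvPolynomial.aeval (fun i => c * z i) p = c ^ D * MvPolynomial.aeval z p := by
  rw [MvPolynomial.aeval_def, MvPolynomial.aeval_def, MvPolynomial.eval₂_eq, MvPolynomial.eval₂_eq, Finset.mul_sum]
  refine Finset.sum_congr rfl fun d hd => ?_
  have hD := h.degree_eq_sum_deg_support hd
  rw [Finset.prod_congr rfl (fun i _ => mul_pow c (z i) (d i)), Finset.prod_mul_distrib, Finset.prod_pow_eq_pow_sum]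
  rw [hD]
  ring

def mslice {n : ℕ} (l : Fin n) (z : Fin n → ℂ) : MvPolynomial (Fin n) ℝ →ₐ[ℝ] Polynomial ℂ :=
  MvPolynomial.aeval (fun i => if i = l then Polynomial.X else Polynomial.C (z i))

lemma mslice_eval {n : ℕ} (l : Fin n) (z : Fin n → ℂ) (p : MvPolynomial (Fin n) ℝ) (t : ℂ) :
    (mslice l z p).eval t = MvPolynomial.aeval (Function.update z l t) p := by
  unfold mslice
  induction p using MvPolynomial.induction_on with
  | C a => simp [IsScalarTower.algebraMap_apply ℝ ℂ (Polynomial ℂ)]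
  | add p q hp hq => simp [hp, hq]
  | mul_X p i hp =>
    rw [map_mul, map_mul, Polynomial.eval_mul, hp]
    by_cases h : i = l
    · subst h; simp
    · simp [h]

lemma mslice_deriv {n : ℕ} (l : Fin n) (z : Fin n → ℂ) (p : MvPolynomial (Fin n) ℝ) :
    Polynomial.derivative (mslice l z p) = mslice l z (MvPolynomial.pderiv l p) := by
  induction p using MvPolynomial.induction_on with
  | C a => simp [mslice, IsScalarTower.algebraMap_apply ℝ ℂ (Polynomial ℂ)]
  | add p q hp hq => simp [hp, hq]
  | mul_X p i hp =>
    rw [map_mul, Polynomial.derivative_mul, hp, Derivation.leibniz, smul_eq_mul, smul_eq_mul, map_add, map_mul, map_mul]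
    by_cases h : i = l
    · subst h; simp [mslice]; ring
    · simp [mslice, h, MvPolynomial.pderiv_X, Pi.single_apply, Ne.symm h]
      ring

lemma GClass.eval_pos {n D : ℕ} {p : MvPolynomial (Fin n) ℝ} (h : GClass D p) (x : Fin n → ℝ) (hx : ∀ i, 0 ≤ x i)
    (l : Fin n) (hl : 0 < x l) : 0 < MvPolynomial.eval x p := by
  rw [MvPolynomial.eval_eq]
  have hc := h.pos (Finsupp.single l D) (by simp)
  refine Finset.sum_pos' ?_ ⟨Finsupp.single l D, ?_, ?_⟩
  · intro d hd
    have hD := h.hom.degree_eq_sum_deg_support hd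
    refine mul_nonneg (h.pos d hD.symm).le (Finset.prod_nonneg fun i _ => pow_nonneg (hx i) _)
  · exact MvPolynomial.mem_support_iff.mpr hc.ne'
  · refine mul_pos hc (Finset.prod_pos fun i _ => ?_)
    by_cases hi : i = l
    · subst hi; positivity
    · simp [Finsupp.single_apply, Ne.symm hi]

lemma aeval_ofReal {n : ℕ} (p : MvPolynomial (Fin n) ℝ) (x : Fin n → ℝ) :
    MvPolynomial.aeval (fun i => (x i : ℂ)) p = ((MvPolynomial.eval x p : ℝ) : ℂ) := by
  induction p using MvPolynomial.induction_on with
  | C a => simp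
  | add p q hp hq => simp [hp, hq]
  | mul_X p i hp => simp [hp]

lemma GClass.slice_deg {n D : ℕ} {p : MvPolynomial (Fin n) ℝ} (h : GClass (D+1) p) (l : Fin n) (z : Fin n → ℂ) :
    0 < (mslice l z p).degree := by
  by_contra hcon
  have hc := Polynomial.eq_C_of_degree_le_zero (not_lt.mp hcon)
  set c := (mslice l z p).coeff 0
  have hP : ∀ t, MvPolynomial.aeval (Function.update z l t) p = c := by
    intro t; rw [← mslice_eval, hc]; simp
  set g : ℂ → (Fin n → ℂ) := fun s => Function.update (fun i => s * z i) l 1 with hg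
  have hgc : Continuous g := by
    refine continuous_pi fun i => ?_
    by_cases hi : i = l
    · subst hi; simp [hg]; fun_prop
    · simp [hg, hi]; fun_prop
  have hcont : Continuous (fun s => MvPolynomial.aeval (g s) p) := by
    have : Continuous (fun w : Fin n → ℂ => MvPolynomial.aeval w p) := by
      simp only [MvPolynomial.aeval_def, MvPolynomial.eval₂_eq]
      fun_prop
    exact this.comp hgc
  have heq : (fun s => MvPolynomial.aeval (g s) p) = fun s => s ^ (D+1) * c := by
    refine Continuous.ext_on (dense_compl_singleton (0:ℂ)) hcont (by fun_prop) ?_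
    intro s hs
    have hs : s ≠ 0 := hs
    have : g s = fun i => s * (Function.update z l s⁻¹ i) := by
      funext i
      by_cases hi : i = l
      · subst hi; simp [hg, hs]
      · simp [hg, hi]
    simp only [this]
    rw [hom_aeval h.hom, hP]
  have h0 := congrFun heq 0
  have hg0 : g 0 = fun i => ((Function.update (fun _ => (0:ℝ)) l 1 i : ℝ) : ℂ) := by
    funext i
    by_cases hi : i = l
    · subst hi; simp [hg]
    · simp [hg, hi]
  simp only [hg0] at h0
  rw [aeval_ofReal] at h0
  have := h.eval_pos (Function.update (fun _ => (0:ℝ)) l 1) (fun i => by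
    by_cases hi : i = l
    · subst hi; simp
    · simp [hi]) l (by simp)
  simp at h0
  linarith

lemma GClass.pderiv {n D : ℕ} {p : MvPolynomial (Fin n) ℝ} (h : GClass (D+1) p) (l : Fin n) :
    GClass D (MvPolynomial.pderiv l p) := by
  refine ⟨by simpa using h.hom.pderiv (i := l), ?_, ?_⟩
  · intro d hd
    rw [MvPolynomial.coeff_pderiv]
    refine mul_pos (h.pos _ ?_) (by positivity)
    rw [map_add, hd]; simp
  · intro z hz h0
    have hdeg := h.slice_deg l z
    have hne : (mslice l z p) ≠ 0 := by
      intro h; simp [h] at hdeg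
    have hne' : Polynomial.derivative (mslice l z p) ≠ 0 := by
      intro h
      have := Polynomial.derivative_eq_zero.mp h
      have := Polynomial.natDegree_pos_iff_degree_pos.mpr hdeg
      omega
    have hsub := Polynomial.rootSet_derivative_subset_convexHull_rootSet hdeg
    have hz' : z l ∈ (Polynomial.derivative (mslice l z p)).rootSet ℂ := by
      rw [Polynomial.mem_rootSet]
      refine ⟨hne', ?_⟩
      rw [Polynomial.coe_aeval_eq_eval, mslice_deriv, mslice_eval, Function.update_eq_self, h0]
    have hconv : convexHull ℝ ((mslice l z p).rootSet ℂ) ⊆ {w : ℂ | w.im ≤ 0} := by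
      refine convexHull_min ?_ (convex_halfSpace_im_le 0)
      intro w hw
      by_contra hcon
      rw [Polynomial.mem_rootSet] at hw
      have hw2 := hw.2
      rw [Polynomial.coe_aeval_eq_eval, mslice_eval] at hw2
      refine h.stab _ ?_ hw2
      intro i
      by_cases hi : i = l
      · subst hi; simpa using hcon
      · simpa [hi] using hz i
    have := hconv (hsub hz')
    have h2 := hz l
    simp at this
    linarith

lemma GClass.root {n D : ℕ} {p : MvPolynomial (Fin n) ℝ} (h : GClass D p) (l : Fin n) (x : Fin n → ℝ)
    (hx : ∀ i, 0 < x i) (τ : ℂ) (hτ : (mslice l (fun i => (x i : ℂ)) p).eval τ = 0) :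
    τ.im = 0 ∧ τ.re ≤ 0 := by
  rw [mslice_eval] at hτ
  have key : ∀ u : ℝ, τ.re + u * τ.im ≤ 0 := by
    intro u
    by_contra hcon
    push Not at hcon
    have := hom_aeval h.hom (⟨u, 1⟩ : ℂ) (Function.update (fun i => (x i : ℂ)) l τ)
    rw [hτ, mul_zero] at this
    refine h.stab _ ?_ this
    intro i
    by_cases hi : i = l
    · subst hi; simp [Complex.mul_im]; linarith
    · simp [hi, hx]
  have hre := key 0
  simp at hre
  refine ⟨?_, hre⟩
  by_contra him
  have := key ((1 - τ.re) / τ.im)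
  rw [div_mul_cancel₀ _ him] at this
  linarith

/-- univariate exponential bound -/
lemma exp_bound_of_roots (P : Polynomial ℂ) (h0 : P.eval 0 ≠ 0)
    (hr : ∀ τ ∈ P.roots, τ.im = 0 ∧ τ.re ≤ 0) (t : ℝ) (ht : 0 ≤ t) :
    ‖P.eval (t:ℂ)‖ ≤ ‖P.eval 0‖ * Real.exp (t * (P.derivative.eval 0 / P.eval 0).re) := by
  have hs := IsAlgClosed.splits P
  have hprod := hs.eq_prod_roots
  rw [hs.eval_derivative_div_eval_of_ne_zero h0]
  have hev : ∀ w, P.eval w = P.leadingCoeff * (P.roots.map (fun a => w - a)).prod := by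
    intro w
    conv_lhs => rw [hprod]
    rw [Polynomial.eval_mul, Polynomial.eval_C, Polynomial.eval_multiset_prod, Multiset.map_map]
    simp
  have hne : ∀ τ ∈ P.roots, τ ≠ 0 := by
    rintro τ hτ rfl
    exact h0 ((Polynomial.mem_roots'.mp hτ).2)
  rw [hev t, hev 0, norm_mul, norm_mul, mul_assoc]
  refine mul_le_mul_of_nonneg_left ?_ (norm_nonneg _)
  generalize P.roots = s at hr hne
  induction s using Multiset.induction_on with
  | empty => simp
  | cons a s ih =>
    have iha := ih (fun τ hτ => hr τ (Multiset.mem_cons_of_mem hτ)) (fun τ hτ => hne τ (Multiset.mem_cons_of_mem hτ))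
    simp only [Multiset.map_cons, Multiset.prod_cons, Multiset.sum_cons, norm_mul, Complex.add_re, mul_add, Real.exp_add]
    have ha := hr a (Multiset.mem_cons_self a s)
    have hane := hne a (Multiset.mem_cons_self a s)
    have hae : a = ((a.re : ℝ) : ℂ) := by apply Complex.ext <;> simp [ha.1]
    have hare : a.re ≠ 0 := by
      intro h; rw [h] at hae; exact hane (by simpa using hae)
    have hlt : a.re < 0 := lt_of_le_of_ne ha.2 hare
    have h1 : ‖(t:ℂ) - a‖ ≤ ‖(0:ℂ) - a‖ * Real.exp (t * (1 / (0 - a)).re) := by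
      rw [hae]
      have e1 : ((t:ℂ) - (a.re:ℂ)) = ((t - a.re : ℝ) : ℂ) := by push_cast; ring
      have e2 : ((0:ℂ) - (a.re:ℂ)) = ((- a.re : ℝ) : ℂ) := by push_cast; ring
      have e3 : (1 / ((- a.re : ℝ) : ℂ)) = ((1 / (-a.re) : ℝ) : ℂ) := by push_cast; ring
      rw [e1, e2, e3, Complex.norm_real, Complex.norm_real, Complex.ofReal_re, Real.norm_eq_abs, Real.norm_eq_abs,
        abs_of_pos (by linarith), abs_of_pos (by linarith)]
      have := Real.add_one_le_exp (t * (1 / (-a.re)))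
      have h3 := mul_le_mul_of_nonneg_left this (by linarith : 0 ≤ -a.re)
      refine le_trans (le_of_eq ?_) h3
      field_simp
      ring
    calc _ ≤ (‖(0:ℂ) - a‖ * Real.exp (t * (1 / (0 - a)).re)) * (‖(Multiset.map (fun a => 0 - a) s).prod‖ * Real.exp (t * (Multiset.map (fun z => 1 / (0 - z)) s).sum.re)) :=
          mul_le_mul h1 iha (norm_nonneg _) (by positivity)
      _ = _ := by ring

lemma GClass.step {n D : ℕ} (hn : 2 ≤ n) {p : MvPolynomial (Fin n) ℝ} (h : GClass (D+1) p) (l : Fin n)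
    (T : Finset (Fin n)) (hl : l ∉ T) (C : ℝ) (hC : 0 ≤ C)
    (hp : ∀ x : Fin n → ℝ, (∀ i, 0 < x i) → C * ∏ i ∈ insert l T, x i ≤ MvPolynomial.eval x p) :
    ∀ x : Fin n → ℝ, (∀ i, 0 < x i) → (C / Real.exp 1) * ∏ i ∈ T, x i ≤ MvPolynomial.eval x (MvPolynomial.pderiv l p) := by
  intro x hx
  obtain ⟨l', hl'⟩ : ∃ l' : Fin n, l' ≠ l := by
    have : Nontrivial (Fin n) := Fin.nontrivial_iff_two_le.mpr hn
    exact exists_ne l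
  have hup : ∀ t : ℝ, (mslice l (fun i => (x i : ℂ)) p).eval (t:ℂ) = ((MvPolynomial.eval (Function.update x l t) p : ℝ) : ℂ) := by
    intro t
    rw [mslice_eval, ← aeval_ofReal]
    congr 2
    funext i
    by_cases hi : i = l
    · subst hi; simp
    · simp [hi]
  have hup' : ∀ t : ℝ, (mslice l (fun i => (x i : ℂ)) p).derivative.eval (t:ℂ) = ((MvPolynomial.eval (Function.update x l t) (MvPolynomial.pderiv l p) : ℝ) : ℂ) := by
    intro t
    rw [mslice_deriv, mslice_eval, ← aeval_ofReal]
    congr 2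
    funext i
    by_cases hi : i = l
    · subst hi; simp
    · simp [hi]
  have hx0 : ∀ i, 0 ≤ Function.update x l 0 i := by
    intro i
    by_cases hi : i = l
    · subst hi; simp
    · simp [hi, (hx i).le]
  set R0 := MvPolynomial.eval (Function.update x l 0) p with hR0
  set R1 := MvPolynomial.eval (Function.update x l 0) (MvPolynomial.pderiv l p) with hR1
  have hR0p : 0 < R0 := h.eval_pos _ hx0 l' (by simp [hl', hx])
  have hR1p : 0 < R1 := (h.pderiv l).eval_pos _ hx0 l' (by simp [hl', hx])
  have h0 : (mslice l (fun i => (x i : ℂ)) p).eval 0 = (R0 : ℂ) := by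
    have := hup 0; simpa using this
  have h0' : (mslice l (fun i => (x i : ℂ)) p).derivative.eval 0 = (R1 : ℂ) := by
    have := hup' 0; simpa using this
  have hb := exp_bound_of_roots (mslice l (fun i => (x i : ℂ)) p) (by rw [h0]; exact_mod_cast hR0p.ne')
    (fun τ hτ => h.root l x hx τ (Polynomial.mem_roots'.mp hτ).2) (R0 / R1) (by positivity)
  rw [hup, h0, h0', Complex.norm_real, Complex.norm_real, ← Complex.ofReal_div, Complex.ofReal_re] at hb
  have e1 : R0 / R1 * (R1 / R0) = 1 := by field_simp
  rw [e1, Real.norm_eq_abs, Real.norm_eq_abs, abs_of_pos hR0p] at hb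
  have hb := (le_abs_self _).trans hb
  have hupos : ∀ i, 0 < Function.update x l (R0/R1) i := by
    intro i
    by_cases hi : i = l
    · subst hi; simp; positivity
    · simp [hi, hx]
  have h2 := (hp _ hupos).trans hb
  rw [Finset.prod_insert hl, Function.update_self, Finset.prod_congr rfl (g := x) (fun i hi => by
    rw [Function.update_of_ne]; rintro rfl; exact hl hi)] at h2
  set Q := ∏ i ∈ T, x i
  have h3 : C / Real.exp 1 * Q ≤ R1 := by
    rw [div_mul_eq_mul_div, div_le_iff₀ (Real.exp_pos 1)]
    have h4 : R0 * (C * Q) ≤ R0 * (R1 * Real.exp 1) := by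
      have := mul_le_mul_of_nonneg_right h2 hR1p.le
      calc R0 * (C * Q) = C * (R0 / R1 * Q) * R1 := by field_simp
        _ ≤ _ := this
        _ = _ := by ring
    exact le_of_mul_le_mul_left h4 hR0p
  refine h3.trans ?_
  rw [hR1, MvPolynomial.eval_eq, MvPolynomial.eval_eq]
  refine Finset.sum_le_sum fun d hd => ?_
  have hD := (h.pderiv l).hom.degree_eq_sum_deg_support hd
  refine mul_le_mul_of_nonneg_left ?_ ((h.pderiv l).pos d hD.symm).le
  refine Finset.prod_le_prod (fun i _ => pow_nonneg (hx0 i) _) fun i _ => ?_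
  refine pow_le_pow_left₀ (hx0 i) ?_ _
  by_cases hi : i = l
  · subst hi; simp [(hx _).le]
  · simp [hi]

lemma GClass.coeff_bound {n : ℕ} (hn : 2 ≤ n) (T : Finset (Fin n)) : ∀ (p : MvPolynomial (Fin n) ℝ) (_ : GClass T.card p)
    (C : ℝ) (_ : 0 ≤ C) (_ : ∀ x : Fin n → ℝ, (∀ i, 0 < x i) → C * ∏ i ∈ T, x i ≤ MvPolynomial.eval x p),
    C / Real.exp 1 ^ T.card ≤ p.coeff (∑ i ∈ T, Finsupp.single i 1) := by
  induction T using Finset.induction_on with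
  | empty =>
    intro p h C hC hp
    have h1 := hp (fun _ => 1) (by simp)
    have h2 : p = MvPolynomial.C (p.coeff 0) := by
      have := MvPolynomial.homogeneousComponent_eq_self h.hom
      simp at this
      rw [this]
    rw [h2] at h1
    simpa using h1
  | insert l T hl ih =>
    intro p h C hC hp
    rw [Finset.card_insert_of_notMem hl] at h ⊢
    have h1 := ih _ (h.pderiv l) (C / Real.exp 1) (by positivity) (h.step hn l T hl C hC hp)
    rw [MvPolynomial.coeff_pderiv] at h1
    have : (∑ i ∈ T, Finsupp.single i 1 : Fin n →₀ ℕ) l = 0 := by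
      rw [Finsupp.finsetSum_apply]
      refine Finset.sum_eq_zero fun i hi => ?_
      rw [Finsupp.single_apply, if_neg]; rintro rfl; exact hl hi
    rw [this] at h1
    rw [Finset.sum_insert hl, add_comm (Finsupp.single l 1)]
    refine le_trans (le_of_eq ?_) (h1.trans (le_of_eq (by simp)))
    rw [pow_succ]; field_simp

def linf {n : ℕ} (a : Fin n → ℝ) : MvPolynomial (Fin n) ℝ := ∑ j, MvPolynomial.C (a j) * MvPolynomial.X j

lemma linf_eval {n : ℕ} (a x : Fin n → ℝ) : MvPolynomial.eval x (linf a) = ∑ j, a j * x j := by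
  simp [linf]

lemma GClass.prod {n : ℕ} (hn : 2 ≤ n) (A : Fin n → Fin n → ℝ) (hA : ∀ i j, 0 < A i j) (s : Finset (Fin n)) :
    GClass s.card (∏ i ∈ s, linf (A i)) := by
  induction s using Finset.induction_on with
  | empty =>
    refine ⟨by simpa using MvPolynomial.isHomogeneous_one (Fin n) ℝ, ?_, ?_⟩
    · intro d hd
      have : d = 0 := by
        rw [Finset.card_empty] at hd
        exact (Finsupp.degree_eq_zero_iff d).mp hd
      subst this; simp
    · intro z hz; simp
  | insert l s hl ih =>
    rw [Finset.card_insert_of_notMem hl, Finset.prod_insert hl, mul_comm]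
    refine ⟨?_, ?_, ?_⟩
    · refine ih.hom.mul ?_
      exact MvPolynomial.IsHomogeneous.sum _ _ _ (fun j _ => MvPolynomial.isHomogeneous_C_mul_X _ _)
    · intro d hd
      have hd0 : ∃ j, j ∈ d.support := by
        by_contra hcon
        push Not at hcon
        have : d = 0 := by
          ext j; simpa using hcon j
        subst this; simp at hd
      obtain ⟨j, hj⟩ := hd0
      have hterm : ∀ j, MvPolynomial.coeff d ((∏ i ∈ s, linf (A i)) * (MvPolynomial.C (A l j) * MvPolynomial.X j)) =
          A l j * (if j ∈ d.support then MvPolynomial.coeff (d - Finsupp.single j 1) (∏ i ∈ s, linf (A i)) else 0) := by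
        intro j
        rw [mul_left_comm, MvPolynomial.coeff_C_mul, MvPolynomial.coeff_mul_X']
      have hdeg : ∀ j ∈ d.support, (d - Finsupp.single j 1).degree = s.card := by
        intro j hj
        have h1 : d - Finsupp.single j 1 + Finsupp.single j 1 = d := by
          refine tsub_add_cancel_of_le ?_
          rw [Finsupp.single_le_iff]
          exact Nat.one_le_iff_ne_zero.mpr (Finsupp.mem_support_iff.mp hj)
        have h2 := congrArg Finsupp.degree h1
        rw [map_add, hd] at h2
        simpa using h2
      unfold linf
      rw [Finset.mul_sum, MvPolynomial.coeff_sum]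
      change 0 < ∑ x, MvPolynomial.coeff d ((∏ i ∈ s, linf (A i)) * (MvPolynomial.C (A l x) * MvPolynomial.X x))
      simp only [hterm]
      refine Finset.sum_pos' ?_ ⟨j, Finset.mem_univ _, ?_⟩
      · intro j _
        refine mul_nonneg (hA l j).le ?_
        split_ifs with h
        · exact (ih.pos _ (hdeg j h)).le
        · exact le_rfl
      · rw [if_pos hj]
        exact mul_pos (hA l j) (ih.pos _ (hdeg j hj))
    · intro z hz h0
      rw [map_mul, mul_eq_zero] at h0
      rcases h0 with h0 | h0
      · exact ih.stab z hz h0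
      · have : (MvPolynomial.aeval z (linf (A l))).im = ∑ j, A l j * (z j).im := by
          simp [linf]
        rw [h0] at this
        have hpos : 0 < ∑ j, A l j * (z j).im :=
          Finset.sum_pos (fun j _ => mul_pos (hA l j) (hz j)) ⟨⟨0, by omega⟩, Finset.mem_univ _⟩
        rw [← this] at hpos; simp at hpos

lemma coeff_prod_linf {n : ℕ} (A : Fin n → Fin n → ℝ) :
    (∏ i, linf (A i)).coeff (∑ i, Finsupp.single i 1) = ∑ σ : Equiv.Perm (Fin n), ∏ i, A i (σ i) := by
  unfold linf
  rw [Finset.prod_univ_sum, MvPolynomial.coeff_sum]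
  have hterm : ∀ f : Fin n → Fin n, MvPolynomial.coeff (∑ i, Finsupp.single i 1)
      (∏ i, (MvPolynomial.C (A i (f i)) * MvPolynomial.X (f i) : MvPolynomial (Fin n) ℝ)) =
      if Function.Bijective f then ∏ i, A i (f i) else 0 := by
    intro f
    have e : ∏ i, (MvPolynomial.C (A i (f i)) * MvPolynomial.X (f i) : MvPolynomial (Fin n) ℝ) =
        MvPolynomial.monomial (∑ i, Finsupp.single (f i) 1) (∏ i, A i (f i)) := by
      rw [MvPolynomial.monomial_sum_prod]
      refine Finset.prod_congr rfl fun i _ => ?_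
      rw [MvPolynomial.C_mul_X_eq_monomial]
    rw [e, MvPolynomial.coeff_monomial]
    have : (∑ i, Finsupp.single (f i) 1 : Fin n →₀ ℕ) = ∑ i, Finsupp.single i 1 ↔ Function.Bijective f := by
      constructor
      · intro h
        rw [← Finite.surjective_iff_bijective]
        intro j
        have h1 := congrArg (fun d => d j) h
        simp only [Finsupp.finsetSum_apply, Finsupp.single_apply] at h1
        simp at h1
        by_contra hcon
        push Not at hcon
        rw [Finset.filter_false_of_mem (fun i _ => hcon i)] at h1
        simp at h1
      · intro h
        exact (Equiv.ofBijective f h).sum_comp (fun i => (Finsupp.single i 1 : Fin n →₀ ℕ))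
    simp [this]
  simp only [hterm, Fintype.piFinset_univ]
  rw [← Finset.sum_filter]
  symm
  refine Finset.sum_bij (fun σ _ => (σ : Fin n → Fin n)) ?_ ?_ ?_ ?_
  · intro σ _; exact Finset.mem_filter.mpr ⟨Finset.mem_univ _, σ.bijective⟩
  · intro a _ b _ h; exact Equiv.coe_fn_injective h
  · intro f hf
    exact ⟨Equiv.ofBijective f (by simpa using hf), by simp, by rfl⟩
  · intro σ _; rfl

lemma amgm_finset {n : ℕ} (s : Finset (Fin n)) (d : ℕ) (hd : 0 < d) (hs : s.card = d) (x : Fin n → ℝ) (hx : ∀ i, 0 < x i) :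
    (d:ℝ) * ∏ j ∈ s, x j ^ ((d:ℝ)⁻¹) ≤ ∑ j ∈ s, x j := by
  have hd' : (0:ℝ) < d := by exact_mod_cast hd
  have := Real.geom_mean_le_arith_mean_weighted s (fun _ => (d:ℝ)⁻¹) x (fun _ _ => by positivity)
    (by simp [hs]; field_simp) (fun i _ => (hx i).le)
  rw [← Finset.mul_sum] at this
  calc _ ≤ (d:ℝ) * ((d:ℝ)⁻¹ * ∑ j ∈ s, x j) := mul_le_mul_of_nonneg_left this hd'.le
    _ = _ := by field_simp

lemma vdw_perturbed {n : ℕ} (hn : 2 ≤ n) (d : ℕ) (hd : 0 < d) (N : Fin n → Finset (Fin n)) (hN : ∀ i, (N i).card = d)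
    (hN' : ∀ j, (Finset.univ.filter (fun i => j ∈ N i)).card = d) (ε : ℝ) (hε : 0 < ε) :
    (d:ℝ)^n / Real.exp 1 ^ n ≤ ∑ σ : Equiv.Perm (Fin n), ∏ i, ((if σ i ∈ N i then 1 else 0) + ε) := by
  have hd' : (0:ℝ) < d := by exact_mod_cast hd
  set A : Fin n → Fin n → ℝ := fun i j => (if j ∈ N i then 1 else 0) + ε with hA
  have hAp : ∀ i j, 0 < A i j := by
    intro i j; simp only [hA]; split_ifs <;> positivity
  have hG := GClass.prod hn A hAp Finset.univ
  have := GClass.coeff_bound hn Finset.univ _ hG ((d:ℝ)^n) (by positivity) ?_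
  · rw [coeff_prod_linf] at this
    simpa using this
  · intro x hx
    rw [map_prod]
    have hrow : ∀ i, (d:ℝ) * ∏ j ∈ N i, x j ^ ((d:ℝ)⁻¹) ≤ MvPolynomial.eval x (linf (A i)) := by
      intro i
      refine (amgm_finset (N i) d hd (hN i) x hx).trans ?_
      rw [linf_eval, ← Finset.sum_filter_add_sum_filter_not Finset.univ (fun j => j ∈ N i)]
      have : Finset.univ.filter (fun j => j ∈ N i) = N i := by ext; simp
      rw [this]
      refine le_trans (Finset.sum_le_sum (fun j hj => ?_)) (le_add_of_nonneg_right (Finset.sum_nonneg fun j _ => mul_nonneg (hAp i j).le (hx j).le))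
      have : 1 ≤ A i j := by simp only [hA, hj, if_true]; linarith
      nlinarith [hx j]
    calc (d:ℝ)^n * ∏ i, x i = ∏ i, ((d:ℝ) * ∏ j ∈ N i, x j ^ ((d:ℝ)⁻¹)) := by
          rw [Finset.prod_mul_distrib]
          congr 1
          · simp
          · rw [Finset.prod_comm' (t' := Finset.univ) (s' := fun j => Finset.univ.filter (fun i => j ∈ N i)) (by simp)]
            refine Finset.prod_congr rfl fun j _ => ?_
            rw [Finset.prod_const, hN', ← Real.rpow_natCast, ← Real.rpow_mul (hx j).le, inv_mul_cancel₀ hd'.ne', Real.rpow_one]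
      _ ≤ _ := Finset.prod_le_prod (fun i _ => mul_nonneg hd'.le (Finset.prod_nonneg fun j _ => Real.rpow_nonneg (hx j).le _)) (fun i _ => hrow i)

lemma weak_vdw {n : ℕ} (hn : 2 ≤ n) (d : ℕ) (hd : 0 < d) (N : Fin n → Finset (Fin n)) (hN : ∀ i, (N i).card = d)
    (hN' : ∀ j, (Finset.univ.filter (fun i => j ∈ N i)).card = d) :
    ((d:ℝ) / Real.exp 1) ^ n ≤ ((Finset.univ.filter (fun σ : Equiv.Perm (Fin n) => ∀ i, σ i ∈ N i)).card : ℝ) := by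
  set F : ℝ → ℝ := fun ε => ∑ σ : Equiv.Perm (Fin n), ∏ i, ((if σ i ∈ N i then (1:ℝ) else 0) + ε) with hF
  have hFc : Continuous F := by
    simp only [hF]
    fun_prop
  have h0 : F 0 = ((Finset.univ.filter (fun σ : Equiv.Perm (Fin n) => ∀ i, σ i ∈ N i)).card : ℝ) := by
    simp only [hF, add_zero]
    rw [Finset.card_filter, Nat.cast_sum]
    refine Finset.sum_congr rfl fun σ _ => ?_
    rw [Finset.prod_ite_zero]
    simp
  rw [← h0, div_pow]
  have hlim : Filter.Tendsto F (nhdsWithin 0 (Set.Ioi 0)) (nhds (F 0)) := (hFc.tendsto 0).mono_left nhdsWithin_le_nhds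
  refine ge_of_tendsto hlim ?_
  filter_upwards [self_mem_nhdsWithin] with ε hε
  exact vdw_perturbed hn d hd N hN hN' ε hε

def LatOn {n : ℕ} (I : Finset (Fin n)) (f : Fin n → Equiv.Perm (Fin n)) : Prop :=
  ∀ r ∈ I, ∀ r' ∈ I, r ≠ r' → ∀ c, f r c ≠ f r' c

def latExt {n : ℕ} (I : Finset (Fin n)) (f0 : Fin n → Equiv.Perm (Fin n)) : Finset (Fin n → Equiv.Perm (Fin n)) :=
  Finset.univ.filter (fun f => LatOn Finset.univ f ∧ ∀ r ∈ I, f r = f0 r)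

def availC {n : ℕ} (I : Finset (Fin n)) (f0 : Fin n → Equiv.Perm (Fin n)) (c : Fin n) : Finset (Fin n) :=
  Finset.univ.filter (fun s => ∀ r ∈ I, f0 r c ≠ s)

lemma availC_card {n : ℕ} {I : Finset (Fin n)} {f0 : Fin n → Equiv.Perm (Fin n)} (h : LatOn I f0) (c : Fin n) :
    (availC I f0 c).card = n - I.card := by
  have : availC I f0 c = (I.image (fun r => f0 r c))ᶜ := by
    ext s; simp [availC]
  rw [this, Finset.card_compl, Fintype.card_fin, Finset.card_image_of_injOn]
  intro a ha b hb hab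
  by_contra hne
  exact h a ha b hb hne c hab

lemma availC_card' {n : ℕ} {I : Finset (Fin n)} {f0 : Fin n → Equiv.Perm (Fin n)} (h : LatOn I f0) (s : Fin n) :
    (Finset.univ.filter (fun c => s ∈ availC I f0 c)).card = n - I.card := by
  have : Finset.univ.filter (fun c => s ∈ availC I f0 c) = (I.image (fun r => (f0 r).symm s))ᶜ := by
    ext c
    simp only [availC, Finset.mem_filter, Finset.mem_univ, true_and, Finset.mem_compl, Finset.mem_image, not_exists, not_and, Equiv.symm_apply_eq, ne_eq]
    exact forall₂_congr fun r _ => not_congr eq_comm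
  rw [this, Finset.card_compl, Fintype.card_fin, Finset.card_image_of_injOn]
  intro a ha b hb hab
  by_contra hne
  simp only at hab
  have := h a ha b hb hne ((f0 a).symm s)
  apply this
  rw [Equiv.apply_symm_apply, hab, Equiv.apply_symm_apply]

lemma latExt_bounds {n : ℕ} (hn : 2 ≤ n) : ∀ (k : ℕ) (I : Finset (Fin n)) (f0 : Fin n → Equiv.Perm (Fin n)),
    LatOn I f0 → I.card + k = n →
    Real.exp (∑ d ∈ Finset.range k, (n:ℝ) * (Real.log ((d+1:ℕ):ℝ) - 1)) ≤ ((latExt I f0).card : ℝ) ∧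
    ((latExt I f0).card : ℝ) ≤ Real.exp (∑ d ∈ Finset.range k, (n:ℝ) * bphi (d+1)) := by
  intro k
  induction k with
  | zero =>
    intro I f0 hL hI
    have hIu : I = Finset.univ := by
      rw [← Finset.card_eq_iff_eq_univ]; simpa using hI
    subst hIu
    have : latExt Finset.univ f0 = {f0} := by
      ext f
      simp only [latExt, Finset.mem_filter, Finset.mem_univ, true_and, Finset.mem_singleton, forall_true_left]
      constructor
      · rintro ⟨_, h⟩; funext r; exact h r
      · rintro rfl; exact ⟨hL, fun _ => rfl⟩
    simp [this]
  | succ k ih =>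
    intro I f0 hL hI
    obtain ⟨r, hr⟩ : ∃ r, r ∉ I := by
      by_contra hcon
      push Not at hcon
      have : I = Finset.univ := Finset.eq_univ_iff_forall.mpr hcon
      rw [this] at hI; simp at hI
    set S := Finset.univ.filter (fun σ : Equiv.Perm (Fin n) => ∀ c, σ c ∈ availC I f0 c) with hS
    have hfib : (latExt I f0).card = ∑ σ ∈ S, (latExt (insert r I) (Function.update f0 r σ)).card := by
      rw [Finset.card_eq_sum_card_fiberwise (f := fun f : Fin n → Equiv.Perm (Fin n) => f r) (t := S)]
      · refine Finset.sum_congr rfl fun σ _ => ?_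
        congr 1
        ext f
        simp only [latExt, Finset.mem_filter, Finset.mem_univ, true_and, Finset.mem_insert, forall_eq_or_imp, Function.update_self]
        constructor
        · rintro ⟨⟨h1, h2⟩, h3⟩
          refine ⟨h1, h3, fun a ha => ?_⟩
          rw [Function.update_of_ne (by rintro rfl; exact hr ha)]; exact h2 a ha
        · rintro ⟨h1, h3, h2⟩
          refine ⟨⟨h1, fun a ha => ?_⟩, h3⟩
          rw [h2 a ha, Function.update_of_ne (by rintro rfl; exact hr ha)]
      · intro f hf
        simp only [latExt, Finset.coe_filter, Finset.mem_univ, true_and, Set.mem_ofPred_eq] at hf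
        simp only [hS, Finset.coe_filter, Finset.mem_univ, true_and, Set.mem_ofPred_eq, availC, Finset.mem_filter]
        intro c a ha
        rw [← hf.2 a ha]
        exact hf.1 a (Finset.mem_univ _) r (Finset.mem_univ _) (by rintro rfl; exact hr ha) c
    have hupd : ∀ σ ∈ S, LatOn (insert r I) (Function.update f0 r σ) := by
      intro σ hσ a ha b hb hab c
      simp only [hS, Finset.mem_filter, Finset.mem_univ, true_and, availC] at hσ
      rcases Finset.mem_insert.mp ha with rfl | ha'
      · rcases Finset.mem_insert.mp hb with rfl | hb'
        · exact absurd rfl hab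
        · rw [Function.update_self, Function.update_of_ne hab.symm]
          exact (hσ c b hb').symm
      · have hane : a ≠ r := by rintro rfl; exact hr ha'
        rcases Finset.mem_insert.mp hb with rfl | hb'
        · rw [Function.update_self, Function.update_of_ne hab]
          exact (hσ c a ha')
        · have hbne : b ≠ r := by rintro rfl; exact hr hb'
          rw [Function.update_of_ne hane, Function.update_of_ne hbne]
          exact hL a ha' b hb' hab c
    have hcard : n - I.card = k + 1 := by omega
    have hib := fun σ hσ => ih (insert r I) (Function.update f0 r σ) (hupd σ hσ)
      (by rw [Finset.card_insert_of_notMem hr]; omega)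
    rw [hfib, Finset.sum_range_succ, Finset.sum_range_succ, Real.exp_add, Real.exp_add]
    push_cast
    have hlow := weak_vdw hn (k+1) (by omega) (availC I f0) (fun c => by rw [availC_card hL, hcard])
      (fun s => by rw [availC_card' hL, hcard])
    have hlow' : Real.exp ((n:ℝ) * (Real.log ((k+1:ℕ):ℝ) - 1)) ≤ (S.card : ℝ) := by
      refine le_trans (le_of_eq ?_) hlow
      rw [mul_comm, Real.exp_mul, Real.exp_sub, Real.exp_log (by positivity), Real.rpow_natCast]
    have hSpos : 0 < S.card := by
      have := lt_of_lt_of_le (Real.exp_pos _) hlow'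
      exact_mod_cast this
    have hup : (S.card : ℝ) ≤ Real.exp ((n:ℝ) * bphi (k+1)) := by
      have := bregman_log n (Fin n) (Fin n) (availC I f0) (by simp) (lt_of_lt_of_eq hSpos (by rw [hS]; congr!))
      rw [← Real.log_le_iff_le_exp (by exact_mod_cast hSpos)]
      refine le_trans (le_of_eq ?_) (this.trans (le_of_eq ?_))
      · congr!
      · simp only [availC_card hL, hcard]; simp
    constructor
    · calc _ ≤ (∑ σ ∈ S, Real.exp (∑ d ∈ Finset.range k, (n:ℝ) * (Real.log ((d+1:ℕ):ℝ) - 1))) := by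
            rw [Finset.sum_const, nsmul_eq_mul, mul_comm]
            push_cast at hlow' ⊢
            exact mul_le_mul_of_nonneg_right hlow' (Real.exp_pos _).le
        _ ≤ _ := Finset.sum_le_sum fun σ hσ => (hib σ hσ).1
    · calc _ ≤ (∑ σ ∈ S, Real.exp (∑ d ∈ Finset.range k, (n:ℝ) * bphi (d+1))) :=
            Finset.sum_le_sum fun σ hσ => (hib σ hσ).2
        _ ≤ _ := by
            rw [Finset.sum_const, nsmul_eq_mul, mul_comm]
            exact mul_le_mul_of_nonneg_left hup (Real.exp_pos _).le

def latP (n : ℕ) : Finset (Fin n → Equiv.Perm (Fin n)) := Finset.univ.filter (fun f => LatOn Finset.univ f)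

lemma log_fact_le (d : ℕ) (hd : 1 ≤ d) : Real.log (d.factorial : ℝ) ≤ d * Real.log d - d + 1 + Real.log d := by
  induction d, hd using Nat.le_induction with
  | base => simp
  | succ d hd ih =>
    rw [Nat.factorial_succ]
    push_cast
    have hdp : (0:ℝ) < d := by exact_mod_cast hd
    rw [Real.log_mul (by positivity) (by positivity)]
    -- need log d ≤ ..., (d+1) log d + 1 ≤ (d+1) log(d+1)
    have h1 : Real.log ((d:ℝ)/(d+1)) ≤ (d:ℝ)/(d+1) - 1 := Real.log_le_sub_one_of_pos (by positivity)
    rw [Real.log_div hdp.ne' (by positivity)] at h1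
    have h2 : ((d:ℝ)+1) * (Real.log d - Real.log (d+1)) ≤ -1 := by
      calc _ ≤ ((d:ℝ)+1) * ((d:ℝ)/(d+1) - 1) := mul_le_mul_of_nonneg_left h1 (by positivity)
        _ = -1 := by field_simp; ring
    linarith

lemma sum_inv_le (n : ℕ) (hn : 1 ≤ n) : ∀ k ≤ n, 1 ≤ k → ∑ d ∈ Finset.range k, (1 / ((d+1:ℕ):ℝ)) ≤ 1 + Real.log k := by
  intro k _ hk
  have := harmonic_le_one_add_log k
  simpa [harmonic] using this

lemma transfer_num (n κ : ℕ) (hn : 2 ≤ n) (hκ : 2 * κ ≤ n) :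
    ∑ d ∈ Finset.range (n - κ), (n:ℝ) * bphi (d+1) + κ * Real.log (n.factorial : ℝ) ≤
      (κ:ℝ)^2 + 2 * n * (1 + Real.log n)^2 + ∑ d ∈ Finset.range n, (n:ℝ) * (Real.log ((d+1:ℕ):ℝ) - 1) := by
  have hn0 : (0:ℝ) < n := by positivity
  have hlogn : 0 ≤ Real.log n := Real.log_nonneg (by exact_mod_cast (by omega : 1 ≤ n))
  -- split
  have hsplit : ∑ d ∈ Finset.range n, (n:ℝ) * (Real.log ((d+1:ℕ):ℝ) - 1) =
      ∑ d ∈ Finset.range (n-κ), (n:ℝ) * (Real.log ((d+1:ℕ):ℝ) - 1) + ∑ t ∈ Finset.range κ, (n:ℝ) * (Real.log ((n-κ+t+1:ℕ):ℝ) - 1) := by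
    have : n = (n - κ) + κ := by omega
    conv_lhs => rw [this]
    rw [Finset.sum_range_add]
    have e : (((n - κ + κ : ℕ)):ℝ) = n := by congr 1; omega
    rw [e]
  have h1 : ∑ d ∈ Finset.range (n-κ), (n:ℝ) * bphi (d+1) ≤ ∑ d ∈ Finset.range (n-κ), (n:ℝ) * (Real.log ((d+1:ℕ):ℝ) - 1)
      + n * (1 + Real.log n)^2 := by
    have hterm : ∀ d ∈ Finset.range (n-κ), (n:ℝ) * bphi (d+1) ≤ (n:ℝ) * (Real.log ((d+1:ℕ):ℝ) - 1) + n * ((1 + Real.log n) * (1 / ((d+1:ℕ):ℝ))) := by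
      intro d hd
      have hd' : d < n - κ := Finset.mem_range.mp hd
      rw [← mul_add]
      refine mul_le_mul_of_nonneg_left ?_ hn0.le
      unfold bphi
      have hdp : (0:ℝ) < ((d+1:ℕ):ℝ) := by positivity
      rw [div_le_iff₀ hdp]
      have := log_fact_le (d+1) (by omega)
      have hlog : Real.log ((d+1:ℕ):ℝ) ≤ Real.log n := Real.log_le_log hdp (by exact_mod_cast (by omega : d + 1 ≤ n))
      calc _ ≤ _ := this
        _ ≤ (Real.log ((d+1:ℕ):ℝ) - 1) * ((d+1:ℕ):ℝ) + (1 + Real.log n) := by linarith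
        _ = _ := by field_simp
    refine (Finset.sum_le_sum hterm).trans ?_
    rw [Finset.sum_add_distrib, ← Finset.mul_sum, ← Finset.mul_sum, ← Finset.mul_sum]
    refine add_le_add le_rfl (mul_le_mul_of_nonneg_left ?_ hn0.le)
    rw [sq]
    refine mul_le_mul_of_nonneg_left ?_ (by linarith)
    refine (sum_inv_le n (by omega) (n-κ) (by omega) (by omega)).trans ?_
    have : Real.log ((n - κ : ℕ):ℝ) ≤ Real.log n := Real.log_le_log (by exact_mod_cast (by omega : 0 < n - κ)) (by exact_mod_cast (by omega : n - κ ≤ n))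
    linarith
  have h2 : (κ:ℝ) * Real.log (n.factorial : ℝ) ≤ ∑ t ∈ Finset.range κ, (n:ℝ) * (Real.log ((n-κ+t+1:ℕ):ℝ) - 1) + (κ:ℝ)^2 + n * (1 + Real.log n)^2 := by
    have hterm : ∀ t ∈ Finset.range κ, Real.log (n.factorial : ℝ) - (1 + Real.log n) ≤ (n:ℝ) * (Real.log ((n-κ+t+1:ℕ):ℝ) - 1) + 2 * ((κ:ℝ) - 1 - t) := by
      intro t ht
      have ht' : t < κ := Finset.mem_range.mp ht
      have := log_fact_le n (by omega)
      have hm : (0:ℝ) < ((n-κ+t+1:ℕ):ℝ) := by positivity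
      have hmm : ((n-κ+t+1:ℕ):ℝ) = n - (κ - 1 - t) := by
        push_cast [Nat.cast_sub (by omega : κ ≤ n)]; ring
      have hlog : Real.log (n / ((n-κ+t+1:ℕ):ℝ)) ≤ n / ((n-κ+t+1:ℕ):ℝ) - 1 := Real.log_le_sub_one_of_pos (by positivity)
      rw [Real.log_div hn0.ne' hm.ne'] at hlog
      have hle : (n:ℝ) * (n / ((n-κ+t+1:ℕ):ℝ) - 1) ≤ 2 * ((κ:ℝ) - 1 - t) := by
        rw [hmm]
        have hs0 : 0 ≤ (κ:ℝ) - 1 - t := by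
          have : (t:ℝ) + 1 ≤ κ := by exact_mod_cast ht'
          linarith
        have hhalf : (n:ℝ)/2 ≤ n - (κ - 1 - t) := by
          have : 2 * (κ:ℝ) ≤ n := by exact_mod_cast hκ
          have : (0:ℝ) ≤ t := by positivity
          linarith
        have hpos : 0 < (n:ℝ) - (κ - 1 - t) := by linarith
        have : (n:ℝ) / (n - (κ - 1 - t)) - 1 = (κ - 1 - t) / (n - (κ - 1 - t)) := by field_simp; ring
        rw [this, mul_div_assoc', div_le_iff₀ hpos]
        nlinarith
      have := mul_le_mul_of_nonneg_left hlog hn0.le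
      linarith
    have hs := Finset.sum_le_sum hterm
    rw [Finset.sum_const, Finset.card_range, nsmul_eq_mul, Finset.sum_add_distrib, ← Finset.mul_sum (Finset.range κ) (fun t => (κ:ℝ) - 1 - (t:ℕ))] at hs
    have hg : ∀ κ : ℕ, 2 * ∑ t ∈ Finset.range κ, ((κ:ℝ) - 1 - (t:ℕ)) ≤ (κ:ℝ)^2 := by
      intro κ
      have h := Finset.sum_range_id_mul_two κ
      have h' : (∑ t ∈ Finset.range κ, (t:ℝ)) * 2 = κ * ((κ - 1 : ℕ):ℝ) := by rw [← Nat.cast_mul, ← h]; push_cast; rfl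
      rw [Finset.sum_sub_distrib, Finset.sum_const, Finset.card_range, nsmul_eq_mul]
      rcases Nat.eq_zero_or_pos κ with h0 | h0
      · subst h0; simp
      · rw [Nat.cast_sub h0] at h'; push_cast at h'
        have : (0:ℝ) ≤ κ := by positivity
        nlinarith
    have hκn : (κ:ℝ) ≤ n := by exact_mod_cast (by omega : κ ≤ n)
    have : (κ:ℝ) * (1 + Real.log n) ≤ n * (1 + Real.log n)^2 := by
      have h0 : 1 ≤ 1 + Real.log n := by linarith
      calc (κ:ℝ) * (1 + Real.log n) ≤ n * (1 + Real.log n) := mul_le_mul_of_nonneg_right hκn (by linarith)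
        _ ≤ n * (1 + Real.log n)^2 := mul_le_mul_of_nonneg_left (by nlinarith) hn0.le
    have := hg κ
    linarith
  rw [hsplit]
  linarith

theorem transfer {n : ℕ} (hn : 2 ≤ n) {J : Type} [Fintype J] (κ : ℕ) (hJ : Fintype.card J = κ) (hκ : 2 * κ ≤ n)
    (e : J ↪ Fin n) (Bad : Finset (J → Equiv.Perm (Fin n))) :
    (((latP n).filter (fun f => (fun j => f (e j)) ∈ Bad)).card : ℝ) ≤
      (Bad.card : ℝ) / (n.factorial : ℝ)^κ * Real.exp ((κ:ℝ)^2 + 2 * n * (1 + Real.log n)^2) * ((latP n).card : ℝ) := by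
  set I : Finset (Fin n) := Finset.univ.map e with hI
  have hIc : I.card + (n - κ) = n := by
    rw [hI, Finset.card_map, Finset.card_univ, hJ]; omega
  have hfib : ∀ g ∈ Bad, ((((latP n).filter (fun f => (fun j => f (e j)) ∈ Bad)).filter (fun f => (fun j => f (e j)) = g)).card : ℝ) ≤
      Real.exp (∑ d ∈ Finset.range (n-κ), (n:ℝ) * bphi (d+1)) := by
    intro g hg
    rcases Finset.eq_empty_or_nonempty (((latP n).filter (fun f => (fun j => f (e j)) ∈ Bad)).filter (fun f => (fun j => f (e j)) = g)) with h | ⟨f0, hf0⟩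
    · rw [h]; simp [Real.exp_nonneg]
    · simp only [Finset.mem_filter, latP, Finset.mem_univ, true_and] at hf0
      refine le_trans ?_ (latExt_bounds hn (n-κ) I f0 (fun r _ r' _ => hf0.1.1 r (Finset.mem_univ _) r' (Finset.mem_univ _)) hIc).2
      refine Nat.cast_le.mpr (Finset.card_le_card ?_)
      intro f hf
      simp only [Finset.mem_filter, latP, Finset.mem_univ, true_and] at hf
      simp only [latExt, Finset.mem_filter, Finset.mem_univ, true_and]
      refine ⟨hf.1.1, ?_⟩
      intro r hr
      obtain ⟨j, _, rfl⟩ := Finset.mem_map.mp hr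
      have := congrFun (hf.2.trans hf0.2.symm) j
      exact this
  have h1 : (((latP n).filter (fun f => (fun j => f (e j)) ∈ Bad)).card : ℝ) ≤ Bad.card * Real.exp (∑ d ∈ Finset.range (n-κ), (n:ℝ) * bphi (d+1)) := by
    rw [Finset.card_eq_sum_card_fiberwise (f := fun f : Fin n → Equiv.Perm (Fin n) => fun j => f (e j)) (t := Bad)]
    · push_cast
      refine (Finset.sum_le_sum hfib).trans ?_
      rw [Finset.sum_const, nsmul_eq_mul]
    · intro f hf
      simp only [Finset.coe_filter, Set.mem_ofPred_eq] at hf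
      exact hf.2
  have h2 : Real.exp (∑ d ∈ Finset.range n, (n:ℝ) * (Real.log ((d+1:ℕ):ℝ) - 1)) ≤ ((latP n).card : ℝ) := by
    have := (latExt_bounds hn n ∅ (fun _ => 1) (by intro r hr; simp at hr) (by simp)).1
    refine this.trans (le_of_eq ?_)
    congr 2
    ext f; simp [latExt, latP]
  have h3 := transfer_num n κ hn hκ
  have hf : (0:ℝ) < n.factorial := by positivity
  refine h1.trans ?_
  have h4 : Real.exp (∑ d ∈ Finset.range (n-κ), (n:ℝ) * bphi (d+1)) ≤ 1 / (n.factorial : ℝ)^κ * Real.exp ((κ:ℝ)^2 + 2 * n * (1 + Real.log n)^2) * ((latP n).card : ℝ) := by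
    refine le_trans ?_ (mul_le_mul_of_nonneg_left h2 (by positivity))
    have e1 : 1 / (n.factorial : ℝ)^κ = Real.exp (-(κ * Real.log (n.factorial : ℝ))) := by
      rw [Real.exp_neg, mul_comm, Real.exp_mul, Real.exp_log hf, Real.rpow_natCast, one_div]
    rw [e1, ← Real.exp_add, ← Real.exp_add]
    apply Real.exp_le_exp.mpr
    linarith
  calc _ ≤ (Bad.card:ℝ) * _ := mul_le_mul_of_nonneg_left h4 (by positivity)
    _ = _ := by ring

lemma hoeff_avg {ι : Type*} [Fintype ι] (y : ι → ℝ) (M : ℝ) (hM : ∀ i, |y i| ≤ M) (h0 : ∑ i, y i = 0) (l : ℝ) :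
    ∑ i, Real.exp (l * y i) ≤ Fintype.card ι * Real.exp (l^2 * M^2 / 2) := by
  rcases isEmpty_or_nonempty ι with h | ⟨⟨i0⟩⟩
  · simp
  have hM0 : 0 ≤ M := (abs_nonneg _).trans (hM i0)
  rcases hM0.eq_or_lt with h | h
  · have : ∀ i, y i = 0 := fun i => abs_nonpos_iff.mp ((hM i).trans h.symm.le)
    simp [this, ← h]
  · have key : ∀ i, Real.exp (l * y i) ≤ Real.cosh (l*M) + (y i / M) * Real.sinh (l*M) := by
      intro i
      have h1 := abs_le.mp (hM i)
      have hcc := convexOn_exp.2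
      have hc := @hcc (l*M) (Set.mem_univ (l*M)) (-(l*M)) (Set.mem_univ (-(l*M)))
        ((1 + y i / M)/2) ((1 - y i / M)/2)
        (by have : -1 ≤ y i / M := by rw [le_div_iff₀ h]; linarith
            linarith)
        (by have : y i / M ≤ 1 := by rw [div_le_iff₀ h]; linarith
            linarith) (by ring)
      simp only [smul_eq_mul] at hc
      have e : (1 + y i / M)/2 * (l * M) + (1 - y i / M)/2 * (-(l*M)) = l * y i := by field_simp; ring
      rw [e] at hc
      refine hc.trans (le_of_eq ?_)
      rw [Real.cosh_eq, Real.sinh_eq]; ring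
    calc _ ≤ ∑ i, (Real.cosh (l*M) + (y i / M) * Real.sinh (l*M)) := Finset.sum_le_sum fun i _ => key i
      _ = Fintype.card ι * Real.cosh (l*M) := by
          rw [Finset.sum_add_distrib, ← Finset.sum_mul, ← Finset.sum_div, h0]; simp
      _ ≤ _ := by
          refine mul_le_mul_of_nonneg_left ?_ (by positivity)
          have := Real.cosh_le_exp_half_sq (l*M)
          rwa [mul_pow] at this

def pmean {n : ℕ} (g : Equiv.Perm (Fin n) → ℝ) : ℝ := (∑ σ, g σ) / (n.factorial : ℝ)

def SwapLip {n : ℕ} (c : ℝ) (g : Equiv.Perm (Fin n) → ℝ) : Prop :=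
  ∀ a b σ, |g (Equiv.swap a b * σ) - g σ| ≤ c

lemma perm_mgf : ∀ (n : ℕ) (g : Equiv.Perm (Fin n) → ℝ) (c : ℝ), 0 ≤ c → SwapLip c g → ∀ l : ℝ,
    ∑ σ, Real.exp (l * (g σ - pmean g)) ≤ (n.factorial : ℝ) * Real.exp (2 * l^2 * c^2 * n) := by
  intro n
  induction n with
  | zero =>
    intro g c hc hg l
    simp [pmean]
  | succ n ih =>
    intro g c hc hg l
    set E := (Equiv.Perm.decomposeFin (n := n)).symm with hE
    set h : Fin (n+1) → Equiv.Perm (Fin n) → ℝ := fun p e => g (E (p, e)) with hh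
    have hsw : ∀ p e, E (p, e) = Equiv.swap 0 p * E (0, e) := by
      intro p e
      ext x
      refine Fin.cases ?_ (fun x => ?_) x
      · simp [hE]
      · simp only [hE, Equiv.Perm.decomposeFin_symm_apply_succ, Equiv.Perm.mul_apply, Equiv.swap_self, Equiv.refl_apply]
    have hmul : ∀ a b e, E (0, Equiv.swap a b * e) = Equiv.swap a.succ b.succ * E (0, e) := by
      intro a b e
      ext x
      refine Fin.cases ?_ (fun x => ?_) x
      · simp [hE, Equiv.swap_apply_of_ne_of_ne (Fin.succ_ne_zero a).symm (Fin.succ_ne_zero b).symm]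
      · simp only [hE, Equiv.Perm.decomposeFin_symm_apply_succ, Equiv.Perm.mul_apply, Equiv.swap_self, Equiv.refl_apply]
        congr 1
        rw [(Fin.succ_injective n).map_swap]
    have hlip : ∀ p, SwapLip c (h p) := by
      intro p a b e
      simp only [hh]
      rw [hsw p, hmul, hsw p e, ← mul_assoc, Equiv.mul_swap_eq_swap_mul, mul_assoc]
      exact hg _ _ _
    have hpm : ∀ p, |pmean (h p) - pmean (h 0)| ≤ c := by
      intro p
      unfold pmean
      rw [← sub_div, ← Finset.sum_sub_distrib, abs_div, div_le_iff₀ (by positivity)]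
      refine (Finset.abs_sum_le_sum_abs _ _).trans ?_
      refine (Finset.sum_le_sum (fun e _ => (?_ : _ ≤ c))).trans ?_
      · simp only [hh]; rw [hsw p e]; exact hg _ _ _
      · rw [Finset.sum_const, Finset.card_univ, Fintype.card_perm, Fintype.card_fin, nsmul_eq_mul, mul_comm]
        refine mul_le_mul_of_nonneg_left ?_ hc
        exact le_abs_self _
    have hsum : ∀ F : Equiv.Perm (Fin (n+1)) → ℝ, ∑ σ, F σ = ∑ p, ∑ e, F (E (p, e)) := by
      intro F
      rw [← Equiv.sum_comp E, Fintype.sum_prod_type]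
    have hmean : ∑ p, (pmean (h p) - pmean g) = 0 := by
      rw [Finset.sum_sub_distrib]
      have : ∑ p, pmean (h p) = (n+1) * pmean g := by
        simp only [pmean, hsum g, hh]
        rw [← Finset.sum_div, Nat.factorial_succ]
        push_cast
        field_simp
      rw [this]; simp
    have hM : ∀ p, |pmean (h p) - pmean g| ≤ 2 * c := by
      intro p
      have e1 : (n+1:ℝ) * (pmean (h p) - pmean g) = ∑ q, (pmean (h p) - pmean (h q)) := by
        rw [Finset.sum_sub_distrib] at hmean ⊢
        simp at hmean ⊢
        linarith
      have e2 : |∑ q, (pmean (h p) - pmean (h q))| ≤ ∑ q : Fin (n+1), 2 * c := by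
        refine (Finset.abs_sum_le_sum_abs _ _).trans (Finset.sum_le_sum fun q _ => ?_)
        have h1 := abs_le.mp (hpm p)
        have h2 := abs_le.mp (hpm q)
        rw [abs_le]; constructor <;> linarith
      rw [← e1, abs_mul, abs_of_pos (by positivity : (0:ℝ) < n+1)] at e2
      simp only [Finset.sum_const, Finset.card_univ, Fintype.card_fin, nsmul_eq_mul] at e2
      push_cast at e2
      exact le_of_mul_le_mul_left e2 (by positivity)
    rw [hsum]
    calc ∑ p, ∑ e, Real.exp (l * (g (E (p, e)) - pmean g))
        = ∑ p, Real.exp (l * (pmean (h p) - pmean g)) * ∑ e, Real.exp (l * (h p e - pmean (h p))) := by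
          refine Finset.sum_congr rfl fun p _ => ?_
          rw [Finset.mul_sum]
          refine Finset.sum_congr rfl fun e _ => ?_
          rw [← Real.exp_add]; congr 1; simp only [hh]; ring
      _ ≤ ∑ p, Real.exp (l * (pmean (h p) - pmean g)) * ((n.factorial : ℝ) * Real.exp (2 * l^2 * c^2 * n)) :=
          Finset.sum_le_sum fun p _ => mul_le_mul_of_nonneg_left (ih (h p) c hc (hlip p) l) (Real.exp_pos _).le
      _ ≤ ((n+1:ℕ):ℝ) * Real.exp (l^2 * (2*c)^2/2) * ((n.factorial : ℝ) * Real.exp (2 * l^2 * c^2 * n)) := by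
          rw [← Finset.sum_mul]
          refine mul_le_mul_of_nonneg_right ?_ (by positivity)
          have := hoeff_avg (fun p => pmean (h p) - pmean g) (2*c) hM hmean l
          simpa using this
      _ = _ := by
          rw [Nat.factorial_succ]
          have : Real.exp (2 * l^2 * c^2 * ((n+1:ℕ):ℝ)) = Real.exp (l^2 * (2*c)^2/2) * Real.exp (2 * l^2 * c^2 * n) := by
            rw [← Real.exp_add]; congr 1; push_cast; ring
          rw [this]; push_cast; ring

/-- lower tail for the sum over independent permutations -/
lemma perm_tail {n : ℕ} {J : Type} [Fintype J] (hn : 0 < n) (g : Equiv.Perm (Fin n) → ℝ) (c : ℝ) (hc : 0 < c) (hg : SwapLip c g)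
    (t : ℝ) (ht : 0 ≤ t) :
    ((Finset.univ.filter (fun f : J → Equiv.Perm (Fin n) => ∑ j, g (f j) ≤ Fintype.card J * (pmean g - t))).card : ℝ) ≤
      (n.factorial : ℝ) ^ Fintype.card J * Real.exp (- (Fintype.card J * t^2 / (8 * c^2 * n))) := by
  have hn' : (0:ℝ) < n := by exact_mod_cast hn
  set k := Fintype.card J
  set l : ℝ := - (t / (4 * c^2 * n)) with hl
  have hl0 : l ≤ 0 := by rw [hl]; simp; positivity
  have h1 : ∑ f : J → Equiv.Perm (Fin n), Real.exp (l * ∑ j, (g (f j) - pmean g)) ≤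
      (n.factorial : ℝ) ^ k * Real.exp (k * (2 * l^2 * c^2 * n)) := by
    have e : ∑ f : J → Equiv.Perm (Fin n), Real.exp (l * ∑ j, (g (f j) - pmean g)) = ∏ _j : J, ∑ σ, Real.exp (l * (g σ - pmean g)) := by
      rw [Finset.prod_univ_sum, Fintype.piFinset_univ]
      refine Finset.sum_congr rfl fun f _ => ?_
      rw [Finset.mul_sum, Real.exp_sum]
    rw [e, Finset.prod_const, Finset.card_univ, Real.exp_nat_mul, ← mul_pow]
    exact pow_le_pow_left₀ (Finset.sum_nonneg fun _ _ => (Real.exp_pos _).le) (perm_mgf n g c hc.le hg l) _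
  have h2 : ((Finset.univ.filter (fun f : J → Equiv.Perm (Fin n) => ∑ j, g (f j) ≤ k * (pmean g - t))).card : ℝ) * Real.exp (l * (-(k*t))) ≤
      ∑ f : J → Equiv.Perm (Fin n), Real.exp (l * ∑ j, (g (f j) - pmean g)) := by
    rw [← nsmul_eq_mul, ← Finset.sum_const]
    refine le_trans (Finset.sum_le_sum (fun f hf => ?_)) (Finset.sum_le_sum_of_subset_of_nonneg (Finset.filter_subset _ _) (fun _ _ _ => (Real.exp_pos _).le))
    have hf := (Finset.mem_filter.mp hf).2
    apply Real.exp_le_exp.mpr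
    refine mul_le_mul_of_nonpos_left ?_ hl0
    rw [Finset.sum_sub_distrib, Finset.sum_const, Finset.card_univ, nsmul_eq_mul]
    change _ - (k:ℝ) * _ ≤ _
    linarith
  have h3 := h2.trans h1
  rw [← le_div_iff₀ (Real.exp_pos _)] at h3
  refine h3.trans (le_of_eq ?_)
  rw [mul_div_assoc, ← Real.exp_sub]
  congr 2
  rw [hl]; field_simp; ring

lemma perm_two_trans {n : ℕ} {a b a' b' : Fin n} (h : a ≠ b) (h' : a' ≠ b') :
    ∃ ρ : Equiv.Perm (Fin n), ρ a = a' ∧ ρ b = b' := by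
  refine ⟨Equiv.swap (Equiv.swap a a' b) b' * Equiv.swap a a', ?_, ?_⟩
  · rw [Equiv.Perm.mul_apply, Equiv.swap_apply_left, Equiv.swap_apply_of_ne_of_ne _ h']
    intro hcon
    have : Equiv.swap a a' a = Equiv.swap a a' b := by rw [Equiv.swap_apply_left]; exact hcon
    exact h ((Equiv.swap a a').injective this)
  · rw [Equiv.Perm.mul_apply, Equiv.swap_apply_left]

lemma perm_sum_pair {n : ℕ} (F : Fin n → Fin n → ℝ) {a b : Fin n} (h : a ≠ b) :
    (n:ℝ) * (n - 1) * ∑ σ : Equiv.Perm (Fin n), F (σ a) (σ b) =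
      (n.factorial : ℝ) * ∑ p ∈ (Finset.univ : Finset (Fin n)).offDiag, F p.1 p.2 := by
  have h1 : ∀ p ∈ (Finset.univ : Finset (Fin n)).offDiag, ∑ σ : Equiv.Perm (Fin n), F (σ p.1) (σ p.2) = ∑ σ : Equiv.Perm (Fin n), F (σ a) (σ b) := by
    intro p hp
    obtain ⟨ρ, h1, h2⟩ := perm_two_trans h (Finset.mem_offDiag.mp hp).2.2
    rw [← Equiv.sum_comp (Equiv.mulRight ρ) (fun σ : Equiv.Perm (Fin n) => F (σ a) (σ b))]
    simp [h1, h2]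
  have h2 := Finset.sum_congr rfl h1
  rw [Finset.sum_const, nsmul_eq_mul, Finset.sum_comm] at h2
  have h3 : ∀ σ : Equiv.Perm (Fin n), ∑ p ∈ (Finset.univ : Finset (Fin n)).offDiag, F (σ p.1) (σ p.2) = ∑ p ∈ (Finset.univ : Finset (Fin n)).offDiag, F p.1 p.2 := by
    intro σ
    refine Finset.sum_nbij' (fun p => (σ p.1, σ p.2)) (fun p => (σ.symm p.1, σ.symm p.2)) ?_ ?_ ?_ ?_ ?_
    · intro p hp; simpa [Finset.mem_offDiag] using hp
    · intro p hp; simpa [Finset.mem_offDiag] using hp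
    · intro p _; simp
    · intro p _; simp
    · intro p _; simp
  rw [Finset.sum_congr rfl (fun σ _ => h3 σ), Finset.sum_const, Finset.card_univ, Fintype.card_perm, Fintype.card_fin, nsmul_eq_mul, Finset.offDiag_card] at h2
  rw [h2, Finset.card_univ, Fintype.card_fin, Nat.cast_sub (Nat.le_mul_self n)]
  push_cast; ring

lemma perm_sum_single {n : ℕ} (F : Fin n → ℝ) (a : Fin n) :
    (n:ℝ) * ∑ σ : Equiv.Perm (Fin n), F (σ a) = (n.factorial : ℝ) * ∑ s, F s := by
  have h1 : ∀ a' : Fin n, ∑ σ : Equiv.Perm (Fin n), F (σ a') = ∑ σ : Equiv.Perm (Fin n), F (σ a) := by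
    intro a'
    rw [← Equiv.sum_comp (Equiv.mulRight (Equiv.swap a a')) (fun σ : Equiv.Perm (Fin n) => F (σ a))]
    simp
  have h2 := Finset.sum_congr (rfl : (Finset.univ : Finset (Fin n)) = _) (fun a' _ => h1 a')
  rw [Finset.sum_const, nsmul_eq_mul, Finset.sum_comm] at h2
  have h3 : ∀ σ : Equiv.Perm (Fin n), ∑ a', F (σ a') = ∑ s, F s := fun σ => Equiv.sum_comp σ F
  rw [Finset.sum_congr rfl (fun σ _ => h3 σ), Finset.sum_const, Finset.card_univ, Fintype.card_perm, Fintype.card_fin, nsmul_eq_mul] at h2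
  rw [h2]; simp

open Filter

def mm (n : ℕ) : ℕ := Nat.findGreatest (fun m => m^33 ≤ n) n

lemma mm_pow_le (n : ℕ) : (mm n)^33 ≤ n := by
  unfold mm
  exact Nat.findGreatest_spec (P := fun m => m^33 ≤ n) (m := 0) (Nat.zero_le _) (by simp)

lemma lt_mm_succ_pow (n : ℕ) : n < (mm n + 1)^33 := by
  by_contra h
  push Not at h
  have h1 : mm n + 1 ≤ n := by
    refine le_trans ?_ h
    exact Nat.le_self_pow (by norm_num) _
  have := Nat.findGreatest_is_greatest (P := fun m => m^33 ≤ n) (n := n) (k := mm n + 1) (by unfold mm; omega) h1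
  exact this h

lemma mm_tendsto : Tendsto mm atTop atTop := by
  refine tendsto_atTop.mpr fun b => ?_
  filter_upwards [eventually_ge_atTop (b^33)] with n hn
  by_contra h
  push Not at h
  have := lt_mm_succ_pow n
  have h2 : (mm n + 1)^33 ≤ b^33 := Nat.pow_le_pow_left h 33
  omega

lemma log_le_mm (C : ℝ) (hC : 0 < C) : ∀ᶠ n : ℕ in atTop, (1 + Real.log n)^4 ≤ C * mm n := by
  -- via m
  have h1 : (fun x : ℝ => Real.log x) =o[atTop] (fun x : ℝ => x ^ (1/4 : ℝ)) := isLittleO_log_rpow_atTop (by norm_num)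
  have hc : (0:ℝ) < C^(1/4:ℝ) / 80 := by positivity
  have h2 := (h1.bound hc)
  have hmt : Tendsto (fun n => ((mm n : ℕ):ℝ)) atTop atTop := tendsto_natCast_atTop_atTop.comp mm_tendsto
  have h3 := hmt.eventually h2
  filter_upwards [h3, mm_tendsto.eventually_ge_atTop 3, eventually_ge_atTop 1] with n hn hm hn1
  have hmp : (3:ℝ) ≤ mm n := by exact_mod_cast hm
  have hnlt : (n:ℝ) < (2 * (mm n:ℝ))^33 := by
    have := lt_mm_succ_pow n
    have h4 : (mm n + 1)^33 ≤ (2 * mm n)^33 := Nat.pow_le_pow_left (by omega) 33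
    have : n < (2 * mm n)^33 := by omega
    exact_mod_cast this
  have hnp : (0:ℝ) < n := by exact_mod_cast hn1
  have hlog : Real.log n ≤ 33 * Real.log (2 * mm n) := by
    have := Real.log_le_log hnp hnlt.le
    rw [Real.log_pow] at this
    exact_mod_cast this
  have hlogm1 : 1 ≤ Real.log (mm n) := by
    rw [Real.le_log_iff_exp_le (by linarith)]
    exact (Real.exp_one_lt_d9.le.trans (by norm_num)).trans hmp
  rw [Real.log_mul (by norm_num) (by linarith)] at hlog
  have hl2 : Real.log 2 ≤ 1 := by
    have := Real.log_two_lt_d9; linarith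
  have hlog0 : 0 ≤ Real.log n := Real.log_nonneg (by exact_mod_cast hn1)
  have hle : 1 + Real.log n ≤ 80 * Real.log (mm n) := by linarith
  rw [Real.norm_of_nonneg (by linarith), Real.norm_of_nonneg (by positivity)] at hn
  have : 1 + Real.log n ≤ (C * mm n) ^ (1/4:ℝ) := by
    rw [Real.mul_rpow hC.le (by linarith)]
    calc _ ≤ 80 * Real.log (mm n) := hle
      _ ≤ 80 * (C^(1/4:ℝ) / 80 * (mm n:ℝ) ^ (1/4:ℝ)) := by linarith
      _ = _ := by ring
  calc (1 + Real.log n)^4 ≤ ((C * mm n) ^ (1/4:ℝ))^4 := pow_le_pow_left₀ (by linarith) this 4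
    _ = C * mm n := by
      rw [← Real.rpow_natCast, ← Real.rpow_mul (by positivity)]; norm_num

/-- union bound over embeddings and an index type -/
lemma transfer_union {n : ℕ} (hn : 2 ≤ n) {J T : Type} [Fintype J] [Fintype T] (κ : ℕ) (hJ : Fintype.card J = κ) (hκ : 2 * κ ≤ n)
    (Bad : T → Finset (J → Equiv.Perm (Fin n))) (β : ℝ) (hβ : 0 ≤ β) (hB : ∀ t, ((Bad t).card : ℝ) ≤ β * (n.factorial : ℝ)^κ) :
    (((latP n).filter (fun f => ∃ e : J ↪ Fin n, ∃ t, (fun j => f (e j)) ∈ Bad t)).card : ℝ) ≤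
      (n:ℝ)^κ * Fintype.card T * β * Real.exp ((κ:ℝ)^2 + 2 * n * (1 + Real.log n)^2) * ((latP n).card : ℝ) := by
  have hsub : (latP n).filter (fun f => ∃ e : J ↪ Fin n, ∃ t, (fun j => f (e j)) ∈ Bad t) ⊆
      (Finset.univ : Finset ((J ↪ Fin n) × T)).biUnion (fun p => (latP n).filter (fun f => (fun j => f (p.1 j)) ∈ Bad p.2)) := by
    intro f hf
    obtain ⟨h1, e, t, h2⟩ := Finset.mem_filter.mp hf
    exact Finset.mem_biUnion.mpr ⟨(e, t), Finset.mem_univ _, Finset.mem_filter.mpr ⟨h1, h2⟩⟩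
  have h1 := (Finset.card_le_card hsub).trans Finset.card_biUnion_le
  have h2 : (((latP n).filter (fun f => ∃ e : J ↪ Fin n, ∃ t, (fun j => f (e j)) ∈ Bad t)).card : ℝ) ≤
      ∑ p : (J ↪ Fin n) × T, (((latP n).filter (fun f => (fun j => f (p.1 j)) ∈ Bad p.2)).card : ℝ) := by
    exact_mod_cast h1
  refine h2.trans ?_
  set X := β * Real.exp ((κ:ℝ)^2 + 2 * n * (1 + Real.log n)^2) * ((latP n).card : ℝ) with hX
  have hX0 : 0 ≤ X := by positivity
  have h3 : ∀ p : (J ↪ Fin n) × T, (((latP n).filter (fun f => (fun j => f (p.1 j)) ∈ Bad p.2)).card : ℝ) ≤ X := by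
    intro p
    refine (transfer hn κ hJ hκ p.1 (Bad p.2)).trans ?_
    rw [hX]
    refine mul_le_mul_of_nonneg_right (mul_le_mul_of_nonneg_right ?_ (Real.exp_pos _).le) (by positivity)
    rw [div_le_iff₀ (by positivity)]
    exact hB _
  refine (Finset.sum_le_sum fun p _ => h3 p).trans ?_
  rw [Finset.sum_const, nsmul_eq_mul, Finset.card_univ, Fintype.card_prod]
  have h4 : ((Fintype.card (J ↪ Fin n) : ℕ):ℝ) ≤ (n:ℝ)^κ := by
    have : Fintype.card (J ↪ Fin n) ≤ n^κ := by
      rw [Fintype.card_embedding_eq, hJ, Fintype.card_fin]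
      exact Nat.descFactorial_le_pow n κ
    exact_mod_cast this
  push_cast
  calc _ ≤ (n:ℝ)^κ * Fintype.card T * X := by
        refine mul_le_mul_of_nonneg_right (mul_le_mul_of_nonneg_right h4 (by positivity)) hX0
    _ = _ := by rw [hX]; ring

lemma exists_low_subset {ι : Type*} (g : ι → ℝ) (k : ℕ) : ∀ (j : ℕ) (A : Finset ι), A.card = k + j →
    ∃ A' ⊆ A, A'.card = k ∧ (A.card:ℝ) * ∑ r ∈ A', g r ≤ k * ∑ r ∈ A, g r := by
  intro j
  induction j with
  | zero => intro A hA; exact ⟨A, subset_rfl, by simpa using hA, by rw [hA]; simp⟩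
  | succ j ih =>
    intro A hA
    obtain ⟨r, hr, hmax⟩ := Finset.exists_max_image A g (Finset.card_pos.mp (by omega))
    obtain ⟨A', h1, h2, h3⟩ := ih (A.erase r) (by rw [Finset.card_erase_of_mem hr]; omega)
    refine ⟨A', h1.trans (Finset.erase_subset _ _), h2, ?_⟩
    have hc : ((A.erase r).card : ℝ) = k + j := by
      rw [Finset.card_erase_of_mem hr, hA]; push_cast [show k + (j+1) - 1 = k + j by omega]; rfl
    have hs : ∑ r ∈ A, g r = ∑ x ∈ A.erase r, g x + g r := (Finset.sum_erase_add A g hr).symm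
    rw [hc] at h3
    rw [hA]; push_cast
    have hle : ∑ x ∈ A.erase r, g x ≤ (k + j) * g r := by
      rw [← hc, ← nsmul_eq_mul, ← Finset.sum_const]
      exact Finset.sum_le_sum fun x hx => hmax x (Finset.mem_of_mem_erase hx)
    set S := ∑ x ∈ A.erase r, g x
    set S' := ∑ x ∈ A', g x
    rw [hs]
    rcases Nat.eq_zero_or_pos (k + j) with h0 | h0
    · have hk : k = 0 := by omega
      have : S' = 0 := by
        have : A' = ∅ := Finset.card_eq_zero.mp (by omega)
        simp [S', this]
      rw [this, hk]; simp
    · have hkj : (0:ℝ) < k + j := by exact_mod_cast h0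
      have hk0 : (0:ℝ) ≤ k := by positivity
      have : (k + j:ℝ) * ((k + (j+1)) * S') ≤ (k+j) * (k * (S + g r)) := by
        calc (k + j:ℝ) * ((k + (j+1)) * S') = (k + (j+1)) * ((k+j) * S') := by ring
          _ ≤ (k + (j+1)) * (k * S) := mul_le_mul_of_nonneg_left h3 (by linarith)
          _ = k * ((k+j) * S + S) := by ring
          _ ≤ k * ((k+j) * S + (k+j) * g r) := mul_le_mul_of_nonneg_left (by linarith) hk0
          _ = _ := by ring
      exact le_of_mul_le_mul_left this hkj

def hitBC {n : ℕ} (B C : Finset (Fin n)) (σ : Equiv.Perm (Fin n)) : ℝ := ((B.filter (fun c => σ c ∈ C)).card : ℝ)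

lemma hitBC_eq {n : ℕ} (B C : Finset (Fin n)) (σ : Equiv.Perm (Fin n)) :
    hitBC B C σ = ∑ c ∈ B, if σ c ∈ C then (1:ℝ) else 0 := by
  simp [hitBC]

lemma hitBC_mean {n : ℕ} (hn : 0 < n) (B C : Finset (Fin n)) : pmean (hitBC B C) = (B.card:ℝ) * C.card / n := by
  have hn' : (0:ℝ) < n := by exact_mod_cast hn
  have h : (n:ℝ) * ∑ σ, hitBC B C σ = n.factorial * (B.card * C.card) := by
    simp only [hitBC_eq]
    rw [Finset.sum_comm, Finset.mul_sum]
    have : ∀ c ∈ B, (n:ℝ) * ∑ σ : Equiv.Perm (Fin n), (if σ c ∈ C then (1:ℝ) else 0) = n.factorial * C.card := by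
      intro c _
      rw [perm_sum_single (fun s => if s ∈ C then (1:ℝ) else 0) c]
      simp
    rw [Finset.sum_congr rfl this, Finset.sum_const, nsmul_eq_mul]; ring
  unfold pmean
  have hf : (0:ℝ) < n.factorial := by positivity
  field_simp
  linarith

/-- A function of the permutation changes only at the two points sent to a, b. -/
lemma hitBC_lip {n : ℕ} (B C : Finset (Fin n)) : SwapLip 2 (hitBC B C) := by
  intro a b σ
  rw [hitBC_eq, hitBC_eq, ← Finset.sum_sub_distrib]
  refine (Finset.abs_sum_le_sum_abs _ _).trans ?_
  have h1 : ∀ c ∈ B, |((if (Equiv.swap a b * σ) c ∈ C then (1:ℝ) else 0) - if σ c ∈ C then 1 else 0)| ≤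
      (if c = σ.symm a then 1 else 0) + (if c = σ.symm b then 1 else 0) := by
    intro c _
    by_cases ha : c = σ.symm a
    · rw [if_pos ha]
      have : (0:ℝ) ≤ if c = σ.symm b then 1 else 0 := by split_ifs <;> norm_num
      refine le_trans ?_ (le_add_of_nonneg_right this)
      split_ifs <;> norm_num
    · by_cases hb : c = σ.symm b
      · rw [if_pos hb]
        have : (0:ℝ) ≤ if c = σ.symm a then 1 else 0 := by split_ifs <;> norm_num
        refine le_trans ?_ (le_add_of_nonneg_left this)
        split_ifs <;> norm_num
      · have hca : σ c ≠ a := fun h => ha (by rw [← h]; simp)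
        have hcb : σ c ≠ b := fun h => hb (by rw [← h]; simp)
        rw [Equiv.Perm.mul_apply, Equiv.swap_apply_of_ne_of_ne hca hcb]
        simp [ha, hb]
  refine (Finset.sum_le_sum h1).trans ?_
  rw [Finset.sum_add_distrib]
  simp only [Finset.sum_ite_eq']
  split_ifs <;> norm_num

def eABC {n : ℕ} (f : Fin n → Equiv.Perm (Fin n)) (A B C : Finset (Fin n)) : ℕ :=
  ((A ×ˢ B).filter (fun p => f p.1 p.2 ∈ C)).card

lemma eABC_eq {n : ℕ} (f : Fin n → Equiv.Perm (Fin n)) (A B C : Finset (Fin n)) :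
    (eABC f A B C : ℝ) = ∑ r ∈ A, hitBC B C (f r) := by
  unfold eABC
  rw [Finset.card_filter, Finset.sum_product]
  push_cast
  refine Finset.sum_congr rfl fun r _ => ?_
  rw [hitBC_eq]

def DiscP (n : ℕ) (η : ℝ) (f : Fin n → Equiv.Perm (Fin n)) : Prop :=
  ∀ A B C : Finset (Fin n), n ≤ A.card * (mm n)^4 → n ≤ B.card * (mm n)^4 → n ≤ C.card * (mm n)^4 →
    (1 - η) * A.card * B.card * C.card / n ≤ eABC f A B C

lemma disc_num (η ε : ℝ) (hη : 0 < η) (hη1 : η < 1) (hε : 0 < ε) : ∀ᶠ n : ℕ in atTop, ∃ k : ℕ, 0 < k ∧ k * (mm n)^4 ≤ n ∧ 2 * k ≤ n ∧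
    (n:ℝ)^k * 4^n * Real.exp (-(k * η^2 * n / (32 * (mm n)^16))) * Real.exp ((k:ℝ)^2 + 2 * n * (1 + Real.log n)^2) ≤ ε := by
  set C : ℝ := η^4 / 2^20 with hCdef
  have hC : 0 < C := by positivity
  filter_upwards [log_le_mm C hC, mm_tendsto.eventually_ge_atTop 2, eventually_ge_atTop 2,
    eventually_ge_atTop (⌈Real.log (1/ε)⌉₊), mm_tendsto.eventually_ge_atTop ⌈(256/η^2)⌉₊] with n hlog hm hn hnε hmη
  have hmp : (2:ℝ) ≤ mm n := by exact_mod_cast hm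
  have hm0 : (0:ℝ) < mm n := by linarith
  have hm33 : ((mm n:ℝ))^33 ≤ n := by exact_mod_cast mm_pow_le n
  have hn0 : (0:ℝ) < n := by positivity
  set a : ℝ := η^2 * n / (128 * (mm n:ℝ)^16) with ha
  have hmη' : 256 / η^2 ≤ mm n := (Nat.le_ceil _).trans (by exact_mod_cast hmη)
  have ha2 : 2 ≤ a := by
    rw [ha, le_div_iff₀ (by positivity)]
    rw [div_le_iff₀ (by positivity)] at hmη'
    have h17 : (mm n:ℝ)^16 * (mm n) ≤ n := by
      calc (mm n:ℝ)^16 * (mm n) = (mm n:ℝ)^17 := by ring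
        _ ≤ (mm n:ℝ)^33 := pow_le_pow_right₀ (by linarith) (by norm_num)
        _ ≤ n := hm33
    calc 2 * (128 * (mm n:ℝ)^16) = 256 * (mm n:ℝ)^16 := by ring
      _ ≤ (mm n * η^2) * (mm n:ℝ)^16 := mul_le_mul_of_nonneg_right hmη' (by positivity)
      _ = η^2 * ((mm n:ℝ)^16 * mm n) := by ring
      _ ≤ η^2 * n := mul_le_mul_of_nonneg_left h17 (by positivity)
  set k := ⌊a⌋₊ with hk
  have hka : (k:ℝ) ≤ a := Nat.floor_le (by linarith)
  have hka2 : a / 2 ≤ k := by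
    have := Nat.lt_floor_add_one a
    have h1 : a < k + 1 := this
    linarith
  have hkm : (k:ℝ) * (mm n:ℝ)^4 ≤ n / 2 := by
    calc (k:ℝ) * (mm n:ℝ)^4 ≤ a * (mm n:ℝ)^4 := mul_le_mul_of_nonneg_right hka (by positivity)
      _ = η^2 * n / 128 * ((mm n:ℝ)^4 / (mm n:ℝ)^16) := by rw [ha]; field_simp
      _ ≤ 1 * n / 128 * 1 := by
          have h1 : (mm n:ℝ)^4 / (mm n:ℝ)^16 ≤ 1 := by
            rw [div_le_one (by positivity)]
            exact pow_le_pow_right₀ (by linarith) (by norm_num)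
          have h2 : η^2 ≤ 1 := by nlinarith
          have h3 : η^2 * n / 128 ≤ 1 * n / 128 := by
            refine div_le_div_of_nonneg_right (mul_le_mul_of_nonneg_right h2 hn0.le) (by norm_num)
          exact mul_le_mul h3 h1 (by positivity) (by positivity)
      _ ≤ n / 2 := by linarith
  have hm4 : (1:ℝ) ≤ (mm n:ℝ)^4 := one_le_pow₀ (by linarith)
  have hkn : (k:ℝ) ≤ n/2 := by
    have : (k:ℝ) * 1 ≤ k * (mm n:ℝ)^4 := mul_le_mul_of_nonneg_left hm4 (by positivity)
    linarith
  refine ⟨k, ?_, ?_, ?_, ?_⟩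
  · have : (0:ℝ) < k := by linarith
    exact_mod_cast this
  · have : (k:ℝ) * (mm n:ℝ)^4 ≤ n := by linarith
    exact_mod_cast this
  · have : 2 * (k:ℝ) ≤ n := by linarith
    exact_mod_cast this
  · have hnexp : (n:ℝ)^k = Real.exp (k * Real.log n) := by
      rw [mul_comm, Real.exp_mul, Real.exp_log hn0, Real.rpow_natCast]
    have h4 : (4:ℝ)^n ≤ Real.exp (n * 2) := by
      rw [mul_comm, Real.exp_mul, Real.rpow_natCast]
      refine pow_le_pow_left₀ (by norm_num) ?_ _
      have := Real.add_one_le_exp (1:ℝ)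
      have e : Real.exp 2 = Real.exp 1 * Real.exp 1 := by rw [← Real.exp_add]; norm_num
      rw [e]; nlinarith
    have hεe : Real.exp (-(n:ℝ)) ≤ ε := by
      have h1 : Real.log (1/ε) ≤ n := (Nat.le_ceil _).trans (by exact_mod_cast hnε)
      rw [one_div, Real.log_inv] at h1
      calc Real.exp (-(n:ℝ)) ≤ Real.exp (Real.log ε) := Real.exp_le_exp.mpr (by linarith)
        _ = ε := Real.exp_log hε
    refine le_trans ?_ hεe
    have hlog0 : 0 ≤ Real.log n := Real.log_nonneg (by exact_mod_cast (by omega : 1 ≤ n))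
    calc _ ≤ Real.exp (k * Real.log n) * Real.exp (n * 2) * Real.exp (-(k * η^2 * n / (32 * (mm n)^16))) * Real.exp ((k:ℝ)^2 + 2 * n * (1 + Real.log n)^2) := by
          rw [hnexp]; gcongr
      _ ≤ _ := by
          rw [← Real.exp_add, ← Real.exp_add, ← Real.exp_add]
          apply Real.exp_le_exp.mpr
          have e1 : (k:ℝ) * η^2 * n / (32 * (mm n:ℝ)^16) = 4 * k * a := by rw [ha]; field_simp; ring
          rw [e1]
          have hk2 : (k:ℝ)^2 ≤ k * a := by nlinarith
          have hka3 : a^2/2 ≤ k * a := by nlinarith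
          have ha3 : 16 * C * n * mm n ≤ a^2 / 2 := by
            have e2 : a^2/2 = (η^4/2^15) * n * (n / (mm n:ℝ)^32) := by rw [ha]; field_simp; ring
            rw [e2]
            have : (mm n:ℝ) ≤ n / (mm n:ℝ)^32 := by
              rw [le_div_iff₀ (by positivity)]
              have e33 : (mm n:ℝ) * (mm n:ℝ)^32 = (mm n:ℝ)^33 := by ring
              rw [e33]; exact_mod_cast hm33
            have e3 : 16 * C = η^4/2^16 := by rw [hCdef]; ring
            rw [e3]
            have h5 : η^4/2^16 * n ≤ η^4/2^15 * n := by
              refine mul_le_mul_of_nonneg_right ?_ hn0.le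
              refine div_le_div_of_nonneg_left (by positivity) (by norm_num) (by norm_num)
            exact mul_le_mul h5 this hm0.le (by positivity)
          set x := 1 + Real.log n with hx
          have hx1 : 1 ≤ x := by linarith
          have hx4 : x^2 ≤ x^4 := pow_le_pow_right₀ hx1 (by norm_num)
          have hx44 : x ≤ x^4 := le_self_pow₀ hx1 (by norm_num)
          have h6 : (n:ℝ) * x^4 ≤ n * (C * mm n) := mul_le_mul_of_nonneg_left hlog hn0.le
          have h7 : (k:ℝ) * Real.log n ≤ n * x^4 := by
            refine mul_le_mul (by linarith) (by linarith) hlog0 hn0.le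
          have h8 : 2 * n * x^2 ≤ 2 * (n * x^4) := by
            rw [mul_assoc]
            exact mul_le_mul_of_nonneg_left (mul_le_mul_of_nonneg_left hx4 hn0.le) (by norm_num)
          have h10 : (n:ℝ) ≤ n * x^4 := le_mul_of_one_le_right hn0.le (hx1.trans hx44)
          have h9 : (n:ℝ) * 2 ≤ 2 * (n * x^4) := by linarith
          have e16 : 16 * C * n * mm n = 16 * (n * (C * mm n)) := by ring
          have e4 : 4 * (k:ℝ) * a = 4 * (k * a) := by ring
          have hX0 : 0 ≤ (n:ℝ) * x^4 := by positivity
          rw [e16] at ha3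
          rw [e4]
          linarith

theorem disc_aas (η ε : ℝ) (hη : 0 < η) (hη1 : η < 1) (hε : 0 < ε) : ∀ᶠ n : ℕ in atTop,
    (((latP n).filter (fun f => ¬ DiscP n η f)).card : ℝ) ≤ ε * ((latP n).card : ℝ) := by
  filter_upwards [disc_num η ε hη hη1 hε, eventually_ge_atTop 2, mm_tendsto.eventually_ge_atTop 2] with n ⟨k, hk0, hkm, hkn, hnum⟩ hn hm
  have hn0 : (0:ℝ) < n := by positivity
  have hm0 : (0:ℝ) < mm n := by positivity
  set β := Real.exp (-(k * η^2 * n / (32 * (mm n)^16))) with hβ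
  set T := {p : Finset (Fin n) × Finset (Fin n) // n ≤ p.1.card * (mm n)^4 ∧ n ≤ p.2.card * (mm n)^4} with hT
  set Bad : T → Finset (Fin k → Equiv.Perm (Fin n)) := fun t =>
    Finset.univ.filter (fun f => ∑ j, hitBC t.1.1 t.1.2 (f j) ≤ Fintype.card (Fin k) * (pmean (hitBC t.1.1 t.1.2) - η * pmean (hitBC t.1.1 t.1.2))) with hBad
  have hB : ∀ t, ((Bad t).card : ℝ) ≤ β * (n.factorial : ℝ)^k := by
    intro t
    have hb := t.2.1
    have hc := t.2.2
    have hmean := hitBC_mean (by omega : 0 < n) t.1.1 t.1.2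
    have hmean0 : 0 ≤ pmean (hitBC t.1.1 t.1.2) := by rw [hmean]; positivity
    have := perm_tail (J := Fin k) (by omega : 0 < n) (hitBC t.1.1 t.1.2) 2 (by norm_num) (hitBC_lip _ _) (η * pmean (hitBC t.1.1 t.1.2)) (by positivity)
    refine le_trans (le_of_eq (by simp only [hBad]; congr!)) (this.trans ?_)
    rw [mul_comm, Fintype.card_fin]
    refine mul_le_mul_of_nonneg_right ?_ (by positivity)
    apply Real.exp_le_exp.mpr
    apply neg_le_neg
    have hlow : (n:ℝ) / (mm n)^8 ≤ pmean (hitBC t.1.1 t.1.2) := by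
      rw [hmean, div_le_div_iff₀ (by positivity) hn0]
      have h1 : (n:ℝ) ≤ t.1.1.card * (mm n:ℝ)^4 := by exact_mod_cast hb
      have h2 : (n:ℝ) ≤ t.1.2.card * (mm n:ℝ)^4 := by exact_mod_cast hc
      calc (n:ℝ) * n ≤ (t.1.1.card * (mm n:ℝ)^4) * (t.1.2.card * (mm n:ℝ)^4) := mul_le_mul h1 h2 hn0.le (by positivity)
        _ = _ := by ring
    have hsq : ((n:ℝ) / (mm n)^8)^2 ≤ (pmean (hitBC t.1.1 t.1.2))^2 := pow_le_pow_left₀ (by positivity) hlow 2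
    have e1 : (k:ℝ) * η^2 * n / (32 * (mm n:ℝ)^16) = k * η^2 * ((n:ℝ) / (mm n)^8)^2 / (8 * 2^2 * n) := by
      field_simp; ring
    rw [e1]
    refine div_le_div_of_nonneg_right ?_ (by positivity)
    rw [mul_pow, mul_assoc]
    refine mul_le_mul_of_nonneg_left (mul_le_mul_of_nonneg_left hsq (by positivity)) (by positivity)
  have htr := transfer_union hn k (Fintype.card_fin k) hkn Bad β (Real.exp_pos _).le hB
  have hcT : (Fintype.card T : ℝ) ≤ 4^n := by
    have : Fintype.card T ≤ Fintype.card (Finset (Fin n) × Finset (Fin n)) := Fintype.card_subtype_le _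
    rw [Fintype.card_prod, Fintype.card_finset, Fintype.card_fin, ← mul_pow] at this
    exact_mod_cast this
  have hsub : (latP n).filter (fun f => ¬ DiscP n η f) ⊆ (latP n).filter (fun f => ∃ e : Fin k ↪ Fin n, ∃ t, (fun j => f (e j)) ∈ Bad t) := by
    intro f hf
    obtain ⟨hf1, hf2⟩ := Finset.mem_filter.mp hf
    refine Finset.mem_filter.mpr ⟨hf1, ?_⟩
    unfold DiscP at hf2
    push Not at hf2
    obtain ⟨A, B, C, hA, hB', hC', hlt⟩ := hf2
    have hkA : k ≤ A.card := by
      by_contra hcon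
      push Not at hcon
      have hm4 : 0 < (mm n)^4 := by positivity
      have : A.card * (mm n)^4 < k * (mm n)^4 := Nat.mul_lt_mul_of_pos_right hcon hm4
      omega
    obtain ⟨A', h1, h2, h3⟩ := exists_low_subset (fun r => hitBC B C (f r)) k (A.card - k) A (by omega)
    refine ⟨(A'.orderEmbOfFin h2).toEmbedding, ⟨(B, C), hB', hC'⟩, ?_⟩
    simp only [hBad, Finset.mem_filter, Finset.mem_univ, true_and, Fintype.card_fin]
    have hsumeq : ∑ j : Fin k, hitBC B C (f ((A'.orderEmbOfFin h2).toEmbedding j)) = ∑ r ∈ A', hitBC B C (f r) := by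
      conv_rhs => rw [← Finset.map_orderEmbOfFin_univ A' h2]
      rw [Finset.sum_map]
    rw [hsumeq, hitBC_mean (by omega : 0 < n)]
    rw [eABC_eq] at hlt
    have hAp : (0:ℝ) < A.card := by exact_mod_cast (by omega : 0 < A.card)
    refine le_of_mul_le_mul_left ?_ hAp
    refine h3.trans ?_
    have := mul_le_mul_of_nonneg_left hlt.le (by positivity : (0:ℝ) ≤ k)
    refine this.trans (le_of_eq ?_)
    ring
  refine le_trans (Nat.cast_le.mpr (Finset.card_le_card hsub)) (htr.trans ?_)
  refine mul_le_mul_of_nonneg_right (le_trans ?_ hnum) (by positivity)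
  gcongr

/-- sequential growth of unions of random sets -/
lemma growth {Ω X : Type} [Fintype Ω] (img : Ω → Finset X) (H : ℕ) (a δ : ℝ) (ha : 0 ≤ a) (hδ0 : 0 ≤ δ) (hδ1 : δ ≤ 1)
    (hyp : ∀ Φ : Finset X, Φ.card ≤ H → ((Finset.univ.filter (fun σ => ((img σ \ Φ).card : ℝ) < a)).card : ℝ) ≤ δ * Fintype.card Ω) :
    ∀ (k j : ℕ) (Φ : Finset X),
    ((Finset.univ.filter (fun G : Fin k → Ω => (Φ ∪ Finset.univ.biUnion (fun i => img (G i))).card ≤ H ∧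
      ((Φ ∪ Finset.univ.biUnion (fun i => img (G i))).card : ℝ) < Φ.card + j * a)).card : ℝ) ≤
      (Fintype.card Ω : ℝ)^k * 2^k * δ^(k - j) := by
  intro k
  induction k with
  | zero =>
    intro j Φ
    simp only [Nat.zero_sub, pow_zero, mul_one]
    exact_mod_cast (Finset.card_le_univ _).trans (by simp)
  | succ k ih =>
    intro j Φ
    by_cases hΦ : Φ.card ≤ H
    swap
    · rw [Finset.filter_false_of_mem]
      · simp only [Finset.card_empty, Nat.cast_zero]; positivity
      · intro G _ h
        exact hΦ ((Finset.card_le_card Finset.subset_union_left).trans h.1)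
    -- split by first coordinate
    set S := fun (k j : ℕ) (Φ : Finset X) => Finset.univ.filter (fun G : Fin k → Ω => (Φ ∪ Finset.univ.biUnion (fun i => img (G i))).card ≤ H ∧
      ((Φ ∪ Finset.univ.biUnion (fun i => img (G i))).card : ℝ) < Φ.card + j * a) with hS
    have hfib : ((S (k+1) j Φ).card : ℝ) ≤ ∑ σ : Ω, (((S (k+1) j Φ).filter (fun G => G 0 = σ)).card : ℝ) := by
      rw [Finset.card_eq_sum_card_fiberwise (f := fun G => G 0) (t := Finset.univ) (fun _ _ => Finset.mem_univ _)]
      push_cast; exact le_rfl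
    have hun : ∀ (G : Fin (k+1) → Ω), Φ ∪ Finset.univ.biUnion (fun i => img (G i)) = (Φ ∪ img (G 0)) ∪ Finset.univ.biUnion (fun i => img (Fin.tail G i)) := by
      intro G
      ext z
      simp only [Finset.mem_union, Finset.mem_biUnion, Finset.mem_univ, true_and, Fin.exists_fin_succ, Fin.tail]
      tauto
    have hgen : ∀ (σ : Ω) (j' : ℕ), (Φ.card : ℝ) + j * a ≤ (Φ ∪ img σ).card + j' * a →
        (((S (k+1) j Φ).filter (fun G => G 0 = σ)).card : ℝ) ≤ (Fintype.card Ω : ℝ)^k * 2^k * δ^(k - j') := by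
      intro σ j' hj'
      refine le_trans ?_ (ih j' (Φ ∪ img σ))
      have : ((S (k+1) j Φ).filter (fun G => G 0 = σ)).card ≤ (S k j' (Φ ∪ img σ)).card := by
        refine Finset.card_le_card_of_injOn Fin.tail ?_ ?_
        · intro G hG
          simp only [hS, Finset.coe_filter, Finset.mem_filter, Finset.mem_univ, true_and, Set.mem_ofPred_eq] at hG ⊢
          obtain ⟨⟨h1, h2⟩, rfl⟩ := hG
          rw [hun] at h1 h2
          exact ⟨h1, lt_of_lt_of_le h2 hj'⟩
        · intro G hG G' hG' h
          have h1 := (Finset.mem_filter.mp hG).2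
          have h2 := (Finset.mem_filter.mp hG').2
          rw [← Fin.cons_self_tail G, ← Fin.cons_self_tail G', h1, h2, h]
      refine le_trans (Nat.cast_le.mpr this) (le_of_eq ?_)
      simp only [hS]
    have hcard : ∀ σ, ((Φ ∪ img σ).card : ℝ) = Φ.card + (img σ \ Φ).card := by
      intro σ
      rw [← Finset.union_sdiff_self_eq_union, Finset.card_union_of_disjoint Finset.disjoint_sdiff]
      push_cast; rfl
    set N : ℝ := (Fintype.card Ω : ℝ)^k * 2^k with hN
    have hN0 : 0 ≤ N := by positivity
    have hsplit : ∀ σ : Ω, (((S (k+1) j Φ).filter (fun G => G 0 = σ)).card : ℝ) ≤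
        (if ((img σ \ Φ).card : ℝ) < a then N * δ^(k - j) else 0) + N * δ^(k+1-j) := by
      intro σ
      split_ifs with h
      · have := hgen σ j (by rw [hcard]; linarith [(Nat.cast_nonneg (img σ \ Φ).card : (0:ℝ) ≤ _)])
        have h0 : 0 ≤ N * δ^(k+1-j) := by positivity
        linarith
      · push Not at h
        rw [zero_add]
        rcases j with _ | j'
        · rw [Finset.filter_false_of_mem]
          · simp only [Finset.card_empty, Nat.cast_zero]; positivity
          · intro G hG
            simp only [hS, Finset.mem_filter, Finset.mem_univ, true_and] at hG
            have h1 := hG.2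
            have h2 : (Φ.card : ℝ) ≤ (Φ ∪ Finset.univ.biUnion (fun i => img (G i))).card := by
              exact_mod_cast Finset.card_le_card Finset.subset_union_left
            exfalso
            simp only [Nat.cast_zero, zero_mul, add_zero] at h1
            linarith
        · have := hgen σ j' (by rw [hcard]; push_cast; linarith)
          rwa [Nat.add_sub_add_right]
    have hsum : ((S (k+1) j Φ).card : ℝ) ≤ (δ * Fintype.card Ω) * (N * δ^(k-j)) + Fintype.card Ω * (N * δ^(k+1-j)) := by
      refine hfib.trans ((Finset.sum_le_sum (fun σ _ => hsplit σ)).trans ?_)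
      rw [Finset.sum_add_distrib, ← Finset.sum_filter, Finset.sum_const, Finset.sum_const, nsmul_eq_mul, nsmul_eq_mul, Finset.card_univ]
      have := mul_le_mul_of_nonneg_right (hyp Φ hΦ) (by positivity : 0 ≤ N * δ^(k-j))
      linarith
    have hδp : δ * δ^(k-j) ≤ δ^(k+1-j) := by
      by_cases hkj : j ≤ k
      · rw [Nat.succ_sub hkj, pow_succ']
      · have : k + 1 - j = 0 := by omega
        have h2 : k - j = 0 := by omega
        rw [this, h2]; simpa using hδ1
    calc ((S (k+1) j Φ).card : ℝ) ≤ _ := hsum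
      _ = Fintype.card Ω * N * (δ * δ^(k-j)) + Fintype.card Ω * N * δ^(k+1-j) := by ring
      _ ≤ Fintype.card Ω * N * δ^(k+1-j) + Fintype.card Ω * N * δ^(k+1-j) := by
          have := mul_le_mul_of_nonneg_left hδp (by positivity : 0 ≤ Fintype.card Ω * N)
          linarith
      _ = _ := by rw [hN]; ring

/-- pair statistics of a permutation -/
def pairg {n : ℕ} {ι : Type} (I : Finset ι) (a b : ι → Fin n) (S : ι → Finset (Fin n × Fin n)) (σ : Equiv.Perm (Fin n)) : ℝ :=
  ∑ i ∈ I, if (σ (a i), σ (b i)) ∈ S i then 1 else 0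

lemma pairg_mean {n : ℕ} (hn : 2 ≤ n) {ι : Type} (I : Finset ι) (a b : ι → Fin n) (S : ι → Finset (Fin n × Fin n))
    (hab : ∀ i ∈ I, a i ≠ b i) (hS : ∀ i ∈ I, ∀ q ∈ S i, q.1 ≠ q.2) :
    pmean (pairg I a b S) = (∑ i ∈ I, ((S i).card : ℝ)) / (n * (n - 1)) := by
  have hn1 : (0:ℝ) < n * (n - 1) := by
    have : (2:ℝ) ≤ n := by exact_mod_cast hn
    apply mul_pos <;> linarith
  unfold pmean pairg
  rw [Finset.sum_comm, div_eq_div_iff (by positivity) hn1.ne', Finset.sum_mul, Finset.sum_mul]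
  refine Finset.sum_congr rfl fun i hi => ?_
  have := perm_sum_pair (fun u v => if (u, v) ∈ S i then (1:ℝ) else 0) (hab i hi)
  rw [mul_comm, this, mul_comm]
  congr 1
  rw [← Finset.sum_filter, Finset.sum_const, nsmul_eq_mul, mul_one]
  congr 2
  ext q
  simp only [Finset.mem_filter, Finset.mem_offDiag, Finset.mem_univ, true_and]
  exact ⟨fun h => h.2, fun h => ⟨hS i hi q h, h⟩⟩

lemma pairg_lip {n : ℕ} {ι : Type} (I : Finset ι) (a b : ι → Fin n) (S : ι → Finset (Fin n × Fin n)) (D : ℕ)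
    (ha : ∀ z, (I.filter (fun i => a i = z)).card ≤ D) (hb : ∀ z, (I.filter (fun i => b i = z)).card ≤ D) :
    SwapLip (4 * D) (pairg I a b S) := by
  intro u v σ
  unfold pairg
  rw [← Finset.sum_sub_distrib]
  refine (Finset.abs_sum_le_sum_abs _ _).trans ?_
  set U := (I.filter (fun i => a i = σ⁻¹ u) ∪ I.filter (fun i => a i = σ⁻¹ v)) ∪ (I.filter (fun i => b i = σ⁻¹ u) ∪ I.filter (fun i => b i = σ⁻¹ v)) with hU
  have hUc : U.card ≤ 4 * D := by
    refine (Finset.card_union_le _ _).trans ?_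
    have h1 := (Finset.card_union_le (I.filter (fun i => a i = σ⁻¹ u)) (I.filter (fun i => a i = σ⁻¹ v)))
    have h2 := (Finset.card_union_le (I.filter (fun i => b i = σ⁻¹ u)) (I.filter (fun i => b i = σ⁻¹ v)))
    have := ha (σ⁻¹ u); have := ha (σ⁻¹ v); have := hb (σ⁻¹ u); have := hb (σ⁻¹ v)
    omega
  have hle : ∀ i ∈ I, |(if ((Equiv.swap u v * σ) (a i), (Equiv.swap u v * σ) (b i)) ∈ S i then (1:ℝ) else 0) - (if (σ (a i), σ (b i)) ∈ S i then 1 else 0)| ≤ if i ∈ U then 1 else 0 := by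
    intro i hi
    by_cases hiU : i ∈ U
    · rw [if_pos hiU]
      split_ifs <;> norm_num
    · rw [if_neg hiU]
      simp only [hU, Finset.mem_union, Finset.mem_filter, hi, true_and, not_or] at hiU
      have e1 : (Equiv.swap u v * σ) (a i) = σ (a i) := by
        rw [Equiv.Perm.mul_apply]
        apply Equiv.swap_apply_of_ne_of_ne
        · intro h; exact hiU.1.1 (by rw [← h]; simp)
        · intro h; exact hiU.1.2 (by rw [← h]; simp)
      have e2 : (Equiv.swap u v * σ) (b i) = σ (b i) := by
        rw [Equiv.Perm.mul_apply]
        apply Equiv.swap_apply_of_ne_of_ne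
        · intro h; exact hiU.2.1 (by rw [← h]; simp)
        · intro h; exact hiU.2.2 (by rw [← h]; simp)
      rw [e1, e2]; simp
  refine (Finset.sum_le_sum hle).trans ?_
  rw [← Finset.sum_filter, Finset.sum_const, nsmul_eq_mul, mul_one]
  have : (I.filter (fun i => i ∈ U)).card ≤ U.card := Finset.card_le_card (fun i hi => (Finset.mem_filter.mp hi).2)
  exact_mod_cast this.trans hUc

abbrev PP (n : ℕ) := (Fin n × Fin n) × (Fin n × Fin n)

def lstep {n : ℕ} (Ψ : Finset (PP n)) (Y : Finset (Fin n)) (σ : Equiv.Perm (Fin n)) : Finset (PP n) :=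
  (Ψ.filter (fun ψ => σ ψ.2.1 ∈ Y ∧ σ ψ.2.2 ∈ Y)).image (fun ψ => (ψ.1, (σ ψ.2.1, σ ψ.2.2)))

lemma mem_lstep {n : ℕ} {Ψ : Finset (PP n)} {Y : Finset (Fin n)} {σ : Equiv.Perm (Fin n)} {p : Fin n × Fin n} {u v : Fin n} :
    (p, (u, v)) ∈ lstep Ψ Y σ ↔ (p, (σ⁻¹ u, σ⁻¹ v)) ∈ Ψ ∧ u ∈ Y ∧ v ∈ Y := by
  unfold lstep
  simp only [Finset.mem_image, Finset.mem_filter, Prod.mk.injEq]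
  constructor
  · rintro ⟨ψ, ⟨h1, h2, h3⟩, rfl, rfl, rfl⟩
    simp [h1, h2, h3]
  · rintro ⟨h1, h2, h3⟩
    exact ⟨_, ⟨h1, by simpa using h2, by simpa using h3⟩, rfl, by simp, by simp⟩

structure LGood {n : ℕ} (K : ℕ) (θ : ℝ) (Ψ : Finset (PP n)) : Prop where
  ne : ∀ ψ ∈ Ψ, ψ.2.1 ≠ ψ.2.2
  fib : ∀ p, (Ψ.filter (fun ψ => ψ.1 = p)).card ≤ K
  deg1 : ∀ z, (Ψ.filter (fun ψ => ψ.2.1 = z)).card ≤ K * n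
  deg2 : ∀ z, (Ψ.filter (fun ψ => ψ.2.2 = z)).card ≤ K * n
  big : θ * K * (n:ℝ)^2 ≤ Ψ.card

def ccc : ℝ := 1 / (128 * 1200^2)

set_option maxHeartbeats 1000000 in
lemma lstep_hyp {n : ℕ} (hn : 2 ≤ n) (K : ℕ) (hK : 0 < K) (θ : ℝ) (hθ : 0 < θ) (Ψ : Finset (PP n)) (h : LGood K θ Ψ)
    (Y : Finset (Fin n)) (hY : (n:ℝ)^2 ≤ 300 * Y.offDiag.card) (Φ : Finset (PP n)) (hΦ : 2 * (Φ.card:ℝ) ≤ θ * (n:ℝ)^2 * Y.offDiag.card) :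
    ((Finset.univ.filter (fun σ => (((lstep Ψ Y σ) \ Φ).card : ℝ) < (Ψ.card : ℝ) / 1200)).card : ℝ) ≤
      Real.exp (-(ccc * θ^2 * n)) * (n.factorial : ℝ) := by
  have hn0 : (0:ℝ) < n := by positivity
  have hn1 : (0:ℝ) < n - 1 := by
    have : (2:ℝ) ≤ n := by exact_mod_cast hn
    linarith
  have hK0 : (0:ℝ) < K := by exact_mod_cast hK
  set S : PP n → Finset (Fin n × Fin n) := fun ψ => Y.offDiag.filter (fun q => (ψ.1, q) ∉ Φ) with hS
  set g := pairg Ψ (fun ψ => ψ.2.1) (fun ψ => ψ.2.2) S with hg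
  have hgle : ∀ σ, g σ ≤ ((lstep Ψ Y σ) \ Φ).card := by
    intro σ
    rw [hg]; unfold pairg
    rw [← Finset.sum_filter, Finset.sum_const, nsmul_eq_mul, mul_one]
    norm_cast
    refine Finset.card_le_card_of_injOn (fun ψ => (ψ.1, (σ ψ.2.1, σ ψ.2.2))) ?_ ?_
    · intro ψ hψ
      simp only [hS, Finset.coe_filter, Set.mem_ofPred_eq, Finset.mem_filter, Finset.mem_offDiag] at hψ
      simp only [Finset.coe_sdiff, Set.mem_sdiff, Finset.mem_coe]
      refine ⟨mem_lstep.mpr ⟨by simpa using hψ.1, hψ.2.1.1, hψ.2.1.2.1⟩, hψ.2.2⟩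
    · intro ψ _ ψ' _ he
      simp only [Prod.mk.injEq, EmbeddingLike.apply_eq_iff_eq] at he
      exact Prod.ext he.1 (Prod.ext he.2.1 he.2.2)
  have hmean := pairg_mean hn Ψ (fun ψ => ψ.2.1) (fun ψ => ψ.2.2) S h.ne (by
    intro ψ _ q hq
    exact (Finset.mem_offDiag.mp (Finset.mem_filter.mp hq).1).2.2)
  have hlip := pairg_lip Ψ (fun ψ => ψ.2.1) (fun ψ => ψ.2.2) S (K * n) h.deg1 h.deg2
  rw [← hg] at hmean hlip
  have hScard : ∀ ψ, (Y.offDiag.card : ℝ) - (Φ.filter (fun φ => φ.1 = ψ.1)).card ≤ (S ψ).card := by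
    intro ψ
    have h1 : Y.offDiag.card ≤ (S ψ).card + (Φ.filter (fun φ => φ.1 = ψ.1)).card := by
      rw [← Finset.card_filter_add_card_filter_not (s := Y.offDiag) (fun q => (ψ.1, q) ∉ Φ)]
      refine Nat.add_le_add_left ?_ _
      refine Finset.card_le_card_of_injOn (fun q => (ψ.1, q)) ?_ ?_
      · intro q hq
        simp only [Finset.coe_filter, Set.mem_ofPred_eq, not_not] at hq ⊢
        exact ⟨hq.2, trivial⟩
      · intro q _ q' _ he
        exact (Prod.mk.inj he).2
    have : (Y.offDiag.card : ℝ) ≤ (S ψ).card + (Φ.filter (fun φ => φ.1 = ψ.1)).card := by exact_mod_cast h1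
    linarith
  have hdc : ∑ ψ ∈ Ψ, ((Φ.filter (fun φ => φ.1 = ψ.1)).card : ℝ) ≤ K * Φ.card := by
    have e1 : ∑ ψ ∈ Ψ, (Φ.filter (fun φ => φ.1 = ψ.1)).card = ∑ φ ∈ Φ, (Ψ.filter (fun ψ => ψ.1 = φ.1)).card := by
      simp only [Finset.card_filter]
      rw [Finset.sum_comm]
      refine Finset.sum_congr rfl fun _ _ => Finset.sum_congr rfl fun _ _ => ?_
      simp only [eq_comm]
    have e2 : ∑ φ ∈ Φ, (Ψ.filter (fun ψ => ψ.1 = φ.1)).card ≤ ∑ φ ∈ Φ, K := Finset.sum_le_sum fun φ _ => h.fib φ.1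
    rw [Finset.sum_const, smul_eq_mul, ← e1, mul_comm] at e2
    exact_mod_cast e2
  have hsumS : (Ψ.card : ℝ) * Y.offDiag.card / 2 ≤ ∑ ψ ∈ Ψ, ((S ψ).card : ℝ) := by
    have h1 := Finset.sum_le_sum (fun ψ (_ : ψ ∈ Ψ) => hScard ψ)
    rw [Finset.sum_sub_distrib, Finset.sum_const, nsmul_eq_mul] at h1
    have h2 : (K:ℝ) * (2 * Φ.card) ≤ K * (θ * (n:ℝ)^2 * Y.offDiag.card) := mul_le_mul_of_nonneg_left hΦ hK0.le
    have h3 : (θ * K * (n:ℝ)^2) * Y.offDiag.card ≤ Ψ.card * Y.offDiag.card := mul_le_mul_of_nonneg_right h.big (by positivity)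
    have e : (K:ℝ) * (θ * (n:ℝ)^2 * Y.offDiag.card) = (θ * K * (n:ℝ)^2) * Y.offDiag.card := by ring
    linarith
  have hmlow : (Ψ.card : ℝ) / 600 ≤ pmean g := by
    rw [hmean, le_div_iff₀ (by positivity)]
    refine le_trans ?_ hsumS
    have h1 : (n:ℝ) * (n - 1) ≤ n^2 := by nlinarith
    have h2 : (n:ℝ) * (n-1) ≤ 300 * Y.offDiag.card := h1.trans hY
    have := mul_le_mul_of_nonneg_left h2 (by positivity : (0:ℝ) ≤ (Ψ.card : ℝ) / 600)
    refine this.trans (le_of_eq ?_); ring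
  have hm0 : 0 ≤ pmean g := le_trans (by positivity) hmlow
  have htail := perm_tail (J := Unit) (by omega : 0 < n) g (4 * (K * n : ℕ)) (by positivity) hlip (pmean g / 2) (by positivity)
  have hstep : ((Finset.univ.filter (fun σ => (((lstep Ψ Y σ) \ Φ).card : ℝ) < (Ψ.card : ℝ) / 1200)).card : ℝ) ≤
    ((Finset.univ.filter (fun f : Unit → Equiv.Perm (Fin n) => ∑ j, g (f j) ≤ Fintype.card Unit * (pmean g - pmean g / 2))).card : ℝ) := by
    norm_cast
    refine Finset.card_le_card_of_injOn (fun σ => fun _ => σ) ?_ ?_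
    · intro σ hσ
      simp only [Finset.coe_filter, Set.mem_ofPred_eq, Finset.mem_univ, true_and] at hσ ⊢
      simp only [Finset.univ_unique, Finset.sum_singleton, Fintype.card_unit, Nat.cast_one, one_mul]
      have := hgle σ
      linarith
    · intro σ _ σ' _ he
      exact congrFun he ()
  refine (hstep.trans (le_of_eq (by congr!))).trans (htail.trans ?_)
  rw [Fintype.card_unit, pow_one, mul_comm]
  refine mul_le_mul_of_nonneg_right ?_ (by positivity)
  apply Real.exp_le_exp.mpr
  apply neg_le_neg
  rw [Nat.cast_one, one_mul, le_div_iff₀ (by positivity)]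
  have h5 : θ * K * (n:ℝ)^2 / 1200 ≤ pmean g / 2 := by
    have := h.big
    linarith
  have h6 := pow_le_pow_left₀ (by positivity) h5 2
  refine le_trans (le_of_eq ?_) h6
  unfold ccc; push_cast; ring

def lstepU {n k : ℕ} (Ψ : Finset (PP n)) (Y : Finset (Fin n)) (G : Fin k → Equiv.Perm (Fin n)) : Finset (PP n) :=
  Finset.univ.biUnion (fun i => lstep Ψ Y (G i))

lemma lstepU_struct {n k : ℕ} (K : ℕ) (θ : ℝ) (Ψ : Finset (PP n)) (h : LGood K θ Ψ)
    (Y : Finset (Fin n)) (G : Fin k → Equiv.Perm (Fin n)) (θ' : ℝ)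
    (hb : θ' * (min (k * K) (n^2) : ℕ) * (n:ℝ)^2 ≤ (lstepU Ψ Y G).card) :
    LGood (min (k * K) (n^2)) θ' (lstepU Ψ Y G) := by
  have hmem : ∀ ψ, ψ ∈ lstepU Ψ Y G ↔ ∃ i, ψ ∈ lstep Ψ Y (G i) := by
    intro ψ; simp [lstepU]
  have hgen : ∀ (Q : PP n → Prop) (Q' : Fin k → PP n → Prop) [DecidablePred Q] [∀ i, DecidablePred (Q' i)] (D : ℕ), (∀ i ψ, ψ ∈ Ψ → Q (ψ.1, (G i ψ.2.1, G i ψ.2.2)) → Q' i ψ) →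
      (∀ i, (Ψ.filter (Q' i)).card ≤ D) → ((lstepU Ψ Y G).filter Q).card ≤ k * D := by
    intro Q Q' _ _ D h1 h2
    have hsub : (lstepU Ψ Y G).filter Q ⊆ Finset.univ.biUnion (fun i => (Ψ.filter (Q' i)).image (fun ψ => (ψ.1, (G i ψ.2.1, G i ψ.2.2)))) := by
      intro ψ hψ
      obtain ⟨h3, h4⟩ := Finset.mem_filter.mp hψ
      obtain ⟨i, hi⟩ := (hmem ψ).mp h3
      obtain ⟨φ, hφ, rfl⟩ := Finset.mem_image.mp hi
      refine Finset.mem_biUnion.mpr ⟨i, Finset.mem_univ _, Finset.mem_image.mpr ⟨φ, Finset.mem_filter.mpr ⟨(Finset.mem_filter.mp hφ).1, h1 i φ (Finset.mem_filter.mp hφ).1 h4⟩, rfl⟩⟩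
    refine (Finset.card_le_card hsub).trans (Finset.card_biUnion_le.trans ?_)
    refine (Finset.sum_le_sum (fun i _ => Finset.card_image_le.trans (h2 i))).trans ?_
    simp
  have hpp : Fintype.card (Fin n × Fin n) = n^2 := by simp [sq]
  refine ⟨?_, ?_, ?_, ?_, hb⟩
  · intro ψ hψ
    obtain ⟨i, hi⟩ := (hmem ψ).mp hψ
    obtain ⟨φ, hφ, rfl⟩ := Finset.mem_image.mp hi
    intro he
    exact h.ne φ (Finset.mem_filter.mp hφ).1 ((G i).injective he)
  · intro p
    refine le_min (hgen _ (fun _ ψ => ψ.1 = p) K (fun i ψ _ hq => hq) (fun i => by convert h.fib p)) ?_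
    rw [← hpp, ← Finset.card_univ]
    refine Finset.card_le_card_of_injOn (fun ψ => ψ.2) (fun _ _ => Finset.mem_coe.mpr (Finset.mem_univ _)) ?_
    intro ψ h1 ψ' h2 he
    have h1' := (Finset.mem_filter.mp h1).2
    have h2' := (Finset.mem_filter.mp h2).2
    exact Prod.ext (h1'.trans h2'.symm) he
  · intro z
    rcases min_choice (k * K) (n^2) with e | e
    · rw [e, mul_assoc]
      refine hgen _ (fun i ψ => ψ.2.1 = (G i)⁻¹ z) (K * n) ?_ (fun i => by convert h.deg1 ((G i)⁻¹ z))
      intro i ψ _ hq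
      rw [← hq]; simp
    · rw [e]
      have : Fintype.card ((Fin n × Fin n) × Fin n) = n^2 * n := by simp [sq]
      rw [← this, ← Finset.card_univ]
      refine Finset.card_le_card_of_injOn (fun ψ => (ψ.1, ψ.2.2)) (fun _ _ => Finset.mem_coe.mpr (Finset.mem_univ _)) ?_
      intro ψ h1 ψ' h2 he
      have h1' := (Finset.mem_filter.mp h1).2
      have h2' := (Finset.mem_filter.mp h2).2
      have he' := Prod.mk.inj he
      exact Prod.ext he'.1 (Prod.ext (h1'.trans h2'.symm) he'.2)
  · intro z
    rcases min_choice (k * K) (n^2) with e | e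
    · rw [e, mul_assoc]
      refine hgen _ (fun i ψ => ψ.2.2 = (G i)⁻¹ z) (K * n) ?_ (fun i => by convert h.deg2 ((G i)⁻¹ z))
      intro i ψ _ hq
      rw [← hq]; simp
    · rw [e]
      have : Fintype.card ((Fin n × Fin n) × Fin n) = n^2 * n := by simp [sq]
      rw [← this, ← Finset.card_univ]
      refine Finset.card_le_card_of_injOn (fun ψ => (ψ.1, ψ.2.1)) (fun _ _ => Finset.mem_coe.mpr (Finset.mem_univ _)) ?_
      intro ψ h1 ψ' h2 he
      have h1' := (Finset.mem_filter.mp h1).2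
      have h2' := (Finset.mem_filter.mp h2).2
      have he' := Prod.mk.inj he
      exact Prod.ext he'.1 (Prod.ext he'.2 (h1'.trans h2'.symm))

lemma layer {n : ℕ} (hn : 2 ≤ n) (K : ℕ) (hK : 0 < K) (θ : ℝ) (hθ : 0 < θ) (Ψ : Finset (PP n)) (h : LGood K θ Ψ)
    (Y : Finset (Fin n)) (hY : (n:ℝ)^2 ≤ 300 * Y.offDiag.card) (j : ℕ) :
    ((Finset.univ.filter (fun G : Fin (2*j) → Equiv.Perm (Fin n) => ¬ LGood (min (2*j * K) (n^2)) (θ/2400) (lstepU Ψ Y G))).card : ℝ) ≤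
      (2^(2*j) * Real.exp (-(ccc * θ^2 * n))^j) * (n.factorial : ℝ)^(2*j) := by
  set H : ℕ := ⌊θ * (n:ℝ)^2 * Y.offDiag.card / 2⌋₊ with hH
  have hH1 : (H:ℝ) ≤ θ * (n:ℝ)^2 * Y.offDiag.card / 2 := Nat.floor_le (by positivity)
  have hgr := growth (lstep Ψ Y) H ((Ψ.card : ℝ) / 1200) (Real.exp (-(ccc * θ^2 * n))) (by positivity) (Real.exp_pos _).le
    (by rw [Real.exp_le_one_iff]; unfold ccc; simp only [Left.neg_nonpos_iff]; positivity)
    (by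
      intro Φ hΦ
      have hΦ' : (Φ.card : ℝ) ≤ H := by exact_mod_cast hΦ
      have := lstep_hyp hn K hK θ hθ Ψ h Y hY Φ (by linarith)
      rw [Fintype.card_perm, Fintype.card_fin]
      convert this) (2*j) j ∅
  have e1 : 2 * j - j = j := by omega
  rw [e1, Fintype.card_perm, Fintype.card_fin] at hgr
  refine le_trans ?_ (hgr.trans (le_of_eq (by ring)))
  norm_cast
  refine Finset.card_le_card ?_
  intro G hG
  simp only [Finset.mem_filter, Finset.mem_univ, true_and] at hG ⊢
  simp only [Finset.empty_union, Finset.card_empty, Nat.cast_zero, zero_add]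
  have hlt : ¬ (θ/2400 * (min (2*j * K) (n^2) : ℕ) * (n:ℝ)^2 ≤ (lstepU Ψ Y G).card) :=
    fun hb => hG (lstepU_struct K θ Ψ h Y G _ hb)
  push Not at hlt
  suffices hh : (lstepU Ψ Y G).card ≤ H ∧ ((lstepU Ψ Y G).card : ℝ) < j * ((Ψ.card : ℝ) / 1200) by
    unfold lstepU at hh; convert hh
  have hm1 : ((min (2*j * K) (n^2) : ℕ) : ℝ) ≤ 2 * j * K := by exact_mod_cast min_le_left _ _
  have hm2 : ((min (2*j * K) (n^2) : ℕ) : ℝ) ≤ (n:ℝ)^2 := by exact_mod_cast min_le_right _ _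
  have hc : 0 < θ / 2400 := by positivity
  constructor
  · apply Nat.le_floor
    refine hlt.le.trans ?_
    calc θ/2400 * (min (2*j * K) (n^2) : ℕ) * (n:ℝ)^2 ≤ θ/2400 * (n:ℝ)^2 * (n:ℝ)^2 := by gcongr
      _ ≤ θ/2400 * (n:ℝ)^2 * (300 * Y.offDiag.card) := by gcongr
      _ ≤ _ := by
        have : 0 ≤ θ * (n:ℝ)^2 * Y.offDiag.card := by positivity
        linarith
  · refine lt_of_lt_of_le hlt ?_
    calc θ/2400 * (min (2*j * K) (n^2) : ℕ) * (n:ℝ)^2 ≤ θ/2400 * (2 * j * K) * (n:ℝ)^2 := by gcongr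
      _ = j * (θ * K * (n:ℝ)^2 / 1200) := by ring
      _ ≤ _ := by
        have := h.big
        gcongr

lemma finalhit {n : ℕ} (hn : 2 ≤ n) (θ : ℝ) (hθ : 0 < θ) (Ψ : Finset (PP n)) (hbig : θ * (n:ℝ)^4 ≤ Ψ.card)
    (π π' : Equiv.Perm (Fin n)) (h1 : ∀ ψ ∈ Ψ, π⁻¹ ψ.1.2 ≠ ψ.2.2) (h2 : ∀ ψ ∈ Ψ, ψ.1.1 ≠ π' ψ.2.1) (k : ℕ) :
    ((Finset.univ.filter (fun G : Fin k → Equiv.Perm (Fin n) => ¬ ∃ i, ∃ ψ ∈ Ψ, G i (π⁻¹ ψ.1.2) = ψ.1.1 ∧ G i ψ.2.2 = π' ψ.2.1)).card : ℝ) ≤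
      Real.exp (-(k * θ^2 * n / 128)) * (n.factorial : ℝ)^k := by
  have hn0 : (0:ℝ) < n := by positivity
  have hn1 : (0:ℝ) < n - 1 := by
    have : (2:ℝ) ≤ n := by exact_mod_cast hn
    linarith
  set I := (Finset.univ : Finset (Fin n)).offDiag with hI
  set S : Fin n × Fin n → Finset (Fin n × Fin n) := fun p => Finset.univ.filter (fun q => q.1 ≠ q.2 ∧ ((q.1, π p.1), (π'⁻¹ q.2, p.2)) ∈ Ψ) with hS
  set g := pairg I (fun p => p.1) (fun p => p.2) S with hg
  have hmean := pairg_mean hn I (fun p => p.1) (fun p => p.2) S (fun p hp => (Finset.mem_offDiag.mp hp).2.2) (by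
    intro ψ _ q hq
    exact (Finset.mem_filter.mp hq).2.1)
  have hlip := pairg_lip I (fun p => p.1) (fun p => p.2) S n (by
      intro z
      conv_rhs => rw [← Fintype.card_fin n, ← Finset.card_univ]
      refine Finset.card_le_card_of_injOn (fun p => p.2) (fun _ _ => Finset.mem_coe.mpr (Finset.mem_univ _)) ?_
      intro p hp p' hp' he
      exact Prod.ext ((Finset.mem_filter.mp hp).2.trans (Finset.mem_filter.mp hp').2.symm) he) (by
      intro z
      conv_rhs => rw [← Fintype.card_fin n, ← Finset.card_univ]
      refine Finset.card_le_card_of_injOn (fun p => p.1) (fun _ _ => Finset.mem_coe.mpr (Finset.mem_univ _)) ?_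
      intro p hp p' hp' he
      exact Prod.ext he ((Finset.mem_filter.mp hp).2.trans (Finset.mem_filter.mp hp').2.symm))
  rw [← hg] at hmean hlip
  have hsum : (Ψ.card : ℝ) ≤ ∑ p ∈ I, ((S p).card : ℝ) := by
    rw [← Nat.cast_sum, ← Finset.card_sigma]
    norm_cast
    refine Finset.card_le_card_of_injOn (fun ψ => ⟨(π⁻¹ ψ.1.2, ψ.2.2), (ψ.1.1, π' ψ.2.1)⟩) ?_ ?_
    · intro ψ hψ
      have hψ' := Finset.mem_coe.mp hψ
      simp only [hI, hS, Finset.coe_sigma, Set.mem_sigma_iff, Finset.mem_coe, Finset.mem_offDiag, Finset.mem_univ, true_and, Finset.mem_filter]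
      exact ⟨h1 ψ hψ', h2 ψ hψ', by simpa using hψ'⟩
    · intro ψ _ ψ' _ he
      simp only [Sigma.mk.injEq, Prod.mk.injEq, heq_eq_eq, EmbeddingLike.apply_eq_iff_eq] at he
      exact Prod.ext (Prod.ext he.2.1 he.1.1) (Prod.ext he.2.2 he.1.2)
  have hmlow : θ * (n:ℝ)^2 ≤ pmean g := by
    rw [hmean, le_div_iff₀ (by positivity)]
    refine le_trans ?_ (hbig.trans hsum)
    have h1 : (n:ℝ) * (n - 1) ≤ n^2 := by nlinarith
    have := mul_le_mul_of_nonneg_left h1 (by positivity : (0:ℝ) ≤ θ * (n:ℝ)^2)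
    refine this.trans (le_of_eq ?_); ring
  have hm0 : 0 ≤ pmean g := le_trans (by positivity) hmlow
  have htail := perm_tail (J := Fin k) (by omega : 0 < n) g (4 * n) (by positivity) hlip (pmean g) hm0
  have hstep : ((Finset.univ.filter (fun G : Fin k → Equiv.Perm (Fin n) => ¬ ∃ i, ∃ ψ ∈ Ψ, G i (π⁻¹ ψ.1.2) = ψ.1.1 ∧ G i ψ.2.2 = π' ψ.2.1)).card : ℝ) ≤
    ((Finset.univ.filter (fun f : Fin k → Equiv.Perm (Fin n) => ∑ j, g (f j) ≤ Fintype.card (Fin k) * (pmean g - pmean g))).card : ℝ) := by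
    norm_cast
    refine Finset.card_le_card ?_
    intro G hG
    simp only [Finset.mem_filter, Finset.mem_univ, true_and] at hG ⊢
    rw [sub_self, mul_zero]
    apply le_of_eq
    refine Finset.sum_eq_zero fun i _ => ?_
    rw [hg]; unfold pairg
    refine Finset.sum_eq_zero fun p _ => ?_
    rw [if_neg]
    intro hp
    simp only [hS, Finset.mem_filter, Finset.mem_univ, true_and] at hp
    exact hG ⟨i, _, hp.2, by simp, by simp⟩
  refine (hstep.trans (le_of_eq (by congr!))).trans (htail.trans ?_)
  rw [Fintype.card_fin, mul_comm]
  refine mul_le_mul_of_nonneg_right ?_ (by positivity)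
  apply Real.exp_le_exp.mpr
  apply neg_le_neg
  rw [le_div_iff₀ (by positivity)]
  have h6 := pow_le_pow_left₀ (by positivity) hmlow 2
  have h7 := mul_le_mul_of_nonneg_left h6 (by positivity : (0:ℝ) ≤ k)
  refine le_trans (le_of_eq ?_) h7
  ring

lemma count_sum {A B Ω : Type} [Fintype A] [Fintype B] [Fintype Ω] (P : (A → Ω) → Prop) (Q : (A ⊕ B → Ω) → Prop)
    (β β' N : ℝ) (hN : (Fintype.card Ω : ℝ) = N) (a b : ℕ) (ha : Fintype.card A = a) (hb : Fintype.card B = b) (hβ' : 0 ≤ β')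
    (h1 : ((Finset.univ.filter (fun g : A → Ω => ¬ P g)).card : ℝ) ≤ β * N^a)
    (h2 : ∀ g, P g → ((Finset.univ.filter (fun g' : B → Ω => ¬ Q (Sum.elim g g'))).card : ℝ) ≤ β' * N^b) :
    ((Finset.univ.filter (fun g : A ⊕ B → Ω => ¬ Q g)).card : ℝ) ≤ (β + β') * N^(a+b) := by
  have hN0 : 0 ≤ N := by rw [← hN]; positivity
  have hAc : (Fintype.card (A → Ω) : ℝ) = N^a := by rw [Fintype.card_fun, ha, ← hN]; push_cast; rfl
  have hBc : (Fintype.card (B → Ω) : ℝ) = N^b := by rw [Fintype.card_fun, hb, ← hN]; push_cast; rfl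
  have e1 : ((Finset.univ.filter (fun g : A ⊕ B → Ω => ¬ Q g)).card : ℝ) ≤ ∑ g : A → Ω, ((Finset.univ.filter (fun g' : B → Ω => ¬ Q (Sum.elim g g'))).card : ℝ) := by
    rw [← Nat.cast_sum, ← Finset.card_sigma]
    norm_cast
    refine Finset.card_le_card_of_injOn (fun g => ⟨g ∘ Sum.inl, g ∘ Sum.inr⟩) ?_ ?_
    · intro g hg
      have hg' := (Finset.mem_filter.mp (Finset.mem_coe.mp hg)).2
      simp only [Finset.coe_sigma, Set.mem_sigma_iff, Finset.mem_coe, Finset.mem_univ, true_and, Finset.mem_filter, Sum.elim_comp_inl_inr]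
      exact hg'
    · intro g _ g' _ he
      simp only [Sigma.mk.injEq, heq_eq_eq] at he
      rw [← Sum.elim_comp_inl_inr g, he.1, he.2, Sum.elim_comp_inl_inr]
  refine e1.trans ?_
  have e2 : ∀ g : A → Ω, ((Finset.univ.filter (fun g' : B → Ω => ¬ Q (Sum.elim g g'))).card : ℝ) ≤ (if ¬ P g then N^b else 0) + β' * N^b := by
    intro g
    by_cases hP : P g
    swap
    · rw [if_pos hP]
      have : ((Finset.univ.filter (fun g' : B → Ω => ¬ Q (Sum.elim g g'))).card : ℝ) ≤ N^b := by
        rw [← hBc]; exact_mod_cast Finset.card_le_univ _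
      have : 0 ≤ β' * N^b := by positivity
      linarith
    · rw [if_neg (not_not.mpr hP), zero_add]; exact h2 g hP
  refine (Finset.sum_le_sum fun g _ => e2 g).trans ?_
  rw [Finset.sum_add_distrib, ← Finset.sum_filter, Finset.sum_const, Finset.sum_const, nsmul_eq_mul, nsmul_eq_mul, Finset.card_univ, hAc]
  have := mul_le_mul_of_nonneg_right h1 (by positivity : 0 ≤ N^b)
  calc _ ≤ β * N^a * N^b + N^a * (β' * N^b) := by linarith
    _ = _ := by rw [pow_add]; ring

lemma avail {n : ℕ} (X : Finset (Fin n)) (q : ℕ) (h : X.card + q ≤ n) : ∃ Y : Finset (Fin n), Y.card = q ∧ ∀ y ∈ Y, y ∉ X := by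
  have : q ≤ Xᶜ.card := by rw [Finset.card_compl, Fintype.card_fin]; omega
  obtain ⟨Y, h1, h2⟩ := Finset.exists_subset_card_eq this
  exact ⟨Y, h2, fun y hy => Finset.mem_compl.mp (h1 hy)⟩

lemma zones {n : ℕ} (hn : 2000 ≤ n) (FC FS : Finset (Fin n)) (hFC : 100 * FC.card ≤ n) (hFS : 100 * FS.card ≤ n) (π π' : Equiv.Perm (Fin n)) :
    ∃ Y0 Z34 Y2 Z12 : Finset (Fin n),
      ((n:ℝ)^2 ≤ 300 * Y0.offDiag.card ∧ (n:ℝ)^2 ≤ 300 * Z34.offDiag.card ∧ (n:ℝ)^2 ≤ 300 * Y2.offDiag.card ∧ (n:ℝ)^2 ≤ 300 * Z12.offDiag.card) ∧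
      (∀ y ∈ Y0, y ∉ FS ∧ π⁻¹ y ∉ FC) ∧
      (∀ d ∈ Z34, d ∉ FC ∧ π' d ∉ FS ∧ π' d ∉ Y0 ∧ π d ∉ Y0) ∧
      (∀ y ∈ Y2, y ∉ FS ∧ y ∉ Y0 ∧ π'⁻¹ y ∉ Z34) ∧
      (∀ d ∈ Z12, d ∉ FC ∧ π d ∉ Y0 ∧ d ∉ Z34) := by
  set q := n / 16 with hq
  have hqb : ∀ Y : Finset (Fin n), Y.card = q → (n:ℝ)^2 ≤ 300 * Y.offDiag.card := by
    intro Y hY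
    rw [Finset.offDiag_card, hY]
    have h1 : n ≤ 17 * (q - 1) := by omega
    have h2 : q * q - q = q * (q - 1) := by rw [Nat.mul_sub, mul_one]
    have h3 : n * n ≤ (17 * (q-1)) * (17 * (q - 1)) := Nat.mul_le_mul h1 h1
    have h4 : (q - 1) * (q-1) ≤ q * (q - 1) := Nat.mul_le_mul_right _ (by omega)
    rw [h2]
    have : n^2 ≤ 300 * (q * (q-1)) := by
      rw [sq]
      have e : (17 * (q-1)) * (17 * (q - 1)) = 289 * ((q-1) * (q-1)) := by ring
      rw [e] at h3
      omega
    exact_mod_cast this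
  have hm : ∀ (σ : Equiv.Perm (Fin n)) (X : Finset (Fin n)), (X.map σ.toEmbedding).card = X.card := fun σ X => Finset.card_map _
  have hmem : ∀ (σ : Equiv.Perm (Fin n)) (X : Finset (Fin n)) (z : Fin n), z ∈ X.map σ.toEmbedding ↔ σ⁻¹ z ∈ X := by
    intro σ X z
    rw [Finset.mem_map_equiv]; rfl
  obtain ⟨Y0, c0, h0⟩ := avail (FS ∪ FC.map π.toEmbedding) q (by
    have := Finset.card_union_le FS (FC.map π.toEmbedding); have := hm π FC; omega)
  obtain ⟨Z34, c34, h34⟩ := avail ((FC ∪ FS.map (π'⁻¹).toEmbedding) ∪ (Y0.map (π'⁻¹).toEmbedding ∪ Y0.map (π⁻¹).toEmbedding)) q (by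
    have := Finset.card_union_le (FC ∪ FS.map (π'⁻¹).toEmbedding) (Y0.map (π'⁻¹).toEmbedding ∪ Y0.map (π⁻¹).toEmbedding)
    have := Finset.card_union_le FC (FS.map (π'⁻¹).toEmbedding)
    have := Finset.card_union_le (Y0.map (π'⁻¹).toEmbedding) (Y0.map (π⁻¹).toEmbedding)
    have := hm π'⁻¹ FS; have := hm π'⁻¹ Y0; have := hm π⁻¹ Y0; omega)
  obtain ⟨Y2, c2, h2⟩ := avail (FS ∪ (Y0 ∪ Z34.map π'.toEmbedding)) q (by
    have := Finset.card_union_le FS (Y0 ∪ Z34.map π'.toEmbedding)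
    have := Finset.card_union_le Y0 (Z34.map π'.toEmbedding)
    have := hm π' Z34; omega)
  obtain ⟨Z12, c12, h12⟩ := avail (FC ∪ (Y0.map (π⁻¹).toEmbedding ∪ Z34)) q (by
    have := Finset.card_union_le FC (Y0.map (π⁻¹).toEmbedding ∪ Z34)
    have := Finset.card_union_le (Y0.map (π⁻¹).toEmbedding) Z34
    have := hm π⁻¹ Y0; omega)
  refine ⟨Y0, Z34, Y2, Z12, ⟨hqb _ c0, hqb _ c34, hqb _ c2, hqb _ c12⟩, ?_, ?_, ?_, ?_⟩
  · intro y hy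
    have := h0 y hy
    simp only [Finset.mem_union, hmem, not_or] at this
    exact this
  · intro y hy
    have := h34 y hy
    simp only [Finset.mem_union, hmem, not_or, inv_inv] at this
    tauto
  · intro y hy
    have := h2 y hy
    simp only [Finset.mem_union, hmem, not_or] at this
    tauto
  · intro y hy
    have := h12 y hy
    simp only [Finset.mem_union, hmem, not_or, inv_inv] at this
    tauto

def SwOK {n k : ℕ} (FC FS : Finset (Fin n)) (π π' : Equiv.Perm (Fin n)) (G1 G2 G3 G4 : Fin k → Equiv.Perm (Fin n)) : Prop :=
  ∃ i1 i2 i3 i4 : Fin k, ∃ c d1 d2 d3 d4 x y x2 y2 s : Fin n,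
    (π c = y ∧ G4 i4 c = x ∧ G1 i1 d1 = x ∧ G1 i1 d2 = y ∧ G2 i2 d1 = x2 ∧ G2 i2 d2 = y2 ∧ G3 i3 d3 = x2 ∧ G3 i3 d4 = y2 ∧ G4 i4 d4 = s ∧ π' d3 = s) ∧
    [c, d1, d2, d3, d4].Nodup ∧ [x, y, x2, y2, s].Nodup ∧ (∀ z ∈ [c, d1, d2, d3, d4], z ∉ FC) ∧ (∀ z ∈ [x, y, x2, y2, s], z ∉ FS)

lemma layer' {n : ℕ} (hn : 2 ≤ n) (K : ℕ) (hK : 0 < K) (θ : ℝ) (hθ : 0 < θ) (Ψ : Finset (PP n)) (h : LGood K θ Ψ)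
    (Y : Finset (Fin n)) (hY : (n:ℝ)^2 ≤ 300 * Y.offDiag.card) (j k : ℕ) (hk : k = 2 * j) :
    ((Finset.univ.filter (fun G : Fin k → Equiv.Perm (Fin n) => ¬ LGood (min (k * K) (n^2)) (θ/2400) (lstepU Ψ Y G))).card : ℝ) ≤
      (2^k * Real.exp (-(ccc * θ^2 * n))^j) * (n.factorial : ℝ)^k := by
  subst hk
  exact layer hn K hK θ hθ Ψ h Y hY j

lemma layer_inv {n : ℕ} (hn : 2 ≤ n) (K : ℕ) (hK : 0 < K) (θ : ℝ) (hθ : 0 < θ) (Ψ : Finset (PP n)) (h : LGood K θ Ψ)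
    (Y : Finset (Fin n)) (hY : (n:ℝ)^2 ≤ 300 * Y.offDiag.card) (j k : ℕ) (hk : k = 2 * j) :
    ((Finset.univ.filter (fun G : Fin k → Equiv.Perm (Fin n) => ¬ LGood (min (k * K) (n^2)) (θ/2400) (lstepU Ψ Y (fun i => (G i)⁻¹)))).card : ℝ) ≤
      (2^k * Real.exp (-(ccc * θ^2 * n))^j) * (n.factorial : ℝ)^k := by
  refine le_trans ?_ (layer' hn K hK θ hθ Ψ h Y hY j k hk)
  norm_cast
  refine Finset.card_le_card_of_injOn (fun G i => (G i)⁻¹) ?_ ?_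
  · intro G hG
    simpa using hG
  · intro G _ G' _ he
    funext i
    exact inv_injective (congrFun he i)

def psi0 {n : ℕ} (Y : Finset (Fin n)) : Finset (PP n) := Y.offDiag.image (fun p => (p, p))

lemma psi0_good {n : ℕ} (Y : Finset (Fin n)) (hY : (n:ℝ)^2 ≤ 300 * Y.offDiag.card) : LGood 1 (1/300) (psi0 Y) := by
  have hdeg : ∀ (f : PP n → Fin n) (g : PP n → Fin n), (∀ p : Fin n × Fin n, ∀ p', f (p, p) = f (p', p') → g (p, p) = g (p', p') → p = p') → ∀ z, ((psi0 Y).filter (fun ψ => f ψ = z)).card ≤ 1 * n := by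
    intro f g hfg z
    rw [one_mul]
    conv_rhs => rw [← Fintype.card_fin n, ← Finset.card_univ]
    refine Finset.card_le_card_of_injOn g (fun _ _ => Finset.mem_coe.mpr (Finset.mem_univ _)) ?_
    intro ψ hψ ψ' hψ' he
    obtain ⟨h1, h2⟩ := Finset.mem_filter.mp hψ
    obtain ⟨h1', h2'⟩ := Finset.mem_filter.mp hψ'
    obtain ⟨p, _, rfl⟩ := Finset.mem_image.mp h1
    obtain ⟨p', _, rfl⟩ := Finset.mem_image.mp h1'
    rw [hfg p p' (h2.trans h2'.symm) he]
  refine ⟨?_, ?_, ?_, ?_, ?_⟩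
  · intro ψ hψ
    obtain ⟨p, hp, rfl⟩ := Finset.mem_image.mp hψ
    exact (Finset.mem_offDiag.mp hp).2.2
  · intro p
    rw [Finset.card_le_one]
    intro ψ hψ ψ' hψ'
    obtain ⟨h1, h2⟩ := Finset.mem_filter.mp hψ
    obtain ⟨h1', h2'⟩ := Finset.mem_filter.mp hψ'
    obtain ⟨q, _, rfl⟩ := Finset.mem_image.mp h1
    obtain ⟨q', _, rfl⟩ := Finset.mem_image.mp h1'
    simp only at h2 h2'
    rw [h2, h2']
  · exact hdeg (fun ψ => ψ.2.1) (fun ψ => ψ.2.2) (fun p p' h1 h2 => Prod.ext h1 h2)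
  · exact hdeg (fun ψ => ψ.2.2) (fun ψ => ψ.2.1) (fun p p' h1 h2 => Prod.ext h2 h1)
  · unfold psi0
    rw [Finset.card_image_of_injective _ (fun p p' h => (Prod.mk.inj h).1)]
    push_cast
    linarith

def th3 : ℝ := 1/300/2400/2400/2400

abbrev JJ (k : ℕ) := (((Fin 2 ⊕ Fin k) ⊕ Fin k) ⊕ Fin k) ⊕ Fin k

lemma mem_lstepU {n k : ℕ} {Ψ : Finset (PP n)} {Y : Finset (Fin n)} {G : Fin k → Equiv.Perm (Fin n)} {p : Fin n × Fin n} {u v : Fin n} :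
    (p, (u, v)) ∈ lstepU Ψ Y G ↔ ∃ i, (p, ((G i)⁻¹ u, (G i)⁻¹ v)) ∈ Ψ ∧ u ∈ Y ∧ v ∈ Y := by
  unfold lstepU
  simp only [Finset.mem_biUnion, Finset.mem_univ, true_and, mem_lstep]

set_option maxHeartbeats 1000000 in
lemma final_part {n k : ℕ} (hn2 : 2 ≤ n) (FC FS : Finset (Fin n)) (π π' : Equiv.Perm (Fin n)) (Y0 Z34 Y2 Z12 : Finset (Fin n))
    (hY0 : ∀ y ∈ Y0, y ∉ FS ∧ π⁻¹ y ∉ FC)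
    (hZ34 : ∀ d ∈ Z34, d ∉ FC ∧ π' d ∉ FS ∧ π' d ∉ Y0 ∧ π d ∉ Y0)
    (hY2 : ∀ y ∈ Y2, y ∉ FS ∧ y ∉ Y0 ∧ π'⁻¹ y ∉ Z34)
    (hZ12 : ∀ d ∈ Z12, d ∉ FC ∧ π d ∉ Y0 ∧ d ∉ Z34) (G1 G2 G3 : Fin k → Equiv.Perm (Fin n)) (Ψ3 : Finset (PP n))
    (hΨ3 : Ψ3 = lstepU (lstepU (lstepU (psi0 Y0) Z12 (fun i => (G1 i)⁻¹)) Y2 G2) Z34 (fun i => (G3 i)⁻¹))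
    (hbig : th3 * (n:ℝ)^4 ≤ Ψ3.card) :
    ((Finset.univ.filter (fun G4 : Fin k → Equiv.Perm (Fin n) => ¬ SwOK FC FS π π' G1 G2 G3 G4)).card : ℝ) ≤
      Real.exp (-(k * th3^2 * n / 128)) * (n.factorial : ℝ)^k := by
  have hun : ∀ ψ ∈ Ψ3, ∃ i1 i2 i3 d1 d2 x2 y2, ψ.1.1 ∈ Y0 ∧ ψ.1.2 ∈ Y0 ∧ ψ.1.1 ≠ ψ.1.2 ∧ d1 ∈ Z12 ∧ d2 ∈ Z12 ∧
      x2 ∈ Y2 ∧ y2 ∈ Y2 ∧ ψ.2.1 ∈ Z34 ∧ ψ.2.2 ∈ Z34 ∧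
      G1 i1 d1 = ψ.1.1 ∧ G1 i1 d2 = ψ.1.2 ∧
      G2 i2 d1 = x2 ∧ G2 i2 d2 = y2 ∧
      G3 i3 ψ.2.1 = x2 ∧ G3 i3 ψ.2.2 = y2 := by
    rintro ⟨⟨x, y⟩, ⟨d3, d4⟩⟩ hψ
    rw [hΨ3] at hψ
    obtain ⟨i3, h3, h3a, h3b⟩ := mem_lstepU.mp hψ
    obtain ⟨i2, h2, h2a, h2b⟩ := mem_lstepU.mp h3
    obtain ⟨i1, h1, h1a, h1b⟩ := mem_lstepU.mp h2
    obtain ⟨p, hp, he⟩ := Finset.mem_image.mp h1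
    simp only [Prod.mk.injEq] at he
    obtain ⟨rfl, he⟩ := he
    simp only [inv_inv, Prod.mk.injEq] at he h2a h2b h1a h1b
    obtain ⟨hp1, hp2, hp3⟩ := Finset.mem_offDiag.mp hp
    exact ⟨i1, i2, i3, _, _, _, _, hp1, hp2, hp3, h1a, h1b, h2a, h2b, h3a, h3b, he.1.symm, he.2.symm, by simp, by simp, rfl, rfl⟩
  have := finalhit hn2 th3 (by unfold th3; norm_num) (Ψ3) hbig π π' (by
    intro ψ hψ he
    obtain ⟨i1, i2, i3, d1, d2, x2, y2, hx, hy, hxy, hd1, hd2, hx2, hy2, hd3, hd4, _⟩ := hun ψ hψ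
    have := (hZ34 _ hd4).2.2.2
    rw [← he] at this
    simp at this
    exact this hy) (by
    intro ψ hψ he
    obtain ⟨i1, i2, i3, d1, d2, x2, y2, hx, hy, hxy, hd1, hd2, hx2, hy2, hd3, hd4, _⟩ := hun ψ hψ
    have := (hZ34 _ hd3).2.2.1
    rw [← he] at this
    exact this hx) k
  refine le_trans ?_ this
  · norm_cast
    refine Finset.card_le_card ?_
    intro G hG
    simp only [Finset.mem_filter, Finset.mem_univ, true_and, Sum.elim_inl, Sum.elim_inr] at hG ⊢
    rintro ⟨i4, ψ, hψ, he1, he2⟩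
    apply hG
    obtain ⟨i1, i2, i3, d1, d2, x2, y2, hx, hy, hxy, hd1, hd2, hx2, hy2, hd3, hd4, q1, q2, q3, q4, q5, q6⟩ := hun ψ hψ
    refine ⟨i1, i2, i3, i4, π⁻¹ ψ.1.2, d1, d2, ψ.2.1, ψ.2.2, ψ.1.1, ψ.1.2, x2, y2, π' ψ.2.1, ⟨by simp, he1, q1, q2, q3, q4, q5, q6, he2, rfl⟩, ?_, ?_, ?_, ?_⟩
    · have hd12 : d1 ≠ d2 := by rintro rfl; exact hxy (q1.symm.trans q2)
      have hxy2 : x2 ≠ y2 := by rintro rfl; exact hd12 ((G2 i2).injective (q3.trans q4.symm))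
      have hd34 : ψ.2.1 ≠ ψ.2.2 := by intro he; rw [he] at q5; exact hxy2 (q5.symm.trans q6)
      have a1 : ∀ d ∈ Z12, π⁻¹ ψ.1.2 ≠ d := by
        rintro d hd rfl
        have := (hZ12 _ hd).2.1
        simp at this; exact this hy
      have a2 : ∀ d ∈ Z34, π⁻¹ ψ.1.2 ≠ d := by
        rintro d hd rfl
        have := (hZ34 _ hd).2.2.2
        simp at this; exact this hy
      have a3 : ∀ d ∈ Z12, ∀ d' ∈ Z34, d ≠ d' := by
        rintro d hd _ hd' rfl
        exact (hZ12 _ hd).2.2 hd'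
      simp only [List.nodup_cons, List.mem_cons, List.not_mem_nil, or_false, not_or, not_false_eq_true, List.nodup_nil, and_true]
      exact ⟨⟨a1 _ hd1, a1 _ hd2, a2 _ hd3, a2 _ hd4⟩, ⟨hd12, a3 _ hd1 _ hd3, a3 _ hd1 _ hd4⟩, ⟨a3 _ hd2 _ hd3, a3 _ hd2 _ hd4⟩, hd34⟩
    · have hd12 : d1 ≠ d2 := by rintro rfl; exact hxy (q1.symm.trans q2)
      have hxy2 : x2 ≠ y2 := by rintro rfl; exact hd12 ((G2 i2).injective (q3.trans q4.symm))
      have b1 : ∀ z ∈ Y0, ∀ z' ∈ Y2, z ≠ z' := by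
        rintro z hz _ hz' rfl
        exact (hY2 _ hz').2.1 hz
      have b2 : ∀ z ∈ Y0, z ≠ π' ψ.2.1 := by
        rintro z hz rfl
        exact (hZ34 _ hd3).2.2.1 hz
      have b3 : ∀ z ∈ Y2, z ≠ π' ψ.2.1 := by
        rintro z hz rfl
        have := (hY2 _ hz).2.2
        simp at this; exact this hd3
      simp only [List.nodup_cons, List.mem_cons, List.not_mem_nil, or_false, not_or, not_false_eq_true, List.nodup_nil, and_true]
      exact ⟨⟨hxy, b1 _ hx _ hx2, b1 _ hx _ hy2, b2 _ hx⟩, ⟨b1 _ hy _ hx2, b1 _ hy _ hy2, b2 _ hy⟩, ⟨hxy2, b3 _ hx2⟩, b3 _ hy2⟩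
    · simp only [List.forall_mem_cons, List.not_mem_nil, false_imp_iff, implies_true, and_true]
      exact ⟨(hY0 _ hy).2, (hZ12 _ hd1).1, (hZ12 _ hd2).1, (hZ34 _ hd3).1, (hZ34 _ hd4).1⟩
    · simp only [List.forall_mem_cons, List.not_mem_nil, false_imp_iff, implies_true, and_true]
      exact ⟨(hY0 _ hx).1, (hY0 _ hy).1, (hY2 _ hx2).1, (hY2 _ hy2).1, (hZ34 _ hd3).2.1⟩

lemma count_sum' {A B Ω : Type} [Fintype A] [Fintype B] [Fintype Ω] [fA : Fintype (A → Ω)] [fB : Fintype (B → Ω)] [fAB : Fintype (A ⊕ B → Ω)] (P : (A → Ω) → Prop) (Q : (A ⊕ B → Ω) → Prop)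
    [dP : DecidablePred P] [dQ : DecidablePred Q]
    (β β' N : ℝ) (hN : (Fintype.card Ω : ℝ) = N) (a b : ℕ) (ha : Fintype.card A = a) (hb : Fintype.card B = b) (hβ' : 0 ≤ β')
    (h1 : ((Finset.univ.filter (fun g : A → Ω => ¬ P g)).card : ℝ) ≤ β * N^a)
    (h2 : ∀ g, P g → ((Finset.univ.filter (fun g' : B → Ω => ¬ Q (Sum.elim g g'))).card : ℝ) ≤ β' * N^b) :
    ((Finset.univ.filter (fun g : A ⊕ B → Ω => ¬ Q g)).card : ℝ) ≤ (β + β') * N^(a+b) := by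
  have := count_sum P Q β β' N hN a b ha hb hβ' (by convert h1) (by intro g hg; convert h2 g hg)
  convert this

lemma lay_step {n : ℕ} {A : Type} [Fintype A] (hn2 : 2 ≤ n) (k : ℕ) [fA : Fintype (A → Equiv.Perm (Fin n))] [fAB : Fintype (A ⊕ Fin k → Equiv.Perm (Fin n))] (Φ : (A → Equiv.Perm (Fin n)) → Finset (PP n)) (Y : (A → Equiv.Perm (Fin n)) → Finset (Fin n))
    (hY : ∀ g, (n:ℝ)^2 ≤ 300 * (Y g).offDiag.card) (K K' : ℕ) (hK : 0 < K) (θ θ' : ℝ) (hθ : 0 < θ) (j : ℕ) (hk : k = 2 * j)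
    (hK' : min (k * K) (n^2) = K') (hθ' : θ/2400 = θ') (a : ℕ) (ha : Fintype.card A = a) (β β' : ℝ)
    (hβ' : 2^k * Real.exp (-(ccc * θ^2 * n))^j ≤ β')
    (h1 : ((Finset.univ.filter (fun g : A → Equiv.Perm (Fin n) => ¬ LGood K θ (Φ g))).card : ℝ) ≤ β * (n.factorial : ℝ)^a) :
    ((Finset.univ.filter (fun g : A ⊕ Fin k → Equiv.Perm (Fin n) => ¬ LGood K' θ' (lstepU (Φ (fun i => g (Sum.inl i))) (Y (fun i => g (Sum.inl i))) (fun i => g (Sum.inr i))))).card : ℝ) ≤ (β + β') * (n.factorial : ℝ)^(a + k) ∧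
    ((Finset.univ.filter (fun g : A ⊕ Fin k → Equiv.Perm (Fin n) => ¬ LGood K' θ' (lstepU (Φ (fun i => g (Sum.inl i))) (Y (fun i => g (Sum.inl i))) (fun i => (g (Sum.inr i))⁻¹)))).card : ℝ) ≤ (β + β') * (n.factorial : ℝ)^(a + k) := by
  have hN : (Fintype.card (Equiv.Perm (Fin n)) : ℝ) = n.factorial := by rw [Fintype.card_perm, Fintype.card_fin]
  have hβ0 : 0 ≤ β' := le_trans (by positivity) hβ'
  subst hK'
  subst hθ'
  constructor
  · refine count_sum' (A := A) (B := Fin k) (Ω := Equiv.Perm (Fin n)) (fun g => LGood K θ (Φ g)) _ β β' n.factorial hN a k ha (by simp) hβ0 h1 ?_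
    intro g hg
    have := layer' hn2 K hK θ hθ (Φ g) hg (Y g) (hY g) j k hk
    exact this.trans (mul_le_mul_of_nonneg_right hβ' (by positivity))
  · refine count_sum' (A := A) (B := Fin k) (Ω := Equiv.Perm (Fin n)) (fun g => LGood K θ (Φ g)) _ β β' n.factorial hN a k ha (by simp) hβ0 h1 ?_
    intro g hg
    have := layer_inv hn2 K hK θ hθ (Φ g) hg (Y g) (hY g) j k hk
    exact this.trans (mul_le_mul_of_nonneg_right hβ' (by positivity))

set_option maxHeartbeats 1000000 in
lemma sw_count {n : ℕ} (hn : 2000 ≤ n) (j k : ℕ) (hk : k = 2 * j) (hj : n^2 ≤ k^3) (hj2 : k ≤ n) (FC FS : Finset (Fin n)) (hFC : 100 * FC.card ≤ n) (hFS : 100 * FS.card ≤ n) :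
    ((Finset.univ.filter (fun g : JJ k → Equiv.Perm (Fin n) => ¬ SwOK FC FS (g (Sum.inl (Sum.inl (Sum.inl (Sum.inl 0))))) (g (Sum.inl (Sum.inl (Sum.inl (Sum.inl 1)))))
      (fun i => g (Sum.inl (Sum.inl (Sum.inl (Sum.inr i))))) (fun i => g (Sum.inl (Sum.inl (Sum.inr i)))) (fun i => g (Sum.inl (Sum.inr i))) (fun i => g (Sum.inr i)))).card : ℝ) ≤
      (4 * (2^k * Real.exp (-(ccc * th3^2 * n))^j)) * (n.factorial : ℝ)^(2 + 4 * k) := by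
  have hn2 : 2 ≤ n := by omega
  have hn0 : (0:ℝ) < n := by positivity
  have hj0 : 0 < j := by
    rcases Nat.eq_zero_or_pos j with h | h
    · subst h
      have : 0 < n^2 := by positivity
      simp [hk] at hj; omega
    · exact h
  have hk0 : 0 < k := by omega
  have hN : (Fintype.card (Equiv.Perm (Fin n)) : ℝ) = n.factorial := by rw [Fintype.card_perm, Fintype.card_fin]
  choose Y0 Z34 Y2 Z12 hsz hY0 hZ34 hY2 hZ12 using zones hn FC FS hFC hFS
  obtain ⟨β, hβ⟩ : ∃ β, β = (2:ℝ)^k * Real.exp (-(ccc * th3^2 * n))^j := ⟨_, rfl⟩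
  have hβ0 : 0 ≤ β := by rw [hβ]; positivity
  have hβle : ∀ θ : ℝ, th3 ≤ θ → (2:ℝ)^k * Real.exp (-(ccc * θ^2 * n))^j ≤ β := by
    intro θ hθ
    have h3 : 0 < th3 := by unfold th3; norm_num
    have hc : 0 < ccc := by unfold ccc; norm_num
    rw [hβ]; gcongr
  obtain ⟨t0, ht0⟩ : ∃ t : ℝ, t = 1/300 := ⟨_, rfl⟩
  obtain ⟨t1, ht1⟩ : ∃ t : ℝ, t = t0/2400 := ⟨_, rfl⟩
  obtain ⟨t2, ht2⟩ : ∃ t : ℝ, t = t1/2400 := ⟨_, rfl⟩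
  have ht3 : t2 / 2400 = th3 := by rw [ht2, ht1, ht0]; rfl
  have p0 : 0 < t0 := by rw [ht0]; norm_num
  have p1 : 0 < t1 := by rw [ht1]; positivity
  have p2 : 0 < t2 := by rw [ht2]; positivity
  have c0 : ((Finset.univ.filter (fun g : Fin 2 → Equiv.Perm (Fin n) => ¬ LGood 1 t0 (psi0 (Y0 (g 0) (g 1))))).card : ℝ) ≤ 0 * (n.factorial : ℝ)^2 := by
    rw [zero_mul]
    apply le_of_eq
    norm_cast
    rw [Finset.card_eq_zero, Finset.filter_eq_empty_iff]
    intro g _ h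
    apply h
    rw [ht0]
    exact psi0_good _ (hsz (g 0) (g 1)).1
  have c1 := (lay_step hn2 k (fun g : Fin 2 → Equiv.Perm (Fin n) => psi0 (Y0 (g 0) (g 1))) (fun g => Z12 (g 0) (g 1)) (fun g => (hsz (g 0) (g 1)).2.2.2)
    1 k (by norm_num) t0 t1 p0 j hk (by rw [mul_one]; apply min_eq_left; nlinarith) ht1.symm 2 (by simp) 0 β (hβle _ (by rw [← ht3]; linarith)) c0).2
  have c2 := (lay_step hn2 k _ (fun g : Fin 2 ⊕ Fin k → Equiv.Perm (Fin n) => Y2 (g (Sum.inl 0)) (g (Sum.inl 1))) (fun g => (hsz (g (Sum.inl 0)) (g (Sum.inl 1))).2.2.1)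
    k (k*k) hk0 t1 t2 p1 j hk (by apply min_eq_left; rw [sq]; exact Nat.mul_le_mul hj2 hj2) ht2.symm (2+k) (by simp) _ β (hβle _ (by rw [← ht3]; linarith)) c1).1
  have c3 := (lay_step hn2 k _ (fun g : (Fin 2 ⊕ Fin k) ⊕ Fin k → Equiv.Perm (Fin n) => Z34 (g (Sum.inl (Sum.inl 0))) (g (Sum.inl (Sum.inl 1)))) (fun g => (hsz (g (Sum.inl (Sum.inl 0))) (g (Sum.inl (Sum.inl 1)))).2.1)
    (k*k) (n^2) (by positivity) t2 th3 p2 j hk (by apply min_eq_right; rw [pow_succ k, sq k] at hj; linarith) ht3 (2+k+k) (by simp) _ β (hβle _ (by rw [← ht3]; linarith)) c2).2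
  have c4 := count_sum' (A := ((Fin 2 ⊕ Fin k) ⊕ Fin k) ⊕ Fin k) (B := Fin k) (Ω := Equiv.Perm (Fin n)) _
    (fun g : JJ k → Equiv.Perm (Fin n) => SwOK FC FS (g (Sum.inl (Sum.inl (Sum.inl (Sum.inl 0))))) (g (Sum.inl (Sum.inl (Sum.inl (Sum.inl 1)))))
      (fun i => g (Sum.inl (Sum.inl (Sum.inl (Sum.inr i))))) (fun i => g (Sum.inl (Sum.inl (Sum.inr i)))) (fun i => g (Sum.inl (Sum.inr i))) (fun i => g (Sum.inr i)))
    _ β n.factorial hN (2 + k + k + k) k (by simp) (by simp) hβ0 c3 (by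
    intro g hg
    have hbig := hg.big
    have := final_part hn2 FC FS (g (Sum.inl (Sum.inl (Sum.inl 0)))) (g (Sum.inl (Sum.inl (Sum.inl 1)))) _ _ _ _ (hY0 _ _) (hZ34 _ _) (hY2 _ _) (hZ12 _ _)
      (fun i => g (Sum.inl (Sum.inl (Sum.inr i)))) (fun i => g (Sum.inl (Sum.inr i))) (fun i => g (Sum.inr i)) _ rfl (le_trans (le_of_eq (by push_cast; ring)) hbig)
    refine le_trans ?_ (this.trans (mul_le_mul_of_nonneg_right ?_ (by positivity)))
    · exact le_of_eq (by congr!)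
    · rw [hβ, ← Real.exp_nat_mul]
      have h2k : (1:ℝ) ≤ 2^k := one_le_pow₀ (by norm_num)
      refine le_trans ?_ (le_mul_of_one_le_left (Real.exp_pos _).le h2k)
      apply Real.exp_le_exp.mpr
      rw [mul_neg]
      apply neg_le_neg
      rw [hk]; push_cast
      have hx : (0:ℝ) ≤ j * th3^2 * n := by positivity
      have e : 2 * (j:ℝ) * th3^2 * n / 128 = (j * th3^2 * n) * (1/64) := by ring
      have e' : (j:ℝ) * (ccc * th3^2 * n) = (j * th3^2 * n) * ccc := by ring
      rw [e, e']
      refine mul_le_mul_of_nonneg_left ?_ hx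
      unfold ccc; norm_num)
  refine c4.trans (le_of_eq ?_)
  have e : 2 + k + k + k + k = 2 + 4 * k := by ring
  rw [e, ← hβ]; ring

lemma sw_num (c ε : ℝ) (hc : 0 < c) (hε : 0 < ε) : ∀ᶠ n : ℕ in atTop,
    (n:ℝ)^(2 + 4 * (2 * (mm n)^23)) * 4^n * (4 * (2^(2 * (mm n)^23) * Real.exp (-(c * n))^((mm n)^23))) *
      Real.exp (((2 + 4 * (2 * (mm n)^23) : ℕ):ℝ)^2 + 2 * n * (1 + Real.log n)^2) ≤ ε := by
  filter_upwards [log_le_mm (c/14) (by positivity), mm_tendsto.eventually_ge_atTop 2, eventually_ge_atTop 2,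
    eventually_ge_atTop (⌈Real.log (1/ε)⌉₊), mm_tendsto.eventually_ge_atTop ⌈(200/c)⌉₊] with n hlog hm hn hnε hmη
  have hmp : (2:ℝ) ≤ mm n := by exact_mod_cast hm
  have hm33 : ((mm n:ℝ))^33 ≤ n := by exact_mod_cast mm_pow_le n
  have hn0 : (0:ℝ) < n := by positivity
  have hmη' : 200 / c ≤ mm n := (Nat.le_ceil _).trans (by exact_mod_cast hmη)
  obtain ⟨m, hmdef⟩ : ∃ m : ℕ, m = mm n := ⟨_, rfl⟩
  rw [← hmdef] at hlog hm hmη hmp hm33 hmη' ⊢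
  have hm0 : (0:ℝ) < m := by linarith
  obtain ⟨k, hkdef⟩ : ∃ k : ℕ, k = 2 + 4 * (2 * m^23) := ⟨_, rfl⟩
  rw [← hkdef]
  have h23 : (1:ℝ) ≤ (m:ℝ)^23 := one_le_pow₀ (by linarith)
  have hk : (k:ℝ) ≤ 10 * (m:ℝ)^23 := by
    rw [hkdef]; push_cast; linarith
  have h10 : (1024:ℝ) ≤ (m:ℝ)^10 := by
    have := pow_le_pow_left₀ (by norm_num) hmp 10
    norm_num at this ⊢; exact this
  have hn1024 : 1024 * (m:ℝ)^23 ≤ n := by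
    refine le_trans ?_ hm33
    calc 1024 * (m:ℝ)^23 ≤ (m:ℝ)^10 * (m:ℝ)^23 := mul_le_mul_of_nonneg_right h10 (by positivity)
      _ = _ := by ring
  have hkn : (k:ℝ) ≤ n := by linarith
  have hnexp : (n:ℝ)^k = Real.exp (k * Real.log n) := by
    rw [mul_comm, Real.exp_mul, Real.exp_log hn0, Real.rpow_natCast]
  have e1 := Real.add_one_le_exp (1:ℝ)
  have e2 : Real.exp 2 = Real.exp 1 * Real.exp 1 := by rw [← Real.exp_add]; norm_num
  have e3 : (4:ℝ) ≤ Real.exp 2 := by rw [e2]; nlinarith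
  have h4 : (4:ℝ)^n ≤ Real.exp (n * 2) := by
    rw [mul_comm, Real.exp_mul, Real.rpow_natCast]
    exact pow_le_pow_left₀ (by norm_num) e3 _
  have h2k : (2:ℝ)^(2 * m^23) ≤ Real.exp (2 * (m:ℝ)^23) := by
    have : (2 * (m:ℝ)^23) = 1 * ((2 * m^23 : ℕ) : ℝ) := by push_cast; ring
    rw [this, Real.exp_mul, Real.rpow_natCast]
    exact pow_le_pow_left₀ (by norm_num) (by linarith) _
  have h5 : Real.exp (-(c * n))^(m^23) = Real.exp ((m:ℝ)^23 * (-(c * n))) := by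
    rw [← Real.exp_nat_mul]; push_cast; rfl
  have hεe : Real.exp (-(n:ℝ)) ≤ ε := by
    have h1 : Real.log (1/ε) ≤ n := (Nat.le_ceil _).trans (by exact_mod_cast hnε)
    rw [one_div, Real.log_inv] at h1
    calc Real.exp (-(n:ℝ)) ≤ Real.exp (Real.log ε) := Real.exp_le_exp.mpr (by linarith)
      _ = ε := Real.exp_log hε
  refine le_trans ?_ hεe
  have hlog0 : 0 ≤ Real.log n := Real.log_nonneg (by exact_mod_cast (by omega : 1 ≤ n))
  calc _ ≤ Real.exp (k * Real.log n) * Real.exp (n * 2) * (Real.exp 2 * (Real.exp (2 * (m:ℝ)^23) * Real.exp ((m:ℝ)^23 * (-(c * n))))) * Real.exp ((k:ℝ)^2 + 2 * n * (1 + Real.log n)^2) := by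
          rw [hnexp, h5]; gcongr
    _ ≤ _ := by
      rw [← Real.exp_add, ← Real.exp_add, ← Real.exp_add, ← Real.exp_add, ← Real.exp_add]
      apply Real.exp_le_exp.mpr
      set x := 1 + Real.log n with hx
      have hx1 : 1 ≤ x := by linarith
      have hx4 : x^2 ≤ x^4 := pow_le_pow_right₀ hx1 (by norm_num)
      have hx44 : x ≤ x^4 := le_self_pow₀ hx1 (by norm_num)
      have h6 : (n:ℝ) * x^4 ≤ n * (c/14 * m) := mul_le_mul_of_nonneg_left hlog hn0.le
      have h7 : (k:ℝ) * Real.log n ≤ n * x^4 := by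
        refine mul_le_mul (by linarith) (by linarith) hlog0 hn0.le
      have h8 : 2 * n * x^2 ≤ 2 * (n * x^4) := by
        rw [mul_assoc]
        exact mul_le_mul_of_nonneg_left (mul_le_mul_of_nonneg_left hx4 hn0.le) (by norm_num)
      have h10' : (n:ℝ) ≤ n * x^4 := le_mul_of_one_le_right hn0.le (hx1.trans hx44)
      have hm23 : (m:ℝ) ≤ (m:ℝ)^23 := le_self_pow₀ (by linarith) (by norm_num)
      have h11 : (n:ℝ) * (c/14 * m) ≤ n * (c/14 * (m:ℝ)^23) := by gcongr
      have h12 : (k:ℝ)^2 ≤ (m:ℝ)^23 * n * (c/2) := by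
        calc (k:ℝ)^2 ≤ (10 * (m:ℝ)^23)^2 := pow_le_pow_left₀ (by positivity) hk 2
          _ = (m:ℝ)^23 * (100 * (m:ℝ)^23) := by ring
          _ ≤ (m:ℝ)^23 * (n * (c/2)) := by
            refine mul_le_mul_of_nonneg_left ?_ (by positivity)
            rw [div_le_iff₀ hc] at hmη'
            have : (m:ℝ)^23 * m ≤ n := by
              refine le_trans ?_ hm33
              rw [← pow_succ]
              exact pow_le_pow_right₀ (by linarith) (by norm_num)
            have a1 := mul_le_mul_of_nonneg_left hmη' (by positivity : (0:ℝ) ≤ (m:ℝ)^23 / 2)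
            have a2 := mul_le_mul_of_nonneg_right this (by positivity : (0:ℝ) ≤ c/2)
            calc 100 * (m:ℝ)^23 = (m:ℝ)^23 / 2 * 200 := by ring
              _ ≤ (m:ℝ)^23 / 2 * (m * c) := a1
              _ = (m:ℝ)^23 * m * (c/2) := by ring
              _ ≤ _ := a2
          _ = _ := by ring
      have h13 : 2 + 2 * (m:ℝ)^23 ≤ n := by linarith
      have e6 : (n:ℝ) * (c/14 * (m:ℝ)^23) = (m:ℝ)^23 * n * c / 14 := by ring
      have e7 : (m:ℝ)^23 * (-(c * n)) = -((m:ℝ)^23 * n * c) := by ring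
      have e8 : (m:ℝ)^23 * n * (c/2) = (m:ℝ)^23 * n * c / 2 := by ring
      rw [e7]
      rw [e6] at h11
      rw [e8] at h12
      linarith

/-- switching property, with rows -/
def SwRow {n : ℕ} (f : Fin n → Equiv.Perm (Fin n)) : Prop :=
  ∀ r r' : Fin n, r ≠ r' → ∀ FR FC FS : Finset (Fin n), 100 * FR.card ≤ n → 100 * FC.card ≤ n → 100 * FS.card ≤ n →
  ∃ w1 w2 w3 w4 : Fin n, ∃ c d1 d2 d3 d4 x y x2 y2 s : Fin n,
    (f r c = y ∧ f w4 c = x ∧ f w1 d1 = x ∧ f w1 d2 = y ∧ f w2 d1 = x2 ∧ f w2 d2 = y2 ∧ f w3 d3 = x2 ∧ f w3 d4 = y2 ∧ f w4 d4 = s ∧ f r' d3 = s) ∧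
    [w1, w2, w3, w4].Nodup ∧ (∀ z ∈ [w1, w2, w3, w4], z ≠ r ∧ z ≠ r' ∧ z ∉ FR) ∧
    [c, d1, d2, d3, d4].Nodup ∧ [x, y, x2, y2, s].Nodup ∧ (∀ z ∈ [c, d1, d2, d3, d4], z ∉ FC) ∧ (∀ z ∈ [x, y, x2, y2, s], z ∉ FS)

lemma jj_emb {n k : ℕ} (hkn : 1000 * k ≤ n) (hn : 2000 ≤ n) (r r' : Fin n) (hrr : r ≠ r') (FR : Finset (Fin n)) (hFR : 100 * FR.card ≤ n) :
    ∃ e : JJ k ↪ Fin n, e (Sum.inl (Sum.inl (Sum.inl (Sum.inl 0)))) = r ∧ e (Sum.inl (Sum.inl (Sum.inl (Sum.inl 1)))) = r' ∧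
      (∀ i, e (Sum.inl (Sum.inl (Sum.inl (Sum.inr i)))) ∉ FR) ∧ (∀ i, e (Sum.inl (Sum.inl (Sum.inr i))) ∉ FR) ∧ (∀ i, e (Sum.inl (Sum.inr i)) ∉ FR) ∧ (∀ i, e (Sum.inr i) ∉ FR) := by
  have hcard : 4 * k ≤ ((Finset.univ : Finset (Fin n)) \ (insert r (insert r' FR))).card := by
    have h1 := Finset.le_card_sdiff (insert r (insert r' FR)) (Finset.univ : Finset (Fin n))
    have h2 := Finset.card_insert_le r (insert r' FR)
    have h3 := Finset.card_insert_le r' FR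
    rw [Finset.card_univ, Fintype.card_fin] at h1
    omega
  obtain ⟨S, hS, hSc⟩ := Finset.exists_subset_card_eq hcard
  have hemb : Nonempty ((((Fin k ⊕ Fin k) ⊕ Fin k) ⊕ Fin k) ≃ S) := by
    rw [← Fintype.card_eq]
    simp [hSc]; ring
  obtain ⟨φ⟩ := hemb
  have hφ : ∀ a, (φ a : Fin n) ≠ r ∧ (φ a : Fin n) ≠ r' ∧ (φ a : Fin n) ∉ FR := by
    intro a
    have := Finset.mem_sdiff.mp (hS (φ a).2)
    simpa [not_or] using this.2
  have hφi : ∀ a b, (φ a : Fin n) = φ b → a = b := fun a b h => φ.injective (Subtype.ext h)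
  let e : JJ k → Fin n := Sum.elim (Sum.elim (Sum.elim (Sum.elim (fun i : Fin 2 => if i = 0 then r else r') (fun i => φ (Sum.inl (Sum.inl (Sum.inl i))))) (fun i => φ (Sum.inl (Sum.inl (Sum.inr i))))) (fun i => φ (Sum.inl (Sum.inr i)))) (fun i => φ (Sum.inr i))
  have he : Function.Injective e := by
    refine Function.Injective.sumElim (Function.Injective.sumElim (Function.Injective.sumElim (Function.Injective.sumElim ?_ ?_ ?_) ?_ ?_) ?_ ?_) ?_ ?_
    · intro i i' h
      fin_cases i <;> fin_cases i' <;> simp_all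
    · intro i i' h; simpa using hφi _ _ h
    · intro i i'
      split_ifs
      · exact (hφ _).1.symm
      · exact (hφ _).2.1.symm
    · intro i i' h; simpa using hφi _ _ h
    · rintro (i | i) i' h
      · simp only [Sum.elim_inl] at h
        split_ifs at h
        · exact (hφ _).1.symm h
        · exact (hφ _).2.1.symm h
      · simpa using hφi _ _ h
    · intro i i' h; simpa using hφi _ _ h
    · rintro ((i | i) | i) i' h
      · simp only [Sum.elim_inl] at h
        split_ifs at h
        · exact (hφ _).1.symm h
        · exact (hφ _).2.1.symm h
      · simpa using hφi _ _ h
      · simpa using hφi _ _ h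
    · intro i i' h; simpa using hφi _ _ h
    · rintro (((i | i) | i) | i) i' h
      · simp only [Sum.elim_inl] at h
        split_ifs at h
        · exact (hφ _).1.symm h
        · exact (hφ _).2.1.symm h
      · simpa using hφi _ _ h
      · simpa using hφi _ _ h
      · simpa using hφi _ _ h
  exact ⟨⟨e, he⟩, rfl, rfl, fun i => (hφ _).2.2, fun i => (hφ _).2.2, fun i => (hφ _).2.2, fun i => (hφ _).2.2⟩

lemma sw_extract {n k : ℕ} (f : Fin n → Equiv.Perm (Fin n)) (r r' : Fin n) (FR FC FS : Finset (Fin n)) (e : JJ k ↪ Fin n)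
    (he0 : e (Sum.inl (Sum.inl (Sum.inl (Sum.inl 0)))) = r) (he1 : e (Sum.inl (Sum.inl (Sum.inl (Sum.inl 1)))) = r')
    (hq1 : ∀ i, e (Sum.inl (Sum.inl (Sum.inl (Sum.inr i)))) ∉ FR) (hq2 : ∀ i, e (Sum.inl (Sum.inl (Sum.inr i))) ∉ FR) (hq3 : ∀ i, e (Sum.inl (Sum.inr i)) ∉ FR) (hq4 : ∀ i, e (Sum.inr i) ∉ FR)
    (h : SwOK FC FS (f (e (Sum.inl (Sum.inl (Sum.inl (Sum.inl 0)))))) (f (e (Sum.inl (Sum.inl (Sum.inl (Sum.inl 1))))))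
      (fun i => f (e (Sum.inl (Sum.inl (Sum.inl (Sum.inr i)))))) (fun i => f (e (Sum.inl (Sum.inl (Sum.inr i))))) (fun i => f (e (Sum.inl (Sum.inr i)))) (fun i => f (e (Sum.inr i)))) :
  ∃ w1 w2 w3 w4 : Fin n, ∃ c d1 d2 d3 d4 x y x2 y2 s : Fin n,
    (f r c = y ∧ f w4 c = x ∧ f w1 d1 = x ∧ f w1 d2 = y ∧ f w2 d1 = x2 ∧ f w2 d2 = y2 ∧ f w3 d3 = x2 ∧ f w3 d4 = y2 ∧ f w4 d4 = s ∧ f r' d3 = s) ∧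
    [w1, w2, w3, w4].Nodup ∧ (∀ z ∈ [w1, w2, w3, w4], z ≠ r ∧ z ≠ r' ∧ z ∉ FR) ∧
    [c, d1, d2, d3, d4].Nodup ∧ [x, y, x2, y2, s].Nodup ∧ (∀ z ∈ [c, d1, d2, d3, d4], z ∉ FC) ∧ (∀ z ∈ [x, y, x2, y2, s], z ∉ FS) := by
  obtain ⟨i1, i2, i3, i4, c, d1, d2, d3, d4, x, y, x2, y2, s, hall, hc1, hc2, hc3, hc4⟩ := h
  rw [he0, he1] at hall
  have hne : ∀ a b, a ≠ b → e a ≠ e b := fun a b h h' => h (e.injective h')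
  refine ⟨_, _, _, _, c, d1, d2, d3, d4, x, y, x2, y2, s, hall, ?_, ?_, hc1, hc2, hc3, hc4⟩
  · simp only [List.nodup_cons, List.mem_cons, List.not_mem_nil, or_false, not_or, not_false_eq_true, List.nodup_nil, and_true]
    refine ⟨⟨?_, ?_, ?_⟩, ⟨?_, ?_⟩, ?_⟩ <;> (apply hne; intro h; simp at h)
  · simp only [List.forall_mem_cons, List.not_mem_nil, false_imp_iff, implies_true, and_true]
    rw [← he0, ← he1]
    refine ⟨⟨?_, ?_, hq1 _⟩, ⟨?_, ?_, hq2 _⟩, ⟨?_, ?_, hq3 _⟩, ⟨?_, ?_, hq4 _⟩⟩ <;> (apply hne; intro h; simp at h)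

theorem sw_aas (ε : ℝ) (hε : 0 < ε) : ∀ᶠ n : ℕ in atTop,
    (((latP n).filter (fun f => ¬ SwRow f)).card : ℝ) ≤ ε * ((latP n).card : ℝ) := by
  have hc : 0 < ccc * th3^2 := by unfold ccc th3; positivity
  filter_upwards [sw_num (ccc * th3^2) ε hc hε, eventually_ge_atTop 2000, mm_tendsto.eventually_ge_atTop (2^21)] with n hnum hn hm
  obtain ⟨m, hmdef⟩ : ∃ m : ℕ, m = mm n := ⟨_, rfl⟩
  have hm33 : m^33 ≤ n := by rw [hmdef]; exact mm_pow_le n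
  have hlt : n < (m+1)^33 := by rw [hmdef]; exact lt_mm_succ_pow n
  rw [← hmdef] at hnum hm
  obtain ⟨k, hk⟩ : ∃ k : ℕ, k = 2 * m^23 := ⟨_, rfl⟩
  rw [← hk] at hnum
  have hkn : 1000 * k ≤ n := by
    have : (2^21)^10 * m^23 ≤ m^10 * m^23 := Nat.mul_le_mul_right _ (Nat.pow_le_pow_left hm 10)
    have e : m^10 * m^23 = m^33 := by ring
    have h3 : 2000 * m^23 ≤ (2^21)^10 * m^23 := Nat.mul_le_mul_right _ (by norm_num)
    omega
  have hk3 : n^2 ≤ k^3 := by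
    calc n^2 ≤ ((m+1)^33)^2 := Nat.pow_le_pow_left hlt.le 2
      _ ≤ ((2*m)^33)^2 := Nat.pow_le_pow_left (Nat.pow_le_pow_left (by omega) 33) 2
      _ = (2^21)^3 * (2^3 * m^66) := by ring
      _ ≤ m^3 * (2^3 * m^66) := Nat.mul_le_mul_right _ (Nat.pow_le_pow_left hm 3)
      _ = k^3 := by rw [hk]; ring
  set β := 4 * ((2:ℝ)^k * Real.exp (-(ccc * th3^2 * n))^(m^23)) with hβ
  set T := {p : Finset (Fin n) × Finset (Fin n) // 100 * p.1.card ≤ n ∧ 100 * p.2.card ≤ n} with hT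
  set Bad : T → Finset (JJ k → Equiv.Perm (Fin n)) := fun t =>
    Finset.univ.filter (fun g : JJ k → Equiv.Perm (Fin n) => ¬ SwOK t.1.1 t.1.2 (g (Sum.inl (Sum.inl (Sum.inl (Sum.inl 0))))) (g (Sum.inl (Sum.inl (Sum.inl (Sum.inl 1)))))
      (fun i => g (Sum.inl (Sum.inl (Sum.inl (Sum.inr i))))) (fun i => g (Sum.inl (Sum.inl (Sum.inr i)))) (fun i => g (Sum.inl (Sum.inr i))) (fun i => g (Sum.inr i))) with hBad
  have hB : ∀ t, ((Bad t).card : ℝ) ≤ β * (n.factorial : ℝ)^(2 + 4 * k) := by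
    intro t
    exact sw_count hn (m^23) k hk hk3 (by omega) t.1.1 t.1.2 t.2.1 t.2.2
  have hcardJ : Fintype.card (JJ k) = 2 + 4 * k := by simp [JJ]; ring
  have htr := transfer_union (by omega) (2 + 4 * k) hcardJ (by omega) Bad β (by positivity) hB
  have hcT : (Fintype.card T : ℝ) ≤ 4^n := by
    have : Fintype.card T ≤ Fintype.card (Finset (Fin n) × Finset (Fin n)) := Fintype.card_subtype_le _
    rw [Fintype.card_prod, Fintype.card_finset, Fintype.card_fin, ← mul_pow] at this
    exact_mod_cast this
  have hsub : (latP n).filter (fun f => ¬ SwRow f) ⊆ (latP n).filter (fun f => ∃ e : JJ k ↪ Fin n, ∃ t, (fun j => f (e j)) ∈ Bad t) := by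
    intro f hf
    obtain ⟨hf1, hf2⟩ := Finset.mem_filter.mp hf
    refine Finset.mem_filter.mpr ⟨hf1, ?_⟩
    by_contra hcon
    apply hf2
    intro r r' hrr FR FC FS hFR hFC hFS
    obtain ⟨e, he0, he1, hq1, hq2, hq3, hq4⟩ := jj_emb hkn hn r r' hrr FR hFR
    have hnb : (fun j => f (e j)) ∉ Bad ⟨(FC, FS), hFC, hFS⟩ := fun h => hcon ⟨_, _, h⟩
    simp only [hBad, Finset.mem_filter, Finset.mem_univ, true_and, not_not] at hnb
    exact sw_extract f r r' FR FC FS e he0 he1 hq1 hq2 hq3 hq4 hnb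
  refine le_trans (Nat.cast_le.mpr (Finset.card_le_card hsub)) (htr.trans ?_)
  refine mul_le_mul_of_nonneg_right (le_trans ?_ hnum) (Nat.cast_nonneg _)
  rw [hβ]
  gcongr

/-- transpose -/
def trL {n : ℕ} (f : Fin n → Equiv.Perm (Fin n)) : Fin n → Equiv.Perm (Fin n) :=
  fun c => if h : Function.Bijective (fun r => f r c) then Equiv.ofBijective _ h else 1

def syL {n : ℕ} (f : Fin n → Equiv.Perm (Fin n)) : Fin n → Equiv.Perm (Fin n) :=
  fun s => if h : Function.Bijective (fun c => (trL f c)⁻¹ s) then Equiv.ofBijective _ h else 1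

lemma mem_latP {n : ℕ} {f : Fin n → Equiv.Perm (Fin n)} : f ∈ latP n ↔ ∀ r r', r ≠ r' → ∀ c, f r c ≠ f r' c := by
  simp [latP, LatOn]

lemma trL_apply {n : ℕ} {f : Fin n → Equiv.Perm (Fin n)} (hf : f ∈ latP n) (c r : Fin n) : trL f c r = f r c := by
  have h : Function.Bijective (fun r => f r c) := by
    rw [← Finite.injective_iff_bijective]
    intro r r' h
    by_contra hne
    exact mem_latP.mp hf r r' hne c h
  unfold trL
  rw [dif_pos h]; rfl

lemma syL_apply {n : ℕ} {f : Fin n → Equiv.Perm (Fin n)} (hf : f ∈ latP n) (s c : Fin n) : syL f s c = (trL f c)⁻¹ s := by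
  have h : Function.Bijective (fun c => (trL f c)⁻¹ s) := by
    rw [← Finite.injective_iff_bijective]
    intro c c' h
    have h1 : trL f c ((trL f c)⁻¹ s) = s := by simp
    have h2 : trL f c' ((trL f c)⁻¹ s) = s := by
      simp only at h
      rw [h]; simp
    rw [trL_apply hf] at h1 h2
    exact (f _).injective (h1.trans h2.symm)
  unfold syL
  rw [dif_pos h]; rfl

lemma syL_iff {n : ℕ} {f : Fin n → Equiv.Perm (Fin n)} (hf : f ∈ latP n) (r c s : Fin n) : syL f s c = r ↔ f r c = s := by
  rw [syL_apply hf, Equiv.Perm.inv_eq_iff_eq, trL_apply hf, eq_comm]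

lemma trL_mem {n : ℕ} {f : Fin n → Equiv.Perm (Fin n)} (hf : f ∈ latP n) : trL f ∈ latP n := by
  rw [mem_latP]
  intro c c' hne r
  rw [trL_apply hf, trL_apply hf]
  exact fun h => hne ((f r).injective h)

lemma syL_mem {n : ℕ} {f : Fin n → Equiv.Perm (Fin n)} (hf : f ∈ latP n) : syL f ∈ latP n := by
  rw [mem_latP]
  intro s s' hne c h
  have h1 := (syL_iff hf _ c s).mp h
  have h2 := (syL_iff hf _ c s').mp rfl
  exact hne (h1.symm.trans h2)

lemma conj_aas {n : ℕ} (T : (Fin n → Equiv.Perm (Fin n)) → (Fin n → Equiv.Perm (Fin n))) (hT : ∀ f ∈ latP n, T f ∈ latP n)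
    (hi : ∀ f ∈ latP n, ∀ f' ∈ latP n, T f = T f' → f = f') (P : (Fin n → Equiv.Perm (Fin n)) → Prop) :
    ((latP n).filter (fun f => ¬ P (T f))).card ≤ ((latP n).filter (fun f => ¬ P f)).card := by
  refine Finset.card_le_card_of_injOn T ?_ ?_
  · intro f hf
    obtain ⟨h1, h2⟩ := Finset.mem_filter.mp hf
    exact Finset.mem_coe.mpr (Finset.mem_filter.mpr ⟨hT f h1, h2⟩)
  · intro f hf f' hf' h
    exact hi f (Finset.mem_filter.mp hf).1 f' (Finset.mem_filter.mp hf').1 h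

lemma four_union {α : Type*} (S : Finset α) (p q r t : α → Prop) :
    (S.filter (fun x => ¬ (p x ∧ q x ∧ r x ∧ t x))).card ≤ (S.filter (fun x => ¬ p x)).card + (S.filter (fun x => ¬ q x)).card + (S.filter (fun x => ¬ r x)).card + (S.filter (fun x => ¬ t x)).card := by
  have hsub : S.filter (fun x => ¬ (p x ∧ q x ∧ r x ∧ t x)) ⊆ ((S.filter (fun x => ¬ p x) ∪ S.filter (fun x => ¬ q x)) ∪ S.filter (fun x => ¬ r x)) ∪ S.filter (fun x => ¬ t x) := by
    intro x hx
    simp only [Finset.mem_filter, Finset.mem_union] at hx ⊢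
    tauto
  refine (Finset.card_le_card hsub).trans ((Finset.card_union_le _ _).trans ?_)
  refine Nat.add_le_add_right ((Finset.card_union_le _ _).trans ?_) _
  exact Nat.add_le_add_right (Finset.card_union_le _ _) _

def GoodL (n : ℕ) (η : ℝ) (f : Fin n → Equiv.Perm (Fin n)) : Prop := DiscP n η f ∧ SwRow f ∧ SwRow (trL f) ∧ SwRow (syL f)

theorem good_aas (η ε : ℝ) (hη : 0 < η) (hη1 : η < 1) (hε : 0 < ε) : ∀ᶠ n : ℕ in atTop,
    (((latP n).filter (fun f => ¬ GoodL n η f)).card : ℝ) ≤ ε * ((latP n).card : ℝ) := by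
  filter_upwards [disc_aas η (ε/4) hη hη1 (by linarith), sw_aas (ε/4) (by linarith)] with n h1 h2
  have h3 := conj_aas trL (fun f hf => trL_mem hf) (by
    intro f hf f' hf' h
    funext r; ext c
    rw [← trL_apply hf, ← trL_apply hf', h]) (SwRow (n := n))
  have h4 := conj_aas syL (fun f hf => syL_mem hf) (by
    intro f hf f' hf' h
    funext r; apply Equiv.ext; intro c
    have := (syL_iff hf r c (f r c)).mpr rfl
    rw [h] at this
    exact ((syL_iff hf' r c _).mp this).symm) (SwRow (n := n))
  have h3' : (((latP n).filter (fun f => ¬ SwRow (trL f))).card : ℝ) ≤ (((latP n).filter (fun f => ¬ SwRow f)).card : ℝ) := by exact_mod_cast h3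
  have h4' : (((latP n).filter (fun f => ¬ SwRow (syL f))).card : ℝ) ≤ (((latP n).filter (fun f => ¬ SwRow f)).card : ℝ) := by exact_mod_cast h4
  have h9 := four_union (latP n) (DiscP n η) SwRow (fun f => SwRow (trL f)) (fun f => SwRow (syL f))
  have h10 : (((latP n).filter (fun f => ¬ GoodL n η f)).card : ℝ) ≤ ((latP n).filter (fun f => ¬ DiscP n η f)).card + ((latP n).filter (fun f => ¬ SwRow f)).card +
     ((latP n).filter (fun f => ¬ SwRow (trL f))).card + ((latP n).filter (fun f => ¬ SwRow (syL f))).card := by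
    refine le_trans (le_of_eq ?_) (le_trans (Nat.cast_le.mpr h9) (le_of_eq ?_))
    · congr 2; refine Finset.filter_congr fun f _ => ?_; unfold GoodL; exact Iff.rfl
    · push_cast; congr!
  linarith

section pm
variable {X Y Z : Type} [DecidableEq X] [DecidableEq Y] [DecidableEq Z]

def IsPM (R : X → Y → Z → Prop) (M : Finset (X × Y × Z)) (A : Finset X) (B : Finset Y) (D : Finset Z) : Prop :=
  (∀ t ∈ M, R t.1 t.2.1 t.2.2) ∧ (∀ t ∈ M, ∀ t' ∈ M, t.1 = t'.1 → t = t') ∧ (∀ t ∈ M, ∀ t' ∈ M, t.2.1 = t'.2.1 → t = t') ∧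
  (∀ t ∈ M, ∀ t' ∈ M, t.2.2 = t'.2.2 → t = t') ∧ M.image (fun t => t.1) = A ∧ M.image (fun t => t.2.1) = B ∧ M.image (fun t => t.2.2) = D

def PM (R : X → Y → Z → Prop) (A : Finset X) (B : Finset Y) (D : Finset Z) : Prop := ∃ M, IsPM R M A B D

lemma IsPM.card {R : X → Y → Z → Prop} {M : Finset (X × Y × Z)} {A : Finset X} {B : Finset Y} {D : Finset Z} (h : IsPM R M A B D) :
    M.card = A.card ∧ M.card = B.card ∧ M.card = D.card := by
  obtain ⟨h1, h2, h3, h4, h5, h6, h7⟩ := h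
  refine ⟨?_, ?_, ?_⟩
  · rw [← h5, Finset.card_image_of_injOn]; intro t ht t' ht' h; exact h2 t ht t' ht' h
  · rw [← h6, Finset.card_image_of_injOn]; intro t ht t' ht' h; exact h3 t ht t' ht' h
  · rw [← h7, Finset.card_image_of_injOn]; intro t ht t' ht' h; exact h4 t ht t' ht' h

lemma IsPM.union {R : X → Y → Z → Prop} {M M' : Finset (X × Y × Z)} {A A' : Finset X} {B B' : Finset Y} {D D' : Finset Z}
    (h : IsPM R M A B D) (h' : IsPM R M' A' B' D') (hA : Disjoint A A') (hB : Disjoint B B') (hD : Disjoint D D') :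
    IsPM R (M ∪ M') (A ∪ A') (B ∪ B') (D ∪ D') := by
  obtain ⟨h1, h2, h3, h4, h5, h6, h7⟩ := h
  obtain ⟨k1, k2, k3, k4, k5, k6, k7⟩ := h'
  rw [Finset.disjoint_left] at hA hB hD
  have aA : ∀ t ∈ M, t.1 ∈ A := fun t ht => by rw [← h5]; exact Finset.mem_image_of_mem _ ht
  have aB : ∀ t ∈ M, t.2.1 ∈ B := fun t ht => by rw [← h6]; exact Finset.mem_image_of_mem (fun t => t.2.1) ht
  have aD : ∀ t ∈ M, t.2.2 ∈ D := fun t ht => by rw [← h7]; exact Finset.mem_image_of_mem (fun t => t.2.2) ht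
  have bA : ∀ t ∈ M', t.1 ∈ A' := fun t ht => by rw [← k5]; exact Finset.mem_image_of_mem _ ht
  have bB : ∀ t ∈ M', t.2.1 ∈ B' := fun t ht => by rw [← k6]; exact Finset.mem_image_of_mem (fun t => t.2.1) ht
  have bD : ∀ t ∈ M', t.2.2 ∈ D' := fun t ht => by rw [← k7]; exact Finset.mem_image_of_mem (fun t => t.2.2) ht
  refine ⟨?_, ?_, ?_, ?_, ?_, ?_, ?_⟩
  · intro t ht
    rcases Finset.mem_union.mp ht with ht | ht
    · exact h1 t ht
    · exact k1 t ht
  · intro t ht t' ht' he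
    rcases Finset.mem_union.mp ht with ht | ht <;> rcases Finset.mem_union.mp ht' with ht' | ht'
    · exact h2 t ht t' ht' he
    · exact absurd (bA t' ht') (he ▸ hA (aA t ht))
    · exact absurd (bA t ht) (he ▸ hA (aA t' ht'))
    · exact k2 t ht t' ht' he
  · intro t ht t' ht' he
    rcases Finset.mem_union.mp ht with ht | ht <;> rcases Finset.mem_union.mp ht' with ht' | ht'
    · exact h3 t ht t' ht' he
    · exact absurd (bB t' ht') (he ▸ hB (aB t ht))
    · exact absurd (bB t ht) (he ▸ hB (aB t' ht'))
    · exact k3 t ht t' ht' he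
  · intro t ht t' ht' he
    rcases Finset.mem_union.mp ht with ht | ht <;> rcases Finset.mem_union.mp ht' with ht' | ht'
    · exact h4 t ht t' ht' he
    · exact absurd (bD t' ht') (he ▸ hD (aD t ht))
    · exact absurd (bD t ht) (he ▸ hD (aD t' ht'))
    · exact k4 t ht t' ht' he
  · rw [Finset.image_union, h5, k5]
  · rw [Finset.image_union, h6, k6]
  · rw [Finset.image_union, h7, k7]

lemma IsPM.single {R : X → Y → Z → Prop} {a : X} {b : Y} {d : Z} (h : R a b d) : IsPM R {(a, b, d)} {a} {b} {d} := by
  refine ⟨?_, ?_, ?_, ?_, ?_, ?_, ?_⟩ <;> simp [h]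

lemma PM.union {R : X → Y → Z → Prop} {A A' : Finset X} {B B' : Finset Y} {D D' : Finset Z}
    (h : PM R A B D) (h' : PM R A' B' D') (hA : Disjoint A A') (hB : Disjoint B B') (hD : Disjoint D D') :
    PM R (A ∪ A') (B ∪ B') (D ∪ D') := by
  obtain ⟨M, h⟩ := h
  obtain ⟨M', h'⟩ := h'
  exact ⟨_, h.union h' hA hB hD⟩

lemma PM.nil {R : X → Y → Z → Prop} : PM R ∅ ∅ ∅ := ⟨∅, by refine ⟨?_, ?_, ?_, ?_, ?_, ?_, ?_⟩ <;> simp⟩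

lemma PM.ins {R : X → Y → Z → Prop} {A : Finset X} {B : Finset Y} {D : Finset Z} (h : PM R A B D) {a : X} {b : Y} {d : Z}
    (hR : R a b d) (ha : a ∉ A) (hb : b ∉ B) (hd : d ∉ D) : PM R (insert a A) (insert b B) (insert d D) := by
  have := PM.union ⟨_, IsPM.single hR⟩ h (Finset.disjoint_singleton_left.mpr ha) (Finset.disjoint_singleton_left.mpr hb) (Finset.disjoint_singleton_left.mpr hd)
  simpa [Finset.singleton_union] using this

lemma PM.swap12 {R : X → Y → Z → Prop} {A : Finset X} {B : Finset Y} {D : Finset Z} (h : PM (fun b a d => R a b d) B A D) : PM R A B D := by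
  obtain ⟨M, h1, h2, h3, h4, h5, h6, h7⟩ := h
  refine ⟨M.image (fun t => (t.2.1, t.1, t.2.2)), ?_, ?_, ?_, ?_, ?_, ?_, ?_⟩
  · intro t ht
    obtain ⟨t0, ht0, rfl⟩ := Finset.mem_image.mp ht
    exact h1 t0 ht0
  · intro t ht t' ht' he
    obtain ⟨t0, ht0, rfl⟩ := Finset.mem_image.mp ht
    obtain ⟨t1, ht1, rfl⟩ := Finset.mem_image.mp ht'
    rw [h3 t0 ht0 t1 ht1 he]
  · intro t ht t' ht' he
    obtain ⟨t0, ht0, rfl⟩ := Finset.mem_image.mp ht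
    obtain ⟨t1, ht1, rfl⟩ := Finset.mem_image.mp ht'
    rw [h2 t0 ht0 t1 ht1 he]
  · intro t ht t' ht' he
    obtain ⟨t0, ht0, rfl⟩ := Finset.mem_image.mp ht
    obtain ⟨t1, ht1, rfl⟩ := Finset.mem_image.mp ht'
    rw [h4 t0 ht0 t1 ht1 he]
  · rw [Finset.image_image]; exact h6
  · rw [Finset.image_image]; exact h5
  · rw [Finset.image_image]; exact h7

lemma PM.swap13 {R : X → Y → Z → Prop} {A : Finset X} {B : Finset Y} {D : Finset Z} (h : PM (fun d b a => R a b d) D B A) : PM R A B D := by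
  obtain ⟨M, h1, h2, h3, h4, h5, h6, h7⟩ := h
  refine ⟨M.image (fun t => (t.2.2, t.2.1, t.1)), ?_, ?_, ?_, ?_, ?_, ?_, ?_⟩
  · intro t ht
    obtain ⟨t0, ht0, rfl⟩ := Finset.mem_image.mp ht
    exact h1 t0 ht0
  · intro t ht t' ht' he
    obtain ⟨t0, ht0, rfl⟩ := Finset.mem_image.mp ht
    obtain ⟨t1, ht1, rfl⟩ := Finset.mem_image.mp ht'
    rw [h4 t0 ht0 t1 ht1 he]
  · intro t ht t' ht' he
    obtain ⟨t0, ht0, rfl⟩ := Finset.mem_image.mp ht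
    obtain ⟨t1, ht1, rfl⟩ := Finset.mem_image.mp ht'
    rw [h3 t0 ht0 t1 ht1 he]
  · intro t ht t' ht' he
    obtain ⟨t0, ht0, rfl⟩ := Finset.mem_image.mp ht
    obtain ⟨t1, ht1, rfl⟩ := Finset.mem_image.mp ht'
    rw [h2 t0 ht0 t1 ht1 he]
  · rw [Finset.image_image]; exact h7
  · rw [Finset.image_image]; exact h6
  · rw [Finset.image_image]; exact h5

lemma greedy (R : X → Y → Z → Prop) (u : ℕ) (A0 : Finset X) (B0 : Finset Y) (D0 : Finset Z)
    (h : ∀ A ⊆ A0, ∀ B ⊆ B0, ∀ D ⊆ D0, A.card = B.card → A.card = D.card → u < A.card → ∃ a ∈ A, ∃ b ∈ B, ∃ d ∈ D, R a b d) :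
    ∀ k : ℕ, ∀ A ⊆ A0, ∀ B ⊆ B0, ∀ D ⊆ D0, A.card = k → B.card = k → D.card = k →
      ∃ A' ⊆ A, ∃ B' ⊆ B, ∃ D' ⊆ D, ∃ v ≤ u, A'.card = v ∧ B'.card = v ∧ D'.card = v ∧ PM R (A \ A') (B \ B') (D \ D') := by
  intro k
  induction k with
  | zero =>
    intro A hA B hB D hD h1 h2 h3
    refine ⟨A, subset_rfl, B, subset_rfl, D, subset_rfl, 0, Nat.zero_le _, h1, h2, h3, ?_⟩
    simp only [Finset.sdiff_self]
    exact PM.nil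
  | succ k ih =>
    intro A hA B hB D hD h1 h2 h3
    by_cases hu : k + 1 ≤ u
    · refine ⟨A, subset_rfl, B, subset_rfl, D, subset_rfl, k+1, hu, h1, h2, h3, ?_⟩
      simp only [Finset.sdiff_self]
      exact PM.nil
    · obtain ⟨a, ha, b, hb, d, hd, hR⟩ := h A hA B hB D hD (by omega) (by omega) (by omega)
      obtain ⟨A', hA', B', hB', D', hD', v, hv, c1, c2, c3, hpm⟩ := ih (A.erase a) ((Finset.erase_subset _ _).trans hA) (B.erase b) ((Finset.erase_subset _ _).trans hB)
        (D.erase d) ((Finset.erase_subset _ _).trans hD) (by rw [Finset.card_erase_of_mem ha]; omega) (by rw [Finset.card_erase_of_mem hb]; omega) (by rw [Finset.card_erase_of_mem hd]; omega)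
      refine ⟨A', hA'.trans (Finset.erase_subset _ _), B', hB'.trans (Finset.erase_subset _ _), D', hD'.trans (Finset.erase_subset _ _), v, hv, c1, c2, c3, ?_⟩
      have := hpm.ins hR (by simp) (by simp) (by simp)
      have e : ∀ {W : Type} [DecidableEq W] (S T : Finset W) (x : W), x ∈ S → T ⊆ S.erase x → insert x (S.erase x \ T) = S \ T := by
        intro W _ S T x hx hT
        ext y
        simp only [Finset.mem_insert, Finset.mem_sdiff, Finset.mem_erase]
        constructor
        · rintro (rfl | ⟨⟨_, h1⟩, h2⟩)
          · exact ⟨hx, fun h => (Finset.mem_erase.mp (hT h)).1 rfl⟩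
          · exact ⟨h1, h2⟩
        · rintro ⟨h1, h2⟩
          by_cases hy : y = x
          · exact Or.inl hy
          · exact Or.inr ⟨⟨hy, h1⟩, h2⟩
      rwa [e A A' a ha hA', e B B' b hb hB', e D D' d hd hD'] at this

lemma coverl (R : X → Y → Z → Prop) (N : ℕ) (A0 : Finset X) (Q : Finset Y) (Q' : Finset Z)
    (h : ∀ a ∈ A0, ∀ F : Finset Y, ∀ F' : Finset Z, F.card < N → F'.card < N → ∃ b ∈ Q, b ∉ F ∧ ∃ d ∈ Q', d ∉ F' ∧ R a b d) (F : Finset Y) (F' : Finset Z) :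
    ∀ A ⊆ A0, A.card + F.card ≤ N → A.card + F'.card ≤ N → ∃ U ⊆ Q, ∃ U' ⊆ Q', Disjoint U F ∧ Disjoint U' F' ∧ U.card = A.card ∧ U'.card = A.card ∧ PM R A U U' := by
  intro A
  induction A using Finset.induction_on with
  | empty =>
    intro _ _ _
    exact ⟨∅, by simp, ∅, by simp, by simp, by simp, rfl, rfl, PM.nil⟩
  | insert a A ha ih =>
    intro hA h1 h2
    rw [Finset.card_insert_of_notMem ha] at h1 h2
    obtain ⟨U, hU, U', hU', hd, hd', c, c', hpm⟩ := ih ((Finset.subset_insert _ _).trans hA) (by omega) (by omega)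
    obtain ⟨b, hb, hbF, d, hdd, hdF, hR⟩ := h a (hA (Finset.mem_insert_self _ _)) (U ∪ F) (U' ∪ F') (by have := Finset.card_union_le U F; omega) (by have := Finset.card_union_le U' F'; omega)
    rw [Finset.mem_union, not_or] at hbF hdF
    refine ⟨insert b U, Finset.insert_subset hb hU, insert d U', Finset.insert_subset hdd hU', ?_, ?_, ?_, ?_, hpm.ins hR ha hbF.1 hdF.1⟩
    · rw [Finset.disjoint_insert_left]; exact ⟨hbF.2, hd⟩
    · rw [Finset.disjoint_insert_left]; exact ⟨hdF.2, hd'⟩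
    · rw [Finset.card_insert_of_notMem ha, Finset.card_insert_of_notMem hbF.1, c]
    · rw [Finset.card_insert_of_notMem ha, Finset.card_insert_of_notMem hdF.1, c']
end pm

lemma set_eq_aux {Λ : Type} [DecidableEq Λ] (S S' U1 U2 Q Rest : Finset Λ) (hS' : S' ⊆ S) (hU1 : U1 ⊆ Q) (hU2 : U2 ⊆ Q) :
    (S \ S') ∪ (S' ∪ U1 ∪ U2) ∪ (Q \ (U1 ∪ U2) ∪ Rest) = S ∪ (Q ∪ Rest) := by
  have a : (S \ S') ∪ (S' ∪ U1 ∪ U2) = S ∪ (U1 ∪ U2) := by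
    rw [Finset.union_assoc S', ← Finset.union_assoc, Finset.sdiff_union_of_subset hS']
  rw [a, Finset.union_assoc, ← Finset.union_assoc (U1 ∪ U2), Finset.union_sdiff_of_subset (Finset.union_subset hU1 hU2)]

lemma level_step {Λ : Type} [DecidableEq Λ] (R : Λ → Λ → Λ → Prop) (L Q Rest : Finset Λ) (hLQ : Disjoint L Q) (hLR : Disjoint L Rest) (hQR : Disjoint Q Rest) (u : ℕ)
    (hedge : ∀ A ⊆ L, ∀ B ⊆ L, ∀ D ⊆ L, A.card = B.card → A.card = D.card → u < A.card → ∃ a ∈ A, ∃ b ∈ B, ∃ d ∈ D, R a b d)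
    (h1 : ∀ a ∈ L, ∀ F F' : Finset Λ, F.card < 2 * u → F'.card < 2 * u → ∃ b ∈ Q, b ∉ F ∧ ∃ d ∈ Q, d ∉ F' ∧ R a b d)
    (h2 : ∀ b ∈ L, ∀ F F' : Finset Λ, F.card < 2 * u → F'.card < 2 * u → ∃ a ∈ Q, a ∉ F ∧ ∃ d ∈ Q, d ∉ F' ∧ R a b d)
    (h3 : ∀ d ∈ L, ∀ F F' : Finset Λ, F.card < 2 * u → F'.card < 2 * u → ∃ b ∈ Q, b ∉ F ∧ ∃ a ∈ Q, a ∉ F' ∧ R a b d)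
    (hP : ∀ A ⊆ Q, ∀ B ⊆ Q, ∀ D ⊆ Q, A.card = B.card → A.card = D.card → PM R (A ∪ Rest) (B ∪ Rest) (D ∪ Rest)) :
    ∀ A ⊆ L, ∀ B ⊆ L, ∀ D ⊆ L, A.card = B.card → A.card = D.card → PM R (A ∪ (Q ∪ Rest)) (B ∪ (Q ∪ Rest)) (D ∪ (Q ∪ Rest)) := by
  intro A hA B hB D hD hAB hAD
  obtain ⟨A', hA', B', hB', D', hD', v, hv, c1, c2, c3, hpm⟩ := greedy R u L L L hedge A.card A hA B hB D hD rfl hAB.symm hAD.symm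
  obtain ⟨UC1, uc1, US1, us1, -, -, e1, e1', pm1⟩ := coverl R (2*u) L Q Q h1 ∅ ∅ A' (hA'.trans hA) (by simp; omega) (by simp; omega)
  obtain ⟨UR1, ur1, US2, us2, -, dS, e2, e2', pm2⟩ := coverl (fun b a d => R a b d) (2*u) L Q Q h2 ∅ US1 B' (hB'.trans hB) (by simp; omega) (by omega)
  obtain ⟨UC2, uc2, UR2, ur2, dC, dR, e3, e3', pm3⟩ := coverl (fun d b a => R a b d) (2*u) L Q Q h3 UC1 UR1 D' (hD'.trans hD) (by omega) (by omega)
  replace pm2 := PM.swap12 pm2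
  replace pm3 := PM.swap13 pm3
  have pmQ := hP (Q \ (UR1 ∪ UR2)) Finset.sdiff_subset (Q \ (UC1 ∪ UC2)) Finset.sdiff_subset (Q \ (US1 ∪ US2)) Finset.sdiff_subset
    (by rw [Finset.card_sdiff_of_subset (Finset.union_subset ur1 ur2), Finset.card_sdiff_of_subset (Finset.union_subset uc1 uc2), Finset.card_union_of_disjoint dR.symm, Finset.card_union_of_disjoint dC.symm]; omega)
    (by rw [Finset.card_sdiff_of_subset (Finset.union_subset ur1 ur2), Finset.card_sdiff_of_subset (Finset.union_subset us1 us2), Finset.card_union_of_disjoint dR.symm, Finset.card_union_of_disjoint dS.symm]; omega)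
  -- combine
  have dj : ∀ {S T : Finset Λ}, S ⊆ L → T ⊆ Q → Disjoint S T := fun hS hT => Finset.disjoint_of_subset_left hS (Finset.disjoint_of_subset_right hT hLQ)
  have p12 := pm1.union pm2 (dj (hA'.trans hA) ur1) (dj (hB'.trans hB) uc1).symm dS.symm
  have p123 := p12.union pm3 (by
      rw [Finset.disjoint_union_left]; exact ⟨dj (hA'.trans hA) ur2, dR.symm⟩) (by
      rw [Finset.disjoint_union_left]; exact ⟨dC.symm, dj (hB'.trans hB) uc2⟩) (by
      rw [Finset.disjoint_union_left]; exact ⟨(dj (hD'.trans hD) us1).symm, (dj (hD'.trans hD) us2).symm⟩)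
  have gen : ∀ (S S' U1 U2 : Finset Λ), S ⊆ L → S' ⊆ S → U1 ⊆ Q → U2 ⊆ Q → Disjoint (S \ S') (S' ∪ U1 ∪ U2) ∧ Disjoint ((S \ S') ∪ (S' ∪ U1 ∪ U2)) (Q \ (U1 ∪ U2) ∪ Rest) ∧
      (S \ S') ∪ (S' ∪ U1 ∪ U2) ∪ (Q \ (U1 ∪ U2) ∪ Rest) = S ∪ (Q ∪ Rest) := by
    intro S S' U1 U2 hS hS' hU1 hU2
    refine ⟨?_, ?_, ?_⟩
    · rw [Finset.disjoint_union_right, Finset.disjoint_union_right]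
      exact ⟨⟨Finset.sdiff_disjoint, dj (Finset.sdiff_subset.trans hS) hU1⟩, dj (Finset.sdiff_subset.trans hS) hU2⟩
    · rw [Finset.disjoint_left] at hLQ hLR hQR ⊢
      intro x hx hx'
      simp only [Finset.mem_union, Finset.mem_sdiff, not_or] at hx hx'
      rcases hx with hx | ((hx | hx) | hx)
      · rcases hx' with hx' | hx'
        · exact hLQ (hS hx.1) hx'.1
        · exact hLR (hS hx.1) hx'
      · rcases hx' with hx' | hx'
        · exact hLQ (hS (hS' hx)) hx'.1
        · exact hLR (hS (hS' hx)) hx'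
      · rcases hx' with hx' | hx'
        · exact hx'.2.1 hx
        · exact hQR (hU1 hx) hx'
      · rcases hx' with hx' | hx'
        · exact hx'.2.2 hx
        · exact hQR (hU2 hx) hx'
    · exact set_eq_aux S S' U1 U2 Q Rest hS' hU1 hU2
  have r1 : UC1 ∪ B' ∪ UC2 = B' ∪ UC1 ∪ UC2 := by rw [Finset.union_comm UC1 B']
  have r2 : US1 ∪ US2 ∪ D' = D' ∪ US1 ∪ US2 := by rw [Finset.union_assoc, Finset.union_comm, Finset.union_assoc, Finset.union_comm D' US1, Finset.union_left_comm, Finset.union_comm US2, ← Finset.union_assoc, Finset.union_comm US1 D']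
  rw [r1, r2] at p123
  obtain ⟨a1, a2, a3⟩ := gen A A' UR1 UR2 hA hA' ur1 ur2
  obtain ⟨b1, b2, b3⟩ := gen B B' UC1 UC2 hB hB' uc1 uc2
  obtain ⟨d1, d2, d3⟩ := gen D D' US1 US2 hD hD' us1 us2
  have := (hpm.union p123 a1 b1 d1).union pmQ a2 b2 d2
  rwa [a3, b3, d3] at this

lemma sw_pm {n : ℕ} {f : Fin n → Equiv.Perm (Fin n)} (hsw : SwRow f) (r r' : Fin n) (hr : r ≠ r') (FR FC FS : Finset (Fin n))
    (h1 : 100 * FR.card ≤ n) (h2 : 100 * FC.card ≤ n) (h3 : 100 * FS.card ≤ n) :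
    ∃ WR WC WS : Finset (Fin n), WR.card ≤ 4 ∧ WC.card ≤ 5 ∧ WS.card ≤ 5 ∧ Disjoint WR FR ∧ Disjoint WC FC ∧ Disjoint WS FS ∧
      r ∉ WR ∧ r' ∉ WR ∧ PM (fun r c s => f r c = s) (insert r WR) WC WS ∧ PM (fun r c s => f r c = s) (insert r' WR) WC WS := by
  obtain ⟨w1, w2, w3, w4, c, d1, d2, d3, d4, x, y, x2, y2, s, ⟨e1, e2, e3, e4, e5, e6, e7, e8, e9, e10⟩, nw, hw, nc, ns, hc, hs⟩ := hsw r r' hr FR FC FS h1 h2 h3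
  refine ⟨{w1, w2, w3, w4}, {c, d1, d2, d3, d4}, {x, y, x2, y2, s}, Finset.card_le_four, Finset.card_le_five, Finset.card_le_five, ?_, ?_, ?_, ?_, ?_, ?_, ?_⟩
  · rw [Finset.disjoint_left]; intro a ha; exact (hw a (by simpa using ha)).2.2
  · rw [Finset.disjoint_left]; intro a ha; exact hc a (by simpa using ha)
  · rw [Finset.disjoint_left]; intro a ha; exact hs a (by simpa using ha)
  · intro ha; exact (hw r (by simpa using ha)).1 rfl
  · intro ha; exact (hw r' (by simpa using ha)).2.1 rfl
  · have q1 := (hw w1 (by simp)).1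
    have q2 := (hw w2 (by simp)).1
    have q3 := (hw w3 (by simp)).1
    have q4 := (hw w4 (by simp)).1
    clear hw hc hs
    simp only [List.nodup_cons, List.mem_cons, List.not_mem_nil, not_or, or_false, not_false_eq_true, List.nodup_nil, and_true] at nw nc ns
    obtain ⟨⟨n1, n2, n3⟩, ⟨n4, n5⟩, n6⟩ := nw
    obtain ⟨⟨c1, c2, c3, c4⟩, ⟨c5, c6, c7⟩, ⟨c8, c9⟩, c10⟩ := nc
    obtain ⟨⟨s1, s2, s3, s4⟩, ⟨s5, s6, s7⟩, ⟨s8, s9⟩, s10⟩ := ns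
    have p := ((((PM.ins (R := fun r c s => f r c = s) PM.nil (a := w4) (b := d4) (d := s) e9 (by simp) (by simp) (by simp)).ins (a := w3) (b := d3) (d := x2) e7
      (by simp; tauto) (by simp; tauto) (by simp; tauto)).ins (a := w2) (b := d2) (d := y2) e6
      (by simp; tauto) (by simp; tauto) (by simp; tauto)).ins (a := w1) (b := d1) (d := x) e3
      (by simp; tauto) (by simp; tauto) (by simp; tauto)).ins (a := r) (b := c) (d := y) e1
      (by simp; tauto) (by simp; tauto) (by simp; tauto)
    have j1 : insert c (insert d1 (insert d2 (insert d3 (insert d4 (∅ : Finset (Fin n)))))) = {c, d1, d2, d3, d4} := rfl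
    have j2 : insert y (insert x (insert y2 (insert x2 (insert s (∅ : Finset (Fin n)))))) = {x, y, x2, y2, s} := by
      rw [Finset.insert_comm y x, Finset.insert_comm y2 x2]; rfl
    rw [j1, j2] at p
    exact p
  · have q1 := (hw w1 (by simp)).2.1
    have q2 := (hw w2 (by simp)).2.1
    have q3 := (hw w3 (by simp)).2.1
    have q4 := (hw w4 (by simp)).2.1
    clear hw hc hs
    simp only [List.nodup_cons, List.mem_cons, List.not_mem_nil, not_or, or_false, not_false_eq_true, List.nodup_nil, and_true] at nw nc ns
    obtain ⟨⟨n1, n2, n3⟩, ⟨n4, n5⟩, n6⟩ := nw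
    obtain ⟨⟨c1, c2, c3, c4⟩, ⟨c5, c6, c7⟩, ⟨c8, c9⟩, c10⟩ := nc
    obtain ⟨⟨s1, s2, s3, s4⟩, ⟨s5, s6, s7⟩, ⟨s8, s9⟩, s10⟩ := ns
    have p := ((((PM.ins (R := fun r c s => f r c = s) PM.nil (a := w4) (b := c) (d := x) e2 (by simp) (by simp) (by simp)).ins (a := w3) (b := d4) (d := y2) e8
      (by simp; tauto) (by simp; tauto) (by simp; tauto)).ins (a := w2) (b := d1) (d := x2) e5
      (by simp; tauto) (by simp; tauto) (by simp; tauto)).ins (a := w1) (b := d2) (d := y) e4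
      (by simp; tauto) (by simp; tauto) (by simp; tauto)).ins (a := r') (b := d3) (d := s) e10
      (by simp; tauto) (by simp; tauto) (by simp; tauto)
    have j1 : insert d3 (insert d2 (insert d1 (insert d4 (insert c (∅ : Finset (Fin n)))))) = {c, d1, d2, d3, d4} := by
      ext z; simp only [Finset.mem_insert, Finset.notMem_empty, Finset.mem_singleton]; clear * -; tauto
    have j2 : insert s (insert y (insert x2 (insert y2 (insert x (∅ : Finset (Fin n)))))) = {x, y, x2, y2, s} := by
      ext z; simp only [Finset.mem_insert, Finset.notMem_empty, Finset.mem_singleton]; clear * -; tauto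
    rw [j1, j2] at p
    exact p

def Sec {V Λ : Type} (lab : V → Λ) (U T : Finset V) : Prop :=
  T ⊆ U ∧ (∀ v ∈ U, ∃ t ∈ T, lab t = lab v) ∧ (∀ t ∈ T, ∀ t' ∈ T, lab t = lab t' → t = t')

lemma absR {n : ℕ} {f : Fin n → Equiv.Perm (Fin n)} (hsw : SwRow f) {Λ : Type} (lab : Fin n → Λ) (FR FC FS : Finset (Fin n)) (U : Finset (Fin n)) :
    U ⊆ FR → 100 * (FR.card + 5 * U.card) ≤ n → 100 * (FC.card + 5 * U.card) ≤ n → 100 * (FS.card + 5 * U.card) ≤ n →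
    ∃ KR KC KS : Finset (Fin n), Disjoint KR FR ∧ Disjoint KC FC ∧ Disjoint KS FS ∧ KR.card ≤ 5 * U.card ∧ KC.card ≤ 5 * U.card ∧ KS.card ≤ 5 * U.card ∧
      ∀ T, Sec lab U T → PM (fun r c s => f r c = s) ((U \ T) ∪ KR) KC KS := by
  induction U using Finset.induction_on with
  | empty =>
    intro _ _ _ _
    refine ⟨∅, ∅, ∅, by simp, by simp, by simp, by simp, by simp, by simp, ?_⟩
    intro T hT
    simpa using PM.nil
  | insert v U hv ih =>
    intro hU b1 b2 b3
    rw [Finset.card_insert_of_notMem hv] at b1 b2 b3 ⊢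
    obtain ⟨KR, KC, KS, dR, dC, dS, k1, k2, k3, hK⟩ := ih ((Finset.subset_insert _ _).trans hU) (by omega) (by omega) (by omega)
    have hvF : v ∈ FR := hU (Finset.mem_insert_self _ _)
    have hvK : v ∉ KR := fun h => (Finset.disjoint_left.mp dR h) hvF
    by_cases hex : ∃ v' ∈ U, lab v' = lab v
    · obtain ⟨v', hv', hl⟩ := hex
      have hne : v ≠ v' := by rintro rfl; exact hv hv'
      have hv'F : v' ∈ FR := hU (Finset.mem_insert_of_mem hv')
      have hv'K : v' ∉ KR := fun h => (Finset.disjoint_left.mp dR h) hv'F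
      obtain ⟨WR, WC, WS, c1, c2, c3, jR, jC, jS, n1, n2, p1, p2⟩ := sw_pm hsw v v' hne (FR ∪ KR) (FC ∪ KC) (FS ∪ KS)
        (by have := Finset.card_union_le FR KR; omega) (by have := Finset.card_union_le FC KC; omega) (by have := Finset.card_union_le FS KS; omega)
      rw [Finset.disjoint_union_right] at jR jC jS
      refine ⟨KR ∪ WR, KC ∪ WC, KS ∪ WS, ?_, ?_, ?_, ?_, ?_, ?_, ?_⟩
      · rw [Finset.disjoint_union_left]; exact ⟨dR, jR.1⟩
      · rw [Finset.disjoint_union_left]; exact ⟨dC, jC.1⟩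
      · rw [Finset.disjoint_union_left]; exact ⟨dS, jS.1⟩
      · have := Finset.card_union_le KR WR; omega
      · have := Finset.card_union_le KC WC; omega
      · have := Finset.card_union_le KS WS; omega
      have hUW : Disjoint U WR := by
        rw [Finset.disjoint_left]; intro a ha hb
        exact (Finset.disjoint_left.mp jR.1 hb) (hU (Finset.mem_insert_of_mem ha))
      intro T ⟨s1, s2, s3⟩
      by_cases hvT : v ∈ T
      · have hv'T : v' ∉ T := fun h => hne (s3 v hvT v' h hl.symm)
        have hsec : Sec lab U (insert v' (T.erase v)) := by
          refine ⟨?_, ?_, ?_⟩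
          · intro a ha
            rcases Finset.mem_insert.mp ha with rfl | ha
            · exact hv'
            · rcases Finset.mem_insert.mp (s1 (Finset.mem_of_mem_erase ha)) with h | h
              · exact absurd h (Finset.ne_of_mem_erase ha)
              · exact h
          · intro a ha
            obtain ⟨t, ht, hlt⟩ := s2 a (Finset.mem_insert_of_mem ha)
            by_cases htv : t = v
            · exact ⟨v', Finset.mem_insert_self _ _, by rw [hl, ← hlt, htv]⟩
            · exact ⟨t, Finset.mem_insert_of_mem (Finset.mem_erase.mpr ⟨htv, ht⟩), hlt⟩
          · intro t ht t' ht' he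
            rcases Finset.mem_insert.mp ht with h1 | ht <;> rcases Finset.mem_insert.mp ht' with h2 | ht'
            · rw [h1, h2]
            · exact absurd (s3 t' (Finset.mem_of_mem_erase ht') v hvT (he.symm.trans (h1 ▸ hl))) (Finset.ne_of_mem_erase ht')
            · exact absurd (s3 t (Finset.mem_of_mem_erase ht) v hvT (he.trans (h2 ▸ hl))) (Finset.ne_of_mem_erase ht)
            · exact s3 t (Finset.mem_of_mem_erase ht) t' (Finset.mem_of_mem_erase ht') he
        have := (hK _ hsec).union p2 (by
          rw [Finset.disjoint_insert_right, Finset.disjoint_union_left]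
          refine ⟨by simp [hv'K], ?_, jR.2.symm⟩
          exact Finset.disjoint_of_subset_left Finset.sdiff_subset hUW) jC.2.symm jS.2.symm
        convert this using 1
        ext a
        simp only [Finset.mem_union, Finset.mem_sdiff, Finset.mem_insert, Finset.mem_erase, not_or, not_and, not_not]
        by_cases h1 : a = v
        · subst h1; simp [hvT, hv, hne]
        · by_cases h2 : a = v'
          · subst h2; simp [hv', hv'T]
          · simp [h1, h2]; clear * -; tauto
      · have hsec : Sec lab U T := by
          refine ⟨?_, fun a ha => s2 a (Finset.mem_insert_of_mem ha), s3⟩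
          intro a ha
          rcases Finset.mem_insert.mp (s1 ha) with rfl | h
          · exact absurd ha hvT
          · exact h
        have := (hK _ hsec).union p1 (by
          rw [Finset.disjoint_insert_right, Finset.disjoint_union_left]
          refine ⟨by simp [hvK, hv], ?_, jR.2.symm⟩
          exact Finset.disjoint_of_subset_left Finset.sdiff_subset hUW) jC.2.symm jS.2.symm
        convert this using 1
        ext a
        simp only [Finset.mem_union, Finset.mem_sdiff, Finset.mem_insert]
        by_cases h1 : a = v
        · subst h1; simp [hvT]
        · simp [h1]; clear * -; tauto
    · push Not at hex
      refine ⟨KR, KC, KS, dR, dC, dS, by omega, by omega, by omega, ?_⟩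
      intro T ⟨s1, s2, s3⟩
      have hvT : v ∈ T := by
        obtain ⟨t, ht, hlt⟩ := s2 v (Finset.mem_insert_self _ _)
        rcases Finset.mem_insert.mp (s1 ht) with rfl | h
        · exact ht
        · exact absurd hlt (hex t h)
      have hsec : Sec lab U (T.erase v) := by
        refine ⟨?_, ?_, fun t ht t' ht' he => s3 t (Finset.mem_of_mem_erase ht) t' (Finset.mem_of_mem_erase ht') he⟩
        · intro a ha
          rcases Finset.mem_insert.mp (s1 (Finset.mem_of_mem_erase ha)) with h | h
          · exact absurd h (Finset.ne_of_mem_erase ha)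
          · exact h
        · intro a ha
          obtain ⟨t, ht, hlt⟩ := s2 a (Finset.mem_insert_of_mem ha)
          refine ⟨t, Finset.mem_erase.mpr ⟨?_, ht⟩, hlt⟩
          rintro rfl
          exact hex a ha hlt.symm
      have := hK _ hsec
      convert this using 2
      ext a
      simp only [Finset.mem_sdiff, Finset.mem_insert, Finset.mem_erase, not_and, ne_eq]
      by_cases h1 : a = v
      · subst h1; simp [hvT, hv]
      · simp [h1]

/-- Absorption of rows, columns and symbols simultaneously. -/
lemma absAll {n : ℕ} {f : Fin n → Equiv.Perm (Fin n)} (hf : f ∈ latP n) (h1 : SwRow f) (h2 : SwRow (trL f)) (h3 : SwRow (syL f)) {Λ : Type}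
    (lR lC lS : Fin n → Λ) (UR UC US : Finset (Fin n)) (k : ℕ) (cR : UR.card ≤ k) (cC : UC.card ≤ k) (cS : US.card ≤ k) (hk : 1600 * k ≤ n) :
    ∃ KR KC KS : Finset (Fin n), Disjoint KR UR ∧ Disjoint KC UC ∧ Disjoint KS US ∧ KR.card ≤ 15 * k ∧ KC.card ≤ 15 * k ∧ KS.card ≤ 15 * k ∧
      ∀ TR TC TS, Sec lR UR TR → Sec lC UC TC → Sec lS US TS → PM (fun r c s => f r c = s) ((UR \ TR) ∪ KR) ((UC \ TC) ∪ KC) ((US \ TS) ∪ KS) := by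
  obtain ⟨R1, C1, S1, a1, a2, a3, a4, a5, a6, aP⟩ := absR h1 lR UR UC US UR subset_rfl (by omega) (by omega) (by omega)
  obtain ⟨C2, R2, S2, b1, b2, b3, b4, b5, b6, bP⟩ := absR h2 lC (UC ∪ C1) (UR ∪ R1) (US ∪ S1) UC Finset.subset_union_left
    (by have := Finset.card_union_le UC C1; omega) (by have := Finset.card_union_le UR R1; omega) (by have := Finset.card_union_le US S1; omega)
  obtain ⟨S3, C3, R3, d1, d2, d3, d4, d5, d6, dP⟩ := absR h3 lS (US ∪ S1 ∪ S2) (UC ∪ C1 ∪ C2) (UR ∪ R1 ∪ R2) US (Finset.subset_union_left.trans Finset.subset_union_left)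
    (by have := Finset.card_union_le US S1; have := Finset.card_union_le (US ∪ S1) S2; omega)
    (by have := Finset.card_union_le UC C1; have := Finset.card_union_le (UC ∪ C1) C2; omega)
    (by have := Finset.card_union_le UR R1; have := Finset.card_union_le (UR ∪ R1) R2; omega)
  simp only [Finset.disjoint_union_right] at b1 b2 b3 d1 d2 d3
  refine ⟨R1 ∪ R2 ∪ R3, C1 ∪ C2 ∪ C3, S1 ∪ S2 ∪ S3, ?_, ?_, ?_, ?_, ?_, ?_, ?_⟩
  · simp only [Finset.disjoint_union_left]; exact ⟨⟨a1, b2.1⟩, d3.1.1⟩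
  · simp only [Finset.disjoint_union_left]; exact ⟨⟨a2, b1.1⟩, d2.1.1⟩
  · simp only [Finset.disjoint_union_left]; exact ⟨⟨a3, b3.1⟩, d1.1.1⟩
  · have := Finset.card_union_le R1 R2; have := Finset.card_union_le (R1 ∪ R2) R3; omega
  · have := Finset.card_union_le C1 C2; have := Finset.card_union_le (C1 ∪ C2) C3; omega
  · have := Finset.card_union_le S1 S2; have := Finset.card_union_le (S1 ∪ S2) S3; omega
  intro TR TC TS sR sC sS
  have p1 := aP TR sR
  have p2 : PM (fun r c s => f r c = s) R2 ((UC \ TC) ∪ C2) S2 := by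
    apply PM.swap12
    have := bP TC sC
    simp only [trL_apply hf] at this
    exact this
  have p3 : PM (fun r c s => f r c = s) R3 C3 ((US \ TS) ∪ S3) := by
    apply PM.swap13
    have := dP TS sS
    simp only [syL_iff hf] at this
    exact this
  have sub : ∀ {S T U : Finset (Fin n)}, Disjoint S U → Disjoint S (U \ T) := fun h => Finset.disjoint_of_subset_right Finset.sdiff_subset h
  have := (p1.union p2 (by rw [Finset.disjoint_union_left]; exact ⟨(sub b2.1).symm, b2.2.symm⟩)
    (by rw [Finset.disjoint_union_right]; exact ⟨sub a2, b1.2.symm⟩) b3.2.symm).union p3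
    (by simp only [Finset.disjoint_union_left]; exact ⟨⟨(sub d3.1.1).symm, d3.1.2.symm⟩, d3.2.symm⟩)
    (by simp only [Finset.disjoint_union_left]; exact ⟨d2.1.2.symm, (sub d2.1.1).symm, d2.2.symm⟩)
    (by simp only [Finset.disjoint_union_left, Finset.disjoint_union_right]; exact ⟨⟨sub a3, sub b3.1⟩, d1.1.2.symm, d1.2.symm⟩)
  have i1 : ∀ A B C D : Finset (Fin n), A ∪ (B ∪ C ∪ D) = A ∪ B ∪ C ∪ D := by intro A B C D; simp only [Finset.union_assoc]
  have i2 : ∀ A B C D : Finset (Fin n), A ∪ (B ∪ C ∪ D) = B ∪ (A ∪ C) ∪ D := by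
    intro A B C D; rw [← Finset.union_assoc B A, Finset.union_comm B A]; simp only [Finset.union_assoc]
  have i3 : ∀ A B C D : Finset (Fin n), A ∪ (B ∪ C ∪ D) = B ∪ C ∪ (A ∪ D) := by
    intro A B C D; rw [Finset.union_left_comm]
  rw [i1, i2, i3]
  exact this

lemma edge_of_disc {n : ℕ} {η : ℝ} (hη : η < 1) {f : Fin n → Equiv.Perm (Fin n)} (hd : DiscP n η f) (hn : 0 < n) (A B C : Finset (Fin n))
    (hA : n ≤ A.card * (mm n) ^ 4) (hB : n ≤ B.card * (mm n) ^ 4) (hC : n ≤ C.card * (mm n) ^ 4) :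
    ∃ r ∈ A, ∃ c ∈ B, ∃ s ∈ C, f r c = s := by
  have h := hd A B C hA hB hC
  have pos : ∀ S : Finset (Fin n), n ≤ S.card * (mm n) ^ 4 → (0 : ℝ) < S.card := by
    intro S hS
    rcases Nat.eq_zero_or_pos S.card with h0 | h0
    · rw [h0] at hS; omega
    · exact_mod_cast h0
  have h0 : (0 : ℝ) < (1 - η) * A.card * B.card * C.card / n := by
    have := pos A hA; have := pos B hB; have := pos C hC
    have h1 : 0 < 1 - η := by linarith
    have : (0 : ℝ) < n := by exact_mod_cast hn
    positivity
  have h1 : 0 < eABC f A B C := by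
    have : (0 : ℝ) < eABC f A B C := by
      refine lt_of_lt_of_le h0 (le_trans (le_of_eq ?_) h)
      ring
    exact_mod_cast this
  unfold eABC at h1
  obtain ⟨p, hp⟩ := Finset.card_pos.mp h1
  rw [Finset.mem_filter, Finset.mem_product] at hp
  exact ⟨p.1, hp.1.1, p.2, hp.1.2, _, hp.2, rfl⟩

section core
variable {V Λ : Type} [DecidableEq V] [DecidableEq Λ]

def Rlab (R : V → V → V → Prop) (lR lC lS : V → Λ) : Λ → Λ → Λ → Prop :=
  fun a b d => ∃ r c s, lR r = a ∧ lC c = b ∧ lS s = d ∧ R r c s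

lemma conv_pm [Nonempty V] (R : V → V → V → Prop) (lR lC lS : V → Λ) (A B D : Finset Λ) (h : PM (Rlab R lR lC lS) A B D) :
    ∃ TR TC TS : Finset V, PM R TR TC TS ∧ (TR.image lR = A ∧ TC.image lC = B ∧ TS.image lS = D) ∧
      (∀ t ∈ TR, ∀ t' ∈ TR, lR t = lR t' → t = t') ∧ (∀ t ∈ TC, ∀ t' ∈ TC, lC t = lC t' → t = t') ∧ (∀ t ∈ TS, ∀ t' ∈ TS, lS t = lS t' → t = t') := by
  obtain ⟨M, h1, h2, h3, h4, h5, h6, h7⟩ := h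
  have hch : ∀ t : Λ × Λ × Λ, ∃ q : V × V × V, t ∈ M → lR q.1 = t.1 ∧ lC q.2.1 = t.2.1 ∧ lS q.2.2 = t.2.2 ∧ R q.1 q.2.1 q.2.2 := by
    intro t
    by_cases ht : t ∈ M
    · obtain ⟨r, c, s, a1, a2, a3, a4⟩ := h1 t ht
      exact ⟨(r, c, s), fun _ => ⟨a1, a2, a3, a4⟩⟩
    · obtain ⟨z⟩ := ‹Nonempty V›
      exact ⟨(z, z, z), fun h => absurd h ht⟩
  choose q hq using hch
  refine ⟨(M.image q).image (fun t => t.1), (M.image q).image (fun t => t.2.1), (M.image q).image (fun t => t.2.2), ⟨M.image q, ?_, ?_, ?_, ?_, rfl, rfl, rfl⟩, ⟨?_, ?_, ?_⟩, ?_, ?_, ?_⟩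
  · intro t ht
    obtain ⟨t0, ht0, rfl⟩ := Finset.mem_image.mp ht
    exact (hq t0 ht0).2.2.2
  · intro t ht t' ht' he
    obtain ⟨t0, ht0, rfl⟩ := Finset.mem_image.mp ht
    obtain ⟨t1, ht1, rfl⟩ := Finset.mem_image.mp ht'
    rw [h2 t0 ht0 t1 ht1 (by rw [← (hq t0 ht0).1, ← (hq t1 ht1).1, he])]
  · intro t ht t' ht' he
    obtain ⟨t0, ht0, rfl⟩ := Finset.mem_image.mp ht
    obtain ⟨t1, ht1, rfl⟩ := Finset.mem_image.mp ht'
    rw [h3 t0 ht0 t1 ht1 (by rw [← (hq t0 ht0).2.1, ← (hq t1 ht1).2.1, he])]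
  · intro t ht t' ht' he
    obtain ⟨t0, ht0, rfl⟩ := Finset.mem_image.mp ht
    obtain ⟨t1, ht1, rfl⟩ := Finset.mem_image.mp ht'
    rw [h4 t0 ht0 t1 ht1 (by rw [← (hq t0 ht0).2.2.1, ← (hq t1 ht1).2.2.1, he])]
  · rw [Finset.image_image, Finset.image_image, ← h5]
    exact Finset.image_congr (fun t ht => (hq t ht).1)
  · rw [Finset.image_image, Finset.image_image, ← h6]
    exact Finset.image_congr (fun t ht => (hq t ht).2.1)
  · rw [Finset.image_image, Finset.image_image, ← h7]
    exact Finset.image_congr (fun t ht => (hq t ht).2.2.1)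
  · intro t ht t' ht' he
    rw [Finset.image_image] at ht ht'
    obtain ⟨t0, ht0, rfl⟩ := Finset.mem_image.mp ht
    obtain ⟨t1, ht1, rfl⟩ := Finset.mem_image.mp ht'
    rw [h2 t0 ht0 t1 ht1 (by rw [← (hq t0 ht0).1, ← (hq t1 ht1).1]; exact he)]
  · intro t ht t' ht' he
    rw [Finset.image_image] at ht ht'
    obtain ⟨t0, ht0, rfl⟩ := Finset.mem_image.mp ht
    obtain ⟨t1, ht1, rfl⟩ := Finset.mem_image.mp ht'
    rw [h3 t0 ht0 t1 ht1 (by rw [← (hq t0 ht0).2.1, ← (hq t1 ht1).2.1]; exact he)]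
  · intro t ht t' ht' he
    rw [Finset.image_image] at ht ht'
    obtain ⟨t0, ht0, rfl⟩ := Finset.mem_image.mp ht
    obtain ⟨t1, ht1, rfl⟩ := Finset.mem_image.mp ht'
    rw [h4 t0 ht0 t1 ht1 (by rw [← (hq t0 ht0).2.2.1, ← (hq t1 ht1).2.2.1]; exact he)]
end core

/-- Fibres of a labelling: all labels lie in `Lab`, and the fibre over `α` has size `m ^ α.1`. -/
def GoodLab {n : ℕ} (m : ℕ) (Lab : Finset (ℕ × ℕ)) (l : Fin n → ℕ × ℕ) : Prop :=
  (∀ v, l v ∈ Lab) ∧ ∀ α ∈ Lab, (Finset.univ.filter (fun v => l v = α)).card = m ^ α.1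

lemma fib_card {n m : ℕ} {Lab : Finset (ℕ × ℕ)} {l : Fin n → ℕ × ℕ} (h : GoodLab m Lab l) (i : ℕ) (S : Finset (ℕ × ℕ)) (hS : S ⊆ Lab.filter (fun α => α.1 = i)) :
    (Finset.univ.filter (fun v => l v ∈ S)).card = S.card * m ^ i := by
  rw [Finset.card_eq_sum_card_fiberwise (f := l) (t := S) (by intro x hx; simpa using hx)]
  rw [Finset.sum_const_nat (m := m ^ i)]
  intro α hα
  have hα' := Finset.mem_filter.mp (hS hα)
  rw [← hα'.2, ← h.2 α hα'.1, Finset.filter_filter]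
  congr 1
  ext v
  simp only [Finset.mem_filter, Finset.mem_univ, true_and]
  constructor
  · rintro ⟨_, h⟩; exact h
  · intro h; exact ⟨h ▸ hα, h⟩

lemma fib_le {n m : ℕ} {Lab : Finset (ℕ × ℕ)} {l : Fin n → ℕ × ℕ} (h : GoodLab m Lab l) (i : ℕ) (F : Finset (ℕ × ℕ)) :
    (Finset.univ.filter (fun v => (l v).1 = i ∧ l v ∈ F)).card ≤ F.card * m ^ i := by
  have h1 := fib_card h i (F ∩ Lab.filter (fun α => α.1 = i)) Finset.inter_subset_right
  have h2 : Finset.univ.filter (fun v => (l v).1 = i ∧ l v ∈ F) = Finset.univ.filter (fun v => l v ∈ F ∩ Lab.filter (fun α => α.1 = i)) := by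
    ext v
    simp only [Finset.mem_filter, Finset.mem_univ, true_and, Finset.mem_inter, h.1 v]
    exact and_comm
  rw [h2, h1]
  exact Nat.mul_le_mul_right _ (Finset.card_le_card Finset.inter_subset_left)

lemma avoid_lab {n m : ℕ} {Lab : Finset (ℕ × ℕ)} {la lb : Fin n → ℕ × ℕ} (ha : GoodLab m Lab la) (hb : GoodLab m Lab lb) (φ : Fin n → Fin n) (hφ : Function.Injective φ)
    (i u : ℕ) (θ : ℝ) (hθ : (4 * u * m ^ i : ℝ) < θ) (hd : θ ≤ (Finset.univ.filter (fun v => (la v).1 = i ∧ (lb (φ v)).1 = i)).card)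
    (F F' : Finset (ℕ × ℕ)) (hF : F.card < 2 * u) (hF' : F'.card < 2 * u) :
    ∃ v, (la v).1 = i ∧ (lb (φ v)).1 = i ∧ la v ∉ F ∧ lb (φ v) ∉ F' := by
  by_contra hcon
  push Not at hcon
  have hsub : Finset.univ.filter (fun v => (la v).1 = i ∧ (lb (φ v)).1 = i) ⊆ Finset.univ.filter (fun v => (la v).1 = i ∧ la v ∈ F) ∪ Finset.univ.filter (fun v => (lb (φ v)).1 = i ∧ lb (φ v) ∈ F') := by
    intro v hv
    simp only [Finset.mem_filter, Finset.mem_univ, true_and, Finset.mem_union] at hv ⊢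
    by_cases h : la v ∈ F
    · exact Or.inl ⟨hv.1, h⟩
    · exact Or.inr ⟨hv.2, hcon v hv.1 hv.2 h⟩
  have h1 := Finset.card_le_card hsub
  have h2 := Finset.card_union_le (Finset.univ.filter (fun v => (la v).1 = i ∧ la v ∈ F)) (Finset.univ.filter (fun v => (lb (φ v)).1 = i ∧ lb (φ v) ∈ F'))
  have h3 := fib_le ha i F
  have h4 : (Finset.univ.filter (fun v => (lb (φ v)).1 = i ∧ lb (φ v) ∈ F')).card ≤ F'.card * m ^ i := by
    refine le_trans ?_ (fib_le hb i F')
    refine Finset.card_le_card_of_injOn φ ?_ (fun a _ b _ h => hφ h)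
    intro v hv
    simpa using hv
  have h5 : F.card * m ^ i ≤ 2 * u * m ^ i := Nat.mul_le_mul_right _ hF.le
  have h6 : F'.card * m ^ i ≤ 2 * u * m ^ i := Nat.mul_le_mul_right _ hF'.le
  have h7 : (Finset.univ.filter (fun v => (la v).1 = i ∧ (lb (φ v)).1 = i)).card ≤ 4 * u * m ^ i := by linarith
  have h8 : ((Finset.univ.filter (fun v => (la v).1 = i ∧ (lb (φ v)).1 = i)).card : ℝ) ≤ 4 * u * m ^ i := by exact_mod_cast h7
  linarith

lemma core_levels {n : ℕ} {η : ℝ} (hη : η < 1) {f : Fin n → Equiv.Perm (Fin n)} (hf : f ∈ latP n) (hd : DiscP n η f) (hn : 0 < n)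
    (hm : 0 < mm n) (hm34 : n ≤ (mm n) ^ 34) (Lab : Finset (ℕ × ℕ)) (hLab : ∀ α ∈ Lab, α.1 ≤ 30) (lR lC lS : Fin n → ℕ × ℕ)
    (gR : GoodLab (mm n) Lab lR) (gC : GoodLab (mm n) Lab lC) (gS : GoodLab (mm n) Lab lS) (θ : ℝ) (hθ : 4 * (n : ℝ) < θ * (mm n : ℝ) ^ 3)
    (h1 : ∀ r, ∀ i, 1 ≤ i → i ≤ 30 → θ ≤ (Finset.univ.filter (fun c => (lC c).1 = i ∧ (lS (f r c)).1 = i)).card)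
    (h2 : ∀ c, ∀ i, 1 ≤ i → i ≤ 30 → θ ≤ (Finset.univ.filter (fun r => (lR r).1 = i ∧ (lS (trL f c r)).1 = i)).card)
    (h3 : ∀ s, ∀ i, 1 ≤ i → i ≤ 30 → θ ≤ (Finset.univ.filter (fun c => (lC c).1 = i ∧ (lR (syL f s c)).1 = i)).card) :
    ∀ k ≤ 30, ∀ A ⊆ Lab.filter (fun α => α.1 = 30 - k), ∀ B ⊆ Lab.filter (fun α => α.1 = 30 - k), ∀ D ⊆ Lab.filter (fun α => α.1 = 30 - k), A.card = B.card → A.card = D.card →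
      PM (Rlab (fun r c s => f r c = s) lR lC lS) (A ∪ Lab.filter (fun α => 30 - k < α.1)) (B ∪ Lab.filter (fun α => 30 - k < α.1)) (D ∪ Lab.filter (fun α => 30 - k < α.1)) := by
  have hedge : ∀ ℓ u : ℕ, n ≤ (u + 1) * (mm n) ^ (ℓ + 4) → ∀ A ⊆ Lab.filter (fun α => α.1 = ℓ), ∀ B ⊆ Lab.filter (fun α => α.1 = ℓ), ∀ D ⊆ Lab.filter (fun α => α.1 = ℓ),
      A.card = B.card → A.card = D.card → u < A.card → ∃ a ∈ A, ∃ b ∈ B, ∃ d ∈ D, Rlab (fun r c s => f r c = s) lR lC lS a b d := by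
    intro ℓ u hu A hA B hB D hD hAB hAD huA
    have key : ∀ S : Finset (ℕ × ℕ), u < S.card → n ≤ S.card * (mm n) ^ ℓ * (mm n) ^ 4 := by
      intro S hS
      rw [mul_assoc, ← pow_add]
      exact hu.trans (Nat.mul_le_mul_right _ hS)
    obtain ⟨r, hr, c, hc, s, hs, hR⟩ := edge_of_disc hη hd hn (Finset.univ.filter (fun v => lR v ∈ A)) (Finset.univ.filter (fun v => lC v ∈ B)) (Finset.univ.filter (fun v => lS v ∈ D))
      (by rw [fib_card gR ℓ A hA]; exact key A huA) (by rw [fib_card gC ℓ B hB]; exact key B (by omega)) (by rw [fib_card gS ℓ D hD]; exact key D (by omega))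
    simp only [Finset.mem_filter, Finset.mem_univ, true_and] at hr hc hs
    exact ⟨lR r, hr, lC c, hc, lS s, hs, r, c, s, rfl, rfl, rfl, hR⟩
  intro k
  induction k with
  | zero =>
    intro _ A hA B hB D hD hAB hAD
    have he : Lab.filter (fun α => 30 - 0 < α.1) = ∅ := by
      rw [Finset.filter_eq_empty_iff]
      intro α hα
      have := hLab α hα
      omega
    rw [he, Finset.union_empty, Finset.union_empty, Finset.union_empty]
    obtain ⟨A', hA', B', hB', D', hD', v, hv, c1, c2, c3, hpm⟩ := greedy _ 0 _ _ _ (hedge (30 - 0) 0 (by simpa using hm34)) A.card A hA B hB D hD rfl hAB.symm hAD.symm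
    have hv0 : v = 0 := by omega
    subst hv0
    rw [Finset.card_eq_zero] at c1 c2 c3
    rw [c1, c2, c3, Finset.sdiff_empty, Finset.sdiff_empty, Finset.sdiff_empty] at hpm
    exact hpm
  | succ k ih =>
    intro hk
    specialize ih (by omega)
    obtain ⟨ℓ, hℓ, hℓ2⟩ : ∃ ℓ, 30 - (k + 1) = ℓ ∧ 30 - k = ℓ + 1 := ⟨30 - (k + 1), rfl, by omega⟩
    rw [hℓ2] at ih
    rw [hℓ]
    have hsplit : Lab.filter (fun α => ℓ < α.1) = Lab.filter (fun α => α.1 = ℓ + 1) ∪ Lab.filter (fun α => ℓ + 1 < α.1) := by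
      rw [← Finset.filter_or]
      refine Finset.filter_congr fun α _ => ?_
      omega
    rw [hsplit]
    have hle : ℓ + 1 ≤ 30 := by omega
    have hmR : (0 : ℝ) < (mm n : ℝ) ^ 3 := by
      have : (0 : ℝ) < mm n := by exact_mod_cast hm
      positivity
    have hu4 : ((4 * ((n / (mm n) ^ (ℓ + 4) : ℕ) : ℝ) * (mm n : ℝ) ^ (ℓ + 1) : ℝ)) < θ := by
      have e1 : (n / (mm n) ^ (ℓ + 4)) * (mm n) ^ (ℓ + 4) ≤ n := Nat.div_mul_le_self _ _
      have e2 : (((n / (mm n) ^ (ℓ + 4) : ℕ) : ℝ) * (mm n : ℝ) ^ (ℓ + 4)) ≤ n := by exact_mod_cast e1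
      have e3 : (mm n : ℝ) ^ (ℓ + 4) = (mm n : ℝ) ^ (ℓ + 1) * (mm n : ℝ) ^ 3 := by rw [← pow_add]
      rw [e3] at e2
      refine lt_of_mul_lt_mul_right ?_ hmR.le
      refine lt_of_le_of_lt ?_ hθ
      linarith
    have ex : ∀ (l : Fin n → ℕ × ℕ), GoodLab (mm n) Lab l → ∀ a ∈ Lab, ∃ v, l v = a := by
      intro l hl a ha
      have : 0 < (Finset.univ.filter (fun v => l v = a)).card := by rw [hl.2 a ha]; positivity
      obtain ⟨v, hv⟩ := Finset.card_pos.mp this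
      exact ⟨v, (Finset.mem_filter.mp hv).2⟩
    have mq : ∀ (l : Fin n → ℕ × ℕ), GoodLab (mm n) Lab l → ∀ v, (l v).1 = ℓ + 1 → l v ∈ Lab.filter (fun α => α.1 = ℓ + 1) :=
      fun l hl v hv => Finset.mem_filter.mpr ⟨hl.1 v, hv⟩
    refine level_step _ _ _ _ ?_ ?_ ?_ (n / (mm n) ^ (ℓ + 4)) (hedge ℓ _ ?_) ?_ ?_ ?_ ih
    · rw [Finset.disjoint_filter]; intro α _ h; omega
    · rw [Finset.disjoint_filter]; intro α _ h; omega
    · rw [Finset.disjoint_filter]; intro α _ h; omega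
    · rw [add_mul, one_mul]; exact (Nat.lt_div_mul_add (pow_pos hm _)).le
    · intro a ha F F' hF hF'
      obtain ⟨r, hr⟩ := ex lR gR a (Finset.mem_filter.mp ha).1
      obtain ⟨c, c1, c2, c3, c4⟩ := avoid_lab gC gS (f r) (f r).injective (ℓ + 1) _ θ hu4 (h1 r (ℓ + 1) (by omega) hle) F F' hF hF'
      exact ⟨_, mq lC gC c c1, c3, _, mq lS gS _ c2, c4, r, c, _, hr, rfl, rfl, rfl⟩
    · intro b hb F F' hF hF'
      obtain ⟨c, hc⟩ := ex lC gC b (Finset.mem_filter.mp hb).1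
      obtain ⟨r, c1, c2, c3, c4⟩ := avoid_lab gR gS (trL f c) (trL f c).injective (ℓ + 1) _ θ hu4 (h2 c (ℓ + 1) (by omega) hle) F F' hF hF'
      exact ⟨_, mq lR gR r c1, c3, _, mq lS gS _ c2, c4, r, c, _, rfl, hc, rfl, (trL_apply hf c r).symm⟩
    · intro d hdd F F' hF hF'
      obtain ⟨s, hs⟩ := ex lS gS d (Finset.mem_filter.mp hdd).1
      obtain ⟨c, c1, c2, c3, c4⟩ := avoid_lab gC gR (syL f s) (syL f s).injective (ℓ + 1) _ θ hu4 (h3 s (ℓ + 1) (by omega) hle) F F' hF hF'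
      exact ⟨_, mq lC gC c c1, c3, _, mq lR gR _ c2, c4, _, c, s, rfl, rfl, hs, (syL_iff hf _ c s).mp rfl⟩

lemma sec_of_conv {n m : ℕ} {Lab : Finset (ℕ × ℕ)} {l : Fin n → ℕ × ℕ} (g : GoodLab m Lab l) (A T : Finset (Fin n)) (hA : ∀ v ∈ A, (l v).1 = 0)
    (hT : T.image l = A.image l ∪ Lab.filter (fun α => 0 < α.1)) (hi : ∀ t ∈ T, ∀ t' ∈ T, l t = l t' → t = t') :
    Sec l (Finset.univ.filter (fun v => 0 < (l v).1)) (T.filter (fun v => 0 < (l v).1)) ∧ T = A ∪ T.filter (fun v => 0 < (l v).1) := by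
  have inj0 : ∀ v v', (l v).1 = 0 → l v = l v' → v = v' := by
    intro v v' h0 h
    have := g.2 (l v) (g.1 v)
    rw [h0, pow_zero, Finset.card_eq_one] at this
    obtain ⟨a, ha⟩ := this
    have h1 : v ∈ ({a} : Finset (Fin n)) := by rw [← ha]; simp
    have h2 : v' ∈ ({a} : Finset (Fin n)) := by rw [← ha]; simp [h]
    rw [Finset.mem_singleton] at h1 h2
    rw [h1, h2]
  refine ⟨⟨?_, ?_, ?_⟩, ?_⟩
  · exact Finset.filter_subset_filter _ (Finset.subset_univ _)
  · intro v hv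
    have hv' := (Finset.mem_filter.mp hv).2
    have : l v ∈ T.image l := by
      rw [hT]; exact Finset.mem_union_right _ (Finset.mem_filter.mpr ⟨g.1 v, hv'⟩)
    obtain ⟨t, ht, he⟩ := Finset.mem_image.mp this
    exact ⟨t, Finset.mem_filter.mpr ⟨ht, he ▸ hv'⟩, he⟩
  · intro t ht t' ht' he
    exact hi t (Finset.mem_filter.mp ht).1 t' (Finset.mem_filter.mp ht').1 he
  · ext v
    rw [Finset.mem_union, Finset.mem_filter]
    constructor
    · intro hv
      by_cases h : 0 < (l v).1
      · exact Or.inr ⟨hv, h⟩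
      · left
        have : l v ∈ A.image l ∪ Lab.filter (fun α => 0 < α.1) := by rw [← hT]; exact Finset.mem_image_of_mem _ hv
        rcases Finset.mem_union.mp this with h1 | h1
        · obtain ⟨a, ha, he⟩ := Finset.mem_image.mp h1
          rw [← inj0 a v (hA a ha) he]; exact ha
        · exact absurd (Finset.mem_filter.mp h1).2 h
    · rintro (hv | hv)
      · have : l v ∈ T.image l := by rw [hT]; exact Finset.mem_union_left _ (Finset.mem_image_of_mem _ hv)
        obtain ⟨t, ht, he⟩ := Finset.mem_image.mp this
        rw [inj0 v t (hA v hv) he.symm]; exact ht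
      · exact hv.1

lemma absorb_det {n : ℕ} {η : ℝ} (hη : η < 1) {f : Fin n → Equiv.Perm (Fin n)} (hf : f ∈ latP n) (hg : GoodL n η f) (hn : 0 < n)
    (hm : 0 < mm n) (hm34 : n ≤ (mm n) ^ 34) (Lab : Finset (ℕ × ℕ)) (hLab : ∀ α ∈ Lab, α.1 ≤ 30) (lR lC lS : Fin n → ℕ × ℕ)
    (gR : GoodLab (mm n) Lab lR) (gC : GoodLab (mm n) Lab lC) (gS : GoodLab (mm n) Lab lS) (θ : ℝ) (hθ : 4 * (n : ℝ) < θ * (mm n : ℝ) ^ 3)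
    (h1 : ∀ r, ∀ i, 1 ≤ i → i ≤ 30 → θ ≤ (Finset.univ.filter (fun c => (lC c).1 = i ∧ (lS (f r c)).1 = i)).card)
    (h2 : ∀ c, ∀ i, 1 ≤ i → i ≤ 30 → θ ≤ (Finset.univ.filter (fun r => (lR r).1 = i ∧ (lS (trL f c r)).1 = i)).card)
    (h3 : ∀ s, ∀ i, 1 ≤ i → i ≤ 30 → θ ≤ (Finset.univ.filter (fun c => (lC c).1 = i ∧ (lR (syL f s c)).1 = i)).card)
    (k : ℕ) (hk : 1600 * k ≤ n) (kR : (Finset.univ.filter (fun v => 0 < (lR v).1)).card ≤ k) (kC : (Finset.univ.filter (fun v => 0 < (lC v).1)).card ≤ k)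
    (kS : (Finset.univ.filter (fun v => 0 < (lS v).1)).card ≤ k) :
    ∃ X Y Z : Finset (Fin n), X.card ≤ 16 * k ∧ X.card = Y.card ∧ X.card = Z.card ∧
      ∀ A B D, Disjoint A X → Disjoint B Y → Disjoint D Z → A.card = B.card → A.card = D.card → PM (fun r c s => f r c = s) (A ∪ X) (B ∪ Y) (D ∪ Z) := by
  haveI : Nonempty (Fin n) := ⟨⟨0, hn⟩⟩
  obtain ⟨hD, sw1, sw2, sw3⟩ := hg
  obtain ⟨KR, KC, KS, dR, dC, dS, cR, cC, cS, hK⟩ := absAll hf sw1 sw2 sw3 lR lC lS _ _ _ k kR kC kS hk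
  have core := core_levels hη hf hD hn hm hm34 Lab hLab lR lC lS gR gC gS θ hθ h1 h2 h3 30 le_rfl
  simp only [Nat.sub_self] at core
  set WR := Finset.univ.filter (fun v => 0 < (lR v).1) with hWR
  set WC := Finset.univ.filter (fun v => 0 < (lC v).1) with hWC
  set WS := Finset.univ.filter (fun v => 0 < (lS v).1) with hWS
  have main : ∀ A B D, Disjoint A (WR ∪ KR) → Disjoint B (WC ∪ KC) → Disjoint D (WS ∪ KS) → A.card = B.card → A.card = D.card →
      PM (fun r c s => f r c = s) (A ∪ (WR ∪ KR)) (B ∪ (WC ∪ KC)) (D ∪ (WS ∪ KS)) := by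
    intro A B D jA jB jD e1 e2
    rw [Finset.disjoint_union_right] at jA jB jD
    have z : ∀ (l : Fin n → ℕ × ℕ) (A : Finset (Fin n)), Disjoint A (Finset.univ.filter (fun v => 0 < (l v).1)) → ∀ v ∈ A, (l v).1 = 0 := by
      intro l A h v hv
      have := Finset.disjoint_left.mp h hv
      simp only [Finset.mem_filter, Finset.mem_univ, true_and] at this
      omega
    have im : ∀ (l : Fin n → ℕ × ℕ) (A : Finset (Fin n)), GoodLab (mm n) Lab l → (∀ v ∈ A, (l v).1 = 0) → A.image l ⊆ Lab.filter (fun α => α.1 = 0) ∧ (A.image l).card = A.card := by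
      intro l A g h
      constructor
      · intro a ha
        obtain ⟨v, hv, rfl⟩ := Finset.mem_image.mp ha
        exact Finset.mem_filter.mpr ⟨g.1 v, h v hv⟩
      · refine Finset.card_image_of_injOn ?_
        intro v hv v' hv' he
        have := g.2 (l v) (g.1 v)
        rw [h v hv, pow_zero, Finset.card_eq_one] at this
        obtain ⟨a, ha⟩ := this
        have h1 : v ∈ ({a} : Finset (Fin n)) := by rw [← ha]; simp
        have h2 : v' ∈ ({a} : Finset (Fin n)) := by rw [← ha]; simpa using he.symm
        rw [Finset.mem_singleton] at h1 h2
        rw [h1, h2]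
    have zA := z lR A jA.1
    have zB := z lC B jB.1
    have zD := z lS D jD.1
    have iA := im lR A gR zA
    have iB := im lC B gC zB
    have iD := im lS D gS zD
    have pm := core (A.image lR) iA.1 (B.image lC) iB.1 (D.image lS) iD.1 (by rw [iA.2, iB.2, e1]) (by rw [iA.2, iD.2, e2])
    obtain ⟨TR, TC, TS, pT, ⟨t1, t2, t3⟩, j1, j2, j3⟩ := conv_pm _ _ _ _ _ _ _ pm
    obtain ⟨s1, q1⟩ := sec_of_conv gR A TR zA t1 j1
    obtain ⟨s2, q2⟩ := sec_of_conv gC B TC zB t2 j2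
    obtain ⟨s3, q3⟩ := sec_of_conv gS D TS zD t3 j3
    have pK := hK _ _ _ s1 s2 s3
    have comb : ∀ (A T W K : Finset (Fin n)), Disjoint A W → Disjoint A K → Disjoint K W → T ⊆ W → Disjoint (A ∪ T) ((W \ T) ∪ K) ∧ (A ∪ T) ∪ ((W \ T) ∪ K) = A ∪ (W ∪ K) := by
      intro A T W K a1 a2 a3 a4
      constructor
      · rw [Finset.disjoint_union_left, Finset.disjoint_union_right, Finset.disjoint_union_right]
        exact ⟨⟨Finset.disjoint_of_subset_right Finset.sdiff_subset a1, a2⟩, Finset.disjoint_sdiff, (Finset.disjoint_of_subset_right a4 a3).symm⟩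
      · rw [Finset.union_assoc, ← Finset.union_assoc T, Finset.union_sdiff_of_subset a4]
    have c1 := comb A _ WR KR jA.1 jA.2 dR s1.1
    have c2 := comb B _ WC KC jB.1 jB.2 dC s2.1
    have c3 := comb D _ WS KS jD.1 jD.2 dS s3.1
    rw [q1, q2, q3] at pT
    have := pT.union pK c1.1 c2.1 c3.1
    rwa [c1.2, c2.2, c3.2] at this
  refine ⟨WR ∪ KR, WC ∪ KC, WS ∪ KS, ?_, ?_, ?_, main⟩
  · have := Finset.card_union_le WR KR; omega
  · obtain ⟨M, hM⟩ := main ∅ ∅ ∅ (by simp) (by simp) (by simp) rfl rfl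
    have := hM.card
    simp only [Finset.empty_union] at this
    omega
  · obtain ⟨M, hM⟩ := main ∅ ∅ ∅ (by simp) (by simp) (by simp) rfl rfl
    have := hM.card
    simp only [Finset.empty_union] at this
    omega

def gl (m w p : ℕ) : ℕ × ℕ := if p < 30 * w then (p / w + 1, p % w / m ^ (p / w + 1)) else (0, p)

lemma card_fin_Ico {n a b : ℕ} (hb : b ≤ n) (P : ℕ → Prop) [DecidablePred (fun q : Fin n => P q)] (hP : ∀ q, P q ↔ a ≤ q ∧ q < b) :
    (Finset.univ.filter (fun q : Fin n => P q)).card = b - a := by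
  have : (Finset.univ.filter (fun q : Fin n => P q)).map Fin.valEmbedding = Finset.Ico a b := by
    ext x
    simp only [Finset.mem_map, Finset.mem_filter, Finset.mem_univ, true_and, Fin.valEmbedding_apply, Finset.mem_Ico, hP]
    constructor
    · rintro ⟨q, h, rfl⟩; exact h
    · intro h; exact ⟨⟨x, by omega⟩, h, rfl⟩
  rw [← Finset.card_map Fin.valEmbedding, this, Nat.card_Ico]

lemma gl_fib {m t i j : ℕ} (hm : 0 < m) (ht : 0 < t) (hi : i < 30) (hj : (j + 1) * m ^ (i + 1) ≤ m ^ 30 * t) (q : ℕ) :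
    gl m (m ^ 30 * t) q = (i + 1, j) ↔ i * (m ^ 30 * t) + j * m ^ (i + 1) ≤ q ∧ q < i * (m ^ 30 * t) + (j + 1) * m ^ (i + 1) := by
  set w := m ^ 30 * t with hw
  have hw0 : 0 < w := by positivity
  have hL : 0 < m ^ (i + 1) := by positivity
  unfold gl
  constructor
  · intro h
    split_ifs at h with h1
    · have e1 : q / w = i := by have := (Prod.mk.inj h).1; omega
      have e2 : q % w / m ^ (i + 1) = j := by have := (Prod.mk.inj h).2; rw [e1] at this; exact this
      have e3 := Nat.div_add_mod q w
      have e4 := Nat.div_add_mod (q % w) (m ^ (i + 1))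
      have e5 := Nat.mod_lt (q % w) hL
      rw [e1] at e3
      rw [e2] at e4
      rw [add_mul, one_mul, mul_comm i w, mul_comm j]
      generalize q % w % m ^ (i + 1) = z at e4 e5
      generalize m ^ (i + 1) * j = y at *
      generalize w * i = y' at *
      omega
    · simp at h
  · rintro ⟨h1, h2⟩
    obtain ⟨r, hr⟩ := Nat.exists_eq_add_of_le (show i * w ≤ q by omega)
    have hrw : r < w := by omega
    have e1 : q / w = i := by
      rw [hr, mul_comm, Nat.mul_add_div hw0, Nat.div_eq_of_lt hrw, add_zero]
    have e2 : q % w = r := by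
      rw [hr, mul_comm, Nat.mul_add_mod, Nat.mod_eq_of_lt hrw]
    have e3 : r / m ^ (i + 1) = j := by
      apply Nat.div_eq_of_lt_le <;> omega
    have h30 : q < 30 * w := by
      have : (i + 1) * w ≤ 30 * w := Nat.mul_le_mul_right _ hi
      rw [add_mul, one_mul] at this
      omega
    rw [if_pos h30, e1, e2, e3]

lemma gl_lev {m w i : ℕ} (hw0 : 0 < w) (hi1 : 1 ≤ i) (hi : i ≤ 30) (q : ℕ) : (gl m w q).1 = i ↔ (i - 1) * w ≤ q ∧ q < i * w := by
  obtain ⟨i, rfl⟩ := Nat.exists_eq_add_of_le' hi1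
  have key : q / w = i ↔ i * w ≤ q ∧ q < (i + 1) * w := by
    constructor
    · rintro rfl
      exact ⟨Nat.div_mul_le_self _ _, by rw [add_mul, one_mul]; exact Nat.lt_div_mul_add hw0⟩
    · rintro ⟨h1, h2⟩
      exact Nat.div_eq_of_lt_le h1 h2
  unfold gl
  split_ifs with h
  · simp only [Nat.add_right_cancel_iff, Nat.add_sub_cancel]
    exact key
  · simp only [Nat.add_sub_cancel]
    have : (i + 1) * w ≤ 30 * w := Nat.mul_le_mul_right _ hi
    constructor
    · intro h; simp at h
    · intro h; omega

lemma gl_good {n m t : ℕ} (hm : 0 < m) (ht : 0 < t) (hn : 30 * (m ^ 30 * t) ≤ n) :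
    GoodLab m (Finset.univ.image (fun p : Fin n => gl m (m ^ 30 * t) p)) (fun p : Fin n => gl m (m ^ 30 * t) p) := by
  refine ⟨fun v => Finset.mem_image_of_mem _ (Finset.mem_univ _), ?_⟩
  intro α hα
  obtain ⟨p, -, rfl⟩ := Finset.mem_image.mp hα
  set w := m ^ 30 * t with hw
  have hw0 : 0 < w := by positivity
  by_cases hp : (p : ℕ) < 30 * w
  · have hi : (p : ℕ) / w < 30 := by rw [Nat.div_lt_iff_lt_mul hw0]; exact hp
    have hdvd : m ^ ((p : ℕ) / w + 1) ∣ w := (pow_dvd_pow m (by omega)).trans (Dvd.intro _ rfl)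
    have e : gl m w p = ((p : ℕ) / w + 1, (p : ℕ) % w / m ^ ((p : ℕ) / w + 1)) := by unfold gl; rw [if_pos hp]
    obtain ⟨K, hK⟩ := hdvd
    have hL : 0 < m ^ ((p : ℕ) / w + 1) := by positivity
    have hj : ((p : ℕ) % w / m ^ ((p : ℕ) / w + 1) + 1) * m ^ ((p : ℕ) / w + 1) ≤ w := by
      have h1 : (p : ℕ) % w / m ^ ((p : ℕ) / w + 1) < K := by
        rw [Nat.div_lt_iff_lt_mul hL, mul_comm, ← hK]
        exact Nat.mod_lt _ hw0
      calc _ ≤ K * m ^ ((p : ℕ) / w + 1) := Nat.mul_le_mul_right _ h1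
        _ = w := by rw [mul_comm, ← hK]
    rw [e]
    have h2 : ((p : ℕ) / w) * w + w ≤ 30 * w := by
      have : ((p : ℕ) / w + 1) * w ≤ 30 * w := Nat.mul_le_mul_right _ hi
      rwa [add_mul, one_mul] at this
    refine (card_fin_Ico ?_ (fun q => gl m w q = ((p : ℕ) / w + 1, (p : ℕ) % w / m ^ ((p : ℕ) / w + 1))) (gl_fib hm ht hi hj)).trans ?_
    · rw [← hw]; clear_value w; clear hK; omega
    · rw [add_mul _ 1, one_mul]
      simp only
      omega
  · have e : gl m w p = (0, (p : ℕ)) := by unfold gl; rw [if_neg hp]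
    rw [e]
    rw [pow_zero, Finset.card_eq_one]
    refine ⟨p, ?_⟩
    ext q
    simp only [Finset.mem_filter, Finset.mem_univ, true_and, Finset.mem_singleton]
    constructor
    · intro h
      unfold gl at h
      split_ifs at h with h1
      · simp at h
      · simp at h; exact Fin.ext h
    · rintro rfl; exact e

lemma good_comp {n m : ℕ} {Lab : Finset (ℕ × ℕ)} {l : Fin n → ℕ × ℕ} (g : GoodLab m Lab l) (σ : Equiv.Perm (Fin n)) : GoodLab m Lab (fun v => l (σ.symm v)) := by
  refine ⟨fun v => g.1 _, fun α hα => ?_⟩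
  rw [← g.2 α hα]
  refine Finset.card_bij' (fun v _ => σ.symm v) (fun v _ => σ v) ?_ ?_ ?_ ?_ <;> simp

lemma exists_perm {n : ℕ} (hn : 0 < n) (w : ℕ) {T : Type} [Fintype T] (B C : T → Finset (Fin n)) (hB : ∀ t, (B t).card = w) (hC : ∀ t, (C t).card = w)
    (h : (Fintype.card T : ℝ) * Real.exp (-(((w : ℝ) ^ 2 / (2 * n)) ^ 2 / (32 * n))) < 1) :
    ∃ σ : Equiv.Perm (Fin n), ∀ t, (w : ℝ) ^ 2 / (2 * n) ≤ ((B t).filter (fun c => σ c ∈ C t)).card := by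
  by_contra hcon
  push Not at hcon
  have hn' : (0 : ℝ) < n := by exact_mod_cast hn
  set θ : ℝ := (w : ℝ) ^ 2 / (2 * n) with hθ
  have hθ0 : 0 ≤ θ := by positivity
  have hb : ∀ t, ((Finset.univ.filter (fun σ : Equiv.Perm (Fin n) => hitBC (B t) (C t) σ < θ)).card : ℝ) ≤ n.factorial * Real.exp (-(θ ^ 2 / (32 * n))) := by
    intro t
    have h1 := perm_tail (J := Unit) hn (hitBC (B t) (C t)) 2 (by norm_num) (hitBC_lip _ _) θ hθ0
    rw [hitBC_mean hn, hB, hC] at h1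
    simp only [Fintype.card_unit, Nat.cast_one, one_mul, pow_one, Finset.univ_unique, Finset.sum_singleton] at h1
    have e1 : (w : ℝ) * w / n - θ = θ := by rw [hθ]; field_simp; ring
    have e2 : θ ^ 2 / (8 * 2 ^ 2 * (n : ℝ)) = θ ^ 2 / (32 * n) := by norm_num
    rw [e1, e2] at h1
    refine le_trans ?_ h1
    rw [Nat.cast_le]
    · refine Finset.card_le_card_of_injOn (fun σ => fun _ => σ) ?_ ?_
      · intro σ hσ
        simp only [Finset.coe_filter, Finset.mem_univ, true_and, Set.mem_ofPred_eq] at hσ ⊢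
        exact hσ.le
      · intro a _ b _ hab
        exact congrFun hab ()
  have hcov : (Finset.univ : Finset (Equiv.Perm (Fin n))) ⊆ Finset.univ.biUnion (fun t => Finset.univ.filter (fun σ : Equiv.Perm (Fin n) => hitBC (B t) (C t) σ < θ)) := by
    intro σ _
    obtain ⟨t, ht⟩ := hcon σ
    rw [Finset.mem_biUnion]
    exact ⟨t, Finset.mem_univ _, Finset.mem_filter.mpr ⟨Finset.mem_univ _, ht⟩⟩
  have h2 := (Finset.card_le_card hcov).trans Finset.card_biUnion_le
  rw [Finset.card_univ, Fintype.card_perm, Fintype.card_fin] at h2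
  have h3 : (n.factorial : ℝ) ≤ ∑ t : T, (n.factorial : ℝ) * Real.exp (-(θ ^ 2 / (32 * n))) := by
    refine le_trans ?_ (Finset.sum_le_sum fun t _ => hb t)
    exact_mod_cast h2
  rw [Finset.sum_const, Finset.card_univ, nsmul_eq_mul] at h3
  have hf : (0 : ℝ) < n.factorial := by exact_mod_cast Nat.factorial_pos n
  have h4 := mul_lt_mul_of_pos_left h hf
  linarith

lemma absorb_num {n m w : ℕ} (hm : 100 ≤ m) (h33 : m ^ 33 ≤ n) (h34 : n ≤ m ^ 34) (hw : n ≤ 2 * (w * m)) :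
    (60 * (n : ℝ)) * Real.exp (-(((w : ℝ) ^ 2 / (2 * n)) ^ 2 / (32 * n))) < 1 := by
  have hm' : (100 : ℝ) ≤ m := by exact_mod_cast hm
  have h33' : (m : ℝ) ^ 33 ≤ n := by exact_mod_cast h33
  have h34' : (n : ℝ) ≤ (m : ℝ) ^ 34 := by exact_mod_cast h34
  have hw' : (n : ℝ) ≤ 2 * (w * m) := by exact_mod_cast hw
  have hm0 : (0 : ℝ) < m := by linarith
  have hn0 : (0 : ℝ) < n := lt_of_lt_of_le (by positivity) h33'
  have h1 : (n : ℝ) / (2 * m) ≤ w := by rw [div_le_iff₀ (by positivity)]; linarith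
  have h2 : (m : ℝ) ^ 29 / 2048 ≤ ((w : ℝ) ^ 2 / (2 * n)) ^ 2 / (32 * n) := by
    calc (m : ℝ) ^ 29 / 2048 = (m : ℝ) ^ 33 / (2048 * (m : ℝ) ^ 4) := by field_simp
      _ ≤ (n : ℝ) / (2048 * (m : ℝ) ^ 4) := by gcongr
      _ = (((n : ℝ) / (2 * m)) ^ 2 / (2 * n)) ^ 2 / (32 * n) := by field_simp; norm_num
      _ ≤ _ := by gcongr
  rw [Real.exp_neg, ← div_eq_mul_inv, div_lt_one (Real.exp_pos _)]
  refine lt_of_lt_of_le ?_ (Real.exp_le_exp.mpr h2)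
  have h3 : ((m : ℝ) ^ 29 / 2048) ^ 2 / 2 ≤ Real.exp ((m : ℝ) ^ 29 / 2048) := by
    have := Real.quadratic_le_exp_of_nonneg (show (0 : ℝ) ≤ (m : ℝ) ^ 29 / 2048 by positivity)
    have h0 : (0 : ℝ) ≤ (m : ℝ) ^ 29 / 2048 := by positivity
    linarith
  refine lt_of_lt_of_le ?_ h3
  calc 60 * (n : ℝ) ≤ 60 * (m : ℝ) ^ 34 := by gcongr
    _ < (100 : ℝ) ^ 24 / 8388608 * (m : ℝ) ^ 34 := by
        apply mul_lt_mul_of_pos_right _ (by positivity)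
        norm_num
    _ ≤ (m : ℝ) ^ 24 / 8388608 * (m : ℝ) ^ 34 := by gcongr
    _ = _ := by ring

theorem absorb (η : ℝ) (hη : η < 1) : ∀ᶠ n : ℕ in atTop, ∀ f ∈ latP n, GoodL n η f → ∃ X Y Z : Finset (Fin n), X.card * mm n ≤ 480 * n ∧ X.card = Y.card ∧ X.card = Z.card ∧
      ∀ A B D, Disjoint A X → Disjoint B Y → Disjoint D Z → A.card = B.card → A.card = D.card → PM (fun r c s => f r c = s) (A ∪ X) (B ∪ Y) (D ∪ Z) := by
  filter_upwards [mm_tendsto.eventually_ge_atTop 100000] with n hm f hf hg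
  have h33 := mm_pow_le n
  have h34 : n ≤ (mm n) ^ 34 := by
    have h1 := lt_mm_succ_pow n
    have hmR : (100000 : ℝ) ≤ mm n := by exact_mod_cast hm
    have h2 : ((mm n : ℝ) + 1) ^ 33 ≤ (mm n : ℝ) ^ 34 := by
      calc ((mm n : ℝ) + 1) ^ 33 ≤ (1.1 * (mm n : ℝ)) ^ 33 := by gcongr; linarith
        _ = 1.1 ^ 33 * (mm n : ℝ) ^ 33 := by rw [mul_pow]
        _ ≤ mm n * (mm n : ℝ) ^ 33 := by gcongr; norm_num; linarith
        _ = _ := by ring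
    have h3 : (mm n + 1) ^ 33 ≤ (mm n) ^ 34 := by exact_mod_cast h2
    omega
  set m := mm n with hmdef
  have hm0 : 0 < m := by omega
  have hn : 0 < n := lt_of_lt_of_le (pow_pos hm0 33) h33
  set t := n / m ^ 31 with htdef
  have p33 : m ^ 33 = m ^ 2 * m ^ 31 := by rw [← pow_add]
  have ht : 0 < t := by
    apply Nat.div_pos _ (pow_pos hm0 _)
    rw [p33] at h33
    exact le_trans (Nat.le_mul_of_pos_left _ (pow_pos hm0 2)) h33
  have hwm : m ^ 30 * t * m ≤ n := by
    have : m ^ 30 * t * m = t * m ^ 31 := by ring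
    rw [this]; exact Nat.div_mul_le_self _ _
  have hw2 : n ≤ 2 * (m ^ 30 * t * m) := by
    have h1 : n < t * m ^ 31 + m ^ 31 := Nat.lt_div_mul_add (pow_pos hm0 _)
    have h2 : m ^ 30 * t * m = t * m ^ 31 := by ring
    have h3 : m ^ 31 ≤ t * m ^ 31 := Nat.le_mul_of_pos_left _ ht
    rw [h2]; omega
  set w := m ^ 30 * t with hw
  have hw0 : 0 < w := by positivity
  have hwn : 100000 * w ≤ n := by
    refine le_trans ?_ hwm
    rw [mul_comm]; exact Nat.mul_le_mul_left _ hm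
  have num := absorb_num (w := w) (by omega) h33 h34 hw2
  set l : Fin n → ℕ × ℕ := fun p => gl m w p with hl
  have gl0 : GoodLab m _ l := gl_good hm0 ht (by omega)
  set Lab := Finset.univ.image l with hLabdef
  have hLab : ∀ α ∈ Lab, α.1 ≤ 30 := by
    intro α hα
    obtain ⟨p, -, rfl⟩ := Finset.mem_image.mp hα
    simp only [hl, gl]
    split_ifs with h
    · have : (p : ℕ) / w < 30 := by rw [Nat.div_lt_iff_lt_mul hw0]; exact h
      simp only; omega
    · simp
  have cpos : ∀ i, 1 ≤ i → i ≤ 30 → (Finset.univ.filter (fun v => (l v).1 = i)).card = w := by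
    intro i h1 h2
    have hle : i * w ≤ n := le_trans (Nat.mul_le_mul_right _ h2) (by omega)
    have := card_fin_Ico (n := n) (a := (i - 1) * w) (b := i * w) hle (fun q => (gl m w q).1 = i) (gl_lev hw0 h1 h2)
    refine Eq.trans this ?_
    rw [← Nat.sub_mul, show i - (i - 1) = 1 by omega, one_mul]
  have cW : (Finset.univ.filter (fun v => 0 < (l v).1)).card = 30 * w := by
    have := card_fin_Ico (n := n) (a := 0) (b := 30 * w) (by omega) (fun q => 0 < (gl m w q).1) (by
      intro q; unfold gl; split_ifs with h <;> simp <;> omega)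
    refine Eq.trans this ?_
    omega
  -- transport of a count
  have trans1 : ∀ (σ : Equiv.Perm (Fin n)) (i : ℕ) (P : Fin n → Prop) [DecidablePred (fun v => (l (σ.symm v)).1 = i ∧ P v)] [DecidablePred (fun c => P (σ c))],
      (Finset.univ.filter (fun v => (l (σ.symm v)).1 = i ∧ P v)).card = ((Finset.univ.filter (fun v => (l v).1 = i)).filter (fun c => P (σ c))).card := by
    intro σ i P _ _
    rw [Finset.filter_filter]
    refine Finset.card_bij' (fun v _ => σ.symm v) (fun v _ => σ v) ?_ ?_ ?_ ?_ <;> simp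
  have cimg : ∀ (π : Equiv.Perm (Fin n)) (S : Finset (Fin n)), (S.image π).card = S.card := fun π S => Finset.card_image_of_injective _ π.injective
  obtain ⟨σR, hσR⟩ := exists_perm hn w (T := Fin n × Fin 30) (fun t => Finset.univ.filter (fun v => (l v).1 = t.2.val + 1))
    (fun t => (Finset.univ.filter (fun v => (l v).1 = t.2.val + 1)).image (trL f t.1).symm) (fun t => cpos _ (by omega) (by omega))
    (fun t => by rw [cimg]; exact cpos _ (by omega) (by omega)) (by
      refine lt_of_le_of_lt ?_ num
      simp only [Fintype.card_prod, Fintype.card_fin]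
      gcongr
      push_cast
      have : (0 : ℝ) ≤ n := Nat.cast_nonneg n
      linarith)
  have hmemimg : ∀ (π : Equiv.Perm (Fin n)) (S : Finset (Fin n)) x, x ∈ S.image π.symm ↔ π x ∈ S := by
    intro π S x
    rw [Finset.mem_image]
    constructor
    · rintro ⟨y, hy, rfl⟩; simpa using hy
    · intro h; exact ⟨_, h, by simp⟩
  have cR : ∀ i, 1 ≤ i → i ≤ 30 → (Finset.univ.filter (fun v => (l (σR.symm v)).1 = i)).card = w := by
    intro i h1 h2
    rw [← cpos i h1 h2]
    refine Finset.card_bij' (fun v _ => σR.symm v) (fun v _ => σR v) ?_ ?_ ?_ ?_ <;> simp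
  obtain ⟨σC, hσC⟩ := exists_perm hn w (T := (Fin n × Fin 30) ⊕ (Fin n × Fin 30))
    (fun t => Sum.elim (fun t => Finset.univ.filter (fun v => (l v).1 = t.2.val + 1)) (fun t => Finset.univ.filter (fun v => (l v).1 = t.2.val + 1)) t)
    (fun t => Sum.elim (fun t => (Finset.univ.filter (fun v => (l v).1 = t.2.val + 1)).image (f t.1).symm)
      (fun t => (Finset.univ.filter (fun v => (l (σR.symm v)).1 = t.2.val + 1)).image (syL f t.1).symm) t)
    (fun t => by rcases t with t | t <;> exact cpos _ (by omega) (by omega))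
    (fun t => by
      rcases t with t | t
      · simp only [Sum.elim_inl]; rw [cimg]; exact cpos _ (by omega) (by omega)
      · simp only [Sum.elim_inr]; rw [cimg]; exact cR _ (by omega) (by omega)) (by
      refine lt_of_le_of_lt ?_ num
      simp only [Fintype.card_sum, Fintype.card_prod, Fintype.card_fin]
      gcongr
      push_cast
      linarith)
  obtain ⟨X, Y, Z, a1, a2, a3, a4⟩ := absorb_det hη hf hg hn hm0 h34 Lab hLab (fun v => l (σR.symm v)) (fun v => l (σC.symm v)) l
    (good_comp gl0 σR) (good_comp gl0 σC) gl0 ((w : ℝ) ^ 2 / (2 * n)) (by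
      have hn' : (0 : ℝ) < n := by exact_mod_cast hn
      have hm' : (100000 : ℝ) ≤ m := by exact_mod_cast hm
      have hm0' : (0 : ℝ) < m := by linarith
      have hw' : (n : ℝ) ≤ 2 * (w * m) := by exact_mod_cast hw2
      have h1 : (n : ℝ) / (2 * m) ≤ w := by rw [div_le_iff₀ (by positivity)]; linarith
      change 4 * (n : ℝ) < (w : ℝ) ^ 2 / (2 * n) * (m : ℝ) ^ 3
      calc 4 * (n : ℝ) < (n : ℝ) * m / 8 := by
            have := mul_le_mul_of_nonneg_left hm' hn'.le
            linarith
        _ = ((n : ℝ) / (2 * m)) ^ 2 / (2 * n) * (m : ℝ) ^ 3 := by field_simp; norm_num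
        _ ≤ _ := by gcongr) (by
      intro r i h1 h2
      refine (hσC (Sum.inl (r, ⟨i - 1, by omega⟩))).trans (le_of_eq ?_)
      rw [trans1 σC i (fun c => (l (f r c)).1 = i)]
      simp only [Sum.elim_inl, hmemimg, Nat.sub_add_cancel h1, Finset.mem_filter, Finset.mem_univ, true_and]) (by
      intro c i h1 h2
      refine (hσR (c, ⟨i - 1, by omega⟩)).trans (le_of_eq ?_)
      rw [trans1 σR i (fun r => (l (trL f c r)).1 = i)]
      simp only [hmemimg, Nat.sub_add_cancel h1, Finset.mem_filter, Finset.mem_univ, true_and]) (by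
      intro s i h1 h2
      refine (hσC (Sum.inr (s, ⟨i - 1, by omega⟩))).trans (le_of_eq ?_)
      rw [trans1 σC i (fun c => (l (σR.symm (syL f s c))).1 = i)]
      simp only [Sum.elim_inr, hmemimg, Nat.sub_add_cancel h1, Finset.mem_filter, Finset.mem_univ, true_and])
    (30 * w) (by omega) (by
      rw [← cW]; refine le_of_eq (Finset.card_bij' (fun v _ => σR.symm v) (fun v _ => σR v) ?_ ?_ ?_ ?_) <;> simp) (by
      rw [← cW]; refine le_of_eq (Finset.card_bij' (fun v _ => σC.symm v) (fun v _ => σC v) ?_ ?_ ?_ ?_) <;> simp) (le_of_eq cW)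
  refine ⟨X, Y, Z, ?_, a2, a3, a4⟩
  calc X.card * m ≤ 16 * (30 * w) * m := Nat.mul_le_mul_right _ a1
    _ = 480 * (w * m) := by ring
    _ ≤ 480 * n := Nat.mul_le_mul_left _ hwm

def tauC {n : ℕ} (f : Fin n → Equiv.Perm (Fin n)) (A B D : Finset (Fin n)) : ℕ :=
  (Finset.univ.filter (fun M : Finset (Fin n × Fin n × Fin n) => IsPM (fun r c s => f r c = s) M A B D)).card

lemma erase_union_aux {n : ℕ} (A X : Finset (Fin n)) (h : Disjoint A X) (r : Fin n) (hr : r ∈ A) :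
    r ∉ A.erase r ∪ X ∧ {r} ∪ (A.erase r ∪ X) = A ∪ X := by
  constructor
  · rw [Finset.mem_union, not_or]
    exact ⟨by simp, Finset.disjoint_left.mp h hr⟩
  · rw [← Finset.union_assoc, Finset.singleton_union, Finset.insert_erase hr]

lemma count_step {n : ℕ} (f : Fin n → Equiv.Perm (Fin n)) (X Y Z A B D : Finset (Fin n)) (hA : Disjoint A X) (hB : Disjoint B Y) (hD : Disjoint D Z) :
    ∑ p ∈ (A ×ˢ B).filter (fun p => f p.1 p.2 ∈ D), tauC f (A.erase p.1 ∪ X) (B.erase p.2 ∪ Y) (D.erase (f p.1 p.2) ∪ Z) ≤ A.card * tauC f (A ∪ X) (B ∪ Y) (D ∪ Z) := by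
  unfold tauC
  rw [← Finset.card_sigma, ← Finset.card_product]
  have tr : ∀ (r c : Fin n) (M : Finset (Fin n × Fin n × Fin n)), r ∈ A → c ∈ B → f r c ∈ D →
      IsPM (fun r c s => f r c = s) M (A.erase r ∪ X) (B.erase c ∪ Y) (D.erase (f r c) ∪ Z) →
      IsPM (fun r c s => f r c = s) ({(r, c, f r c)} ∪ M) (A ∪ X) (B ∪ Y) (D ∪ Z) ∧ (r, c, f r c) ∉ M := by
    intro r c M hr hc hs hM
    obtain ⟨a1, a2⟩ := erase_union_aux A X hA r hr
    obtain ⟨b1, b2⟩ := erase_union_aux B Y hB c hc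
    obtain ⟨d1, d2⟩ := erase_union_aux D Z hD (f r c) hs
    have h := IsPM.union (IsPM.single (R := fun r c s => f r c = s) (a := r) (b := c) (d := f r c) rfl) hM (Finset.disjoint_singleton_left.mpr a1)
      (Finset.disjoint_singleton_left.mpr b1) (Finset.disjoint_singleton_left.mpr d1)
    rw [a2, b2, d2] at h
    refine ⟨h, fun hmem => a1 ?_⟩
    rw [← hM.2.2.2.2.1]
    exact Finset.mem_image.mpr ⟨_, hmem, rfl⟩
  refine Finset.card_le_card_of_injOn (fun x => (x.1.1, {(x.1.1, x.1.2, f x.1.1 x.1.2)} ∪ x.2)) ?_ ?_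
  · rintro ⟨p, M⟩ hx
    simp only [Finset.coe_sigma, Set.mem_sigma_iff, Finset.mem_coe, Finset.mem_filter, Finset.mem_product, Finset.mem_univ, true_and] at hx
    simp only [Finset.mem_coe, Finset.mem_product, Finset.mem_filter, Finset.mem_univ, true_and]
    exact ⟨hx.1.1.1, (tr p.1 p.2 M hx.1.1.1 hx.1.1.2 hx.1.2 hx.2).1⟩
  · rintro ⟨p, M⟩ hx ⟨p', M'⟩ hx' he
    simp only [Finset.coe_sigma, Set.mem_sigma_iff, Finset.mem_coe, Finset.mem_filter, Finset.mem_product, Finset.mem_univ, true_and] at hx hx'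
    obtain ⟨e1, e2⟩ := Prod.mk.inj he
    obtain ⟨q1, q2⟩ := tr p.1 p.2 M hx.1.1.1 hx.1.1.2 hx.1.2 hx.2
    obtain ⟨q1', q2'⟩ := tr p'.1 p'.2 M' hx'.1.1.1 hx'.1.1.2 hx'.1.2 hx'.2
    simp only at e1 e2
    have m1 : (p.1, p.2, f p.1 p.2) ∈ {(p.1, p.2, f p.1 p.2)} ∪ M := by simp
    have m2 : (p'.1, p'.2, f p'.1 p'.2) ∈ {(p.1, p.2, f p.1 p.2)} ∪ M := by rw [e2]; simp
    have heq := q1.2.1 _ m1 _ m2 e1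
    have hp : p = p' := by
      have := (Prod.mk.inj (Prod.mk.inj heq).2).1
      exact Prod.ext e1 this
    subst hp
    have hM : M = M' := by
      rw [Finset.singleton_union, Finset.singleton_union] at e2
      have := congrArg (fun S => S.erase (p.1, p.2, f p.1 p.2)) e2
      simpa [Finset.erase_insert q2, Finset.erase_insert q2'] using this
    subst hM
    rfl

lemma count_lower {n : ℕ} {η : ℝ} (hη : η < 1) {f : Fin n → Equiv.Perm (Fin n)} (hd : DiscP n η f) (hn : 0 < n) (X Y Z : Finset (Fin n))
    (hab : ∀ A B D, Disjoint A X → Disjoint B Y → Disjoint D Z → A.card = B.card → A.card = D.card → PM (fun r c s => f r c = s) (A ∪ X) (B ∪ Y) (D ∪ Z))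
    (g : ℕ) (hg : n ≤ (g + 1) * (mm n) ^ 4) :
    ∀ d : ℕ, ∀ A B D, Disjoint A X → Disjoint B Y → Disjoint D Z → A.card = g + d → B.card = g + d → D.card = g + d →
      (∏ i ∈ Finset.Ioc g (g + d), ((1 - η) * (i : ℝ) ^ 2 / (n : ℝ)) : ℝ) ≤ (tauC f (A ∪ X) (B ∪ Y) (D ∪ Z) : ℝ) := by
  have hn' : (0 : ℝ) < n := by exact_mod_cast hn
  have h1η : 0 < 1 - η := by linarith
  intro d
  induction d with
  | zero =>
    intro A B D hA hB hD cA cB cD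
    rw [add_zero, Finset.Ioc_self, Finset.prod_empty]
    obtain ⟨M, hM⟩ := hab A B D hA hB hD (by omega) (by omega)
    have : 0 < tauC f (A ∪ X) (B ∪ Y) (D ∪ Z) := Finset.card_pos.mpr ⟨M, Finset.mem_filter.mpr ⟨Finset.mem_univ _, hM⟩⟩
    exact_mod_cast this
  | succ d ih =>
    intro A B D hA hB hD cA cB cD
    have hstep := count_step f X Y Z A B D hA hB hD
    set P : ℝ := ∏ i ∈ Finset.Ioc g (g + d), ((1 - η) * (i : ℝ) ^ 2 / n) with hP
    have hP0 : 0 ≤ P := Finset.prod_nonneg fun i _ => by positivity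
    have hstep' : (eABC f A B D : ℝ) * P ≤ (A.card : ℝ) * tauC f (A ∪ X) (B ∪ Y) (D ∪ Z) := by
      refine le_trans ?_ (show ((∑ p ∈ (A ×ˢ B).filter (fun p => f p.1 p.2 ∈ D), tauC f (A.erase p.1 ∪ X) (B.erase p.2 ∪ Y) (D.erase (f p.1 p.2) ∪ Z) : ℕ) : ℝ) ≤ _ by exact_mod_cast hstep)
      rw [Nat.cast_sum]
      unfold eABC
      rw [← nsmul_eq_mul]
      refine Finset.card_nsmul_le_sum _ _ _ ?_
      intro p hp
      rw [Finset.mem_filter, Finset.mem_product] at hp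
      refine ih _ _ _ ?_ ?_ ?_ ?_ ?_ ?_
      · exact Finset.disjoint_of_subset_left (Finset.erase_subset _ _) hA
      · exact Finset.disjoint_of_subset_left (Finset.erase_subset _ _) hB
      · exact Finset.disjoint_of_subset_left (Finset.erase_subset _ _) hD
      · rw [Finset.card_erase_of_mem hp.1.1]; omega
      · rw [Finset.card_erase_of_mem hp.1.2]; omega
      · rw [Finset.card_erase_of_mem hp.2]; omega
    have hgm : ∀ S : Finset (Fin n), S.card = g + (d + 1) → n ≤ S.card * (mm n) ^ 4 := by
      intro S hS
      rw [hS]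
      exact hg.trans (Nat.mul_le_mul_right _ (by omega))
    have hdisc := hd A B D (hgm A cA) (hgm B cB) (hgm D cD)
    have hA0 : (0 : ℝ) < A.card := by rw [cA]; positivity
    rw [← add_assoc, Finset.prod_Ioc_succ_top (by omega), ← hP]
    have cA' : (A.card : ℝ) = ((g + d + 1 : ℕ) : ℝ) := by rw [cA, add_assoc]
    have cB' : (B.card : ℝ) = ((g + d + 1 : ℕ) : ℝ) := by rw [cB, add_assoc]
    have cD' : (D.card : ℝ) = ((g + d + 1 : ℕ) : ℝ) := by rw [cD, add_assoc]
    rw [cA'] at hA0 hstep'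
    rw [cA', cB', cD'] at hdisc
    refine le_of_mul_le_mul_left ?_ hA0
    refine le_trans ?_ hstep'
    calc ((g + d + 1 : ℕ) : ℝ) * (P * ((1 - η) * ((g + d + 1 : ℕ) : ℝ) ^ 2 / n))
        = ((1 - η) * ((g + d + 1 : ℕ) : ℝ) * ((g + d + 1 : ℕ) : ℝ) * ((g + d + 1 : ℕ) : ℝ) / n) * P := by ring
      _ ≤ _ := mul_le_mul_of_nonneg_right hdisc hP0

lemma fac_le (a K : ℕ) : ∀ d, a + d ≤ K → (a + d).factorial ≤ a.factorial * K ^ d := by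
  intro d
  induction d with
  | zero => intro _; simp
  | succ d ih =>
    intro h
    rw [← add_assoc, Nat.factorial_succ, pow_succ]
    calc (a + d + 1) * (a + d).factorial ≤ K * (a.factorial * K ^ d) := Nat.mul_le_mul (by omega) (ih (by omega))
      _ = _ := by ring

lemma prod_Ioc_fac (g : ℕ) : ∀ d, (∏ i ∈ Finset.Ioc g (g + d), i) * g.factorial = (g + d).factorial := by
  intro d
  induction d with
  | zero => simp
  | succ d ih =>
    rw [← add_assoc, Finset.prod_Ioc_succ_top (by omega), Nat.factorial_succ, ← ih]
    ring

lemma final_num {n g d h : ℕ} (hn : 0 < n) {η ε : ℝ} (hη0 : 0 ≤ η) (hη : η < 1) (hε : ε < 1) (hgd : g + d + h = n)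
    (hlog : 2 * ((h : ℝ) + g) * Real.log n ≤ n * (Real.log (1 - η) - Real.log (1 - ε))) :
    ((1 - ε) * n / Real.exp 1 ^ 2) ^ n ≤ ∏ i ∈ Finset.Ioc g (g + d), ((1 - η) * (i : ℝ) ^ 2 / n) := by
  have hn' : (0 : ℝ) < n := by exact_mod_cast hn
  have hn1 : (1 : ℝ) ≤ n := by exact_mod_cast hn
  have h1η : 0 < 1 - η := by linarith
  have h1ε : 0 < 1 - ε := by linarith
  set Q : ℝ := ∏ i ∈ Finset.Ioc g (g + d), (i : ℝ) with hQ
  have e1 : ∏ i ∈ Finset.Ioc g (g + d), ((1 - η) * (i : ℝ) ^ 2 / n) = ((1 - η) / n) ^ d * Q ^ 2 := by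
    have e0 : ∏ i ∈ Finset.Ioc g (g + d), ((1 - η) * (i : ℝ) ^ 2 / n) = ∏ i ∈ Finset.Ioc g (g + d), (((1 - η) / n) * (i : ℝ) ^ 2) :=
      Finset.prod_congr rfl (fun i _ => by ring)
    rw [e0, Finset.prod_mul_distrib, Finset.prod_const, Nat.card_Ioc, Finset.prod_pow, Nat.add_sub_cancel_left]
  have hQ0 : 0 ≤ Q := Finset.prod_nonneg fun i _ => by positivity
  have e2 : (n.factorial : ℝ) ≤ Q * n ^ (g + h) := by
    have a1 := fac_le (g + d) n h (by omega)
    have a2 := prod_Ioc_fac g d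
    have a3 := fac_le 0 n g (by omega)
    simp only [Nat.zero_add, Nat.factorial_zero, one_mul] at a3
    rw [hgd] at a1
    have a4 : n.factorial ≤ (∏ i ∈ Finset.Ioc g (g + d), i) * n ^ (g + h) := by
      calc n.factorial ≤ (g + d).factorial * n ^ h := a1
        _ = (∏ i ∈ Finset.Ioc g (g + d), i) * g.factorial * n ^ h := by rw [a2]
        _ ≤ (∏ i ∈ Finset.Ioc g (g + d), i) * n ^ g * n ^ h := by gcongr
        _ = _ := by rw [mul_assoc, ← pow_add]
    have a5 : ((n.factorial : ℕ) : ℝ) ≤ (((∏ i ∈ Finset.Ioc g (g + d), i) * n ^ (g + h) : ℕ) : ℝ) := Nat.cast_le.mpr a4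
    rw [Nat.cast_mul, Nat.cast_prod, Nat.cast_pow] at a5
    exact a5
  have e3 : (n : ℝ) ^ n ≤ Real.exp 1 ^ n * (Q * n ^ (g + h)) := by
    have := Real.pow_div_factorial_le_exp (n : ℝ) hn'.le n
    rw [div_le_iff₀ (by exact_mod_cast Nat.factorial_pos n)] at this
    refine this.trans ?_
    rw [← Real.exp_nat_mul, mul_one]
    exact mul_le_mul_of_nonneg_left e2 (Real.exp_pos _).le
  have e4 : (1 - ε) ^ n * (n : ℝ) ^ (2 * (g + h)) ≤ (1 - η) ^ n := by
    rw [← Real.log_le_log_iff (by positivity) (by positivity), Real.log_mul (by positivity) (by positivity), Real.log_pow, Real.log_pow, Real.log_pow]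
    push_cast
    linarith
  have e5 : (1 - η) ^ n ≤ (1 - η) ^ d := pow_le_pow_of_le_one h1η.le (by linarith) (by omega)
  have e6 : (n : ℝ) ^ d ≤ (n : ℝ) ^ n := pow_le_pow_right₀ hn1 (by omega)
  rw [e1, div_pow, div_pow, mul_pow]
  set E := Real.exp 1 with hE
  have hE0 : 0 < E := Real.exp_pos _
  set N2 := (n : ℝ) ^ (g + h) with hN2
  have hN20 : 0 < N2 := by positivity
  have e7 : (n : ℝ) ^ (2 * (g + h)) = N2 ^ 2 := by rw [hN2, ← pow_mul, mul_comm]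
  rw [e7] at e4
  have e8 : ((n : ℝ) ^ n) ^ 2 ≤ (E ^ n) ^ 2 * Q ^ 2 * N2 ^ 2 := by
    have := pow_le_pow_left₀ (by positivity) e3 2
    refine this.trans (le_of_eq (by ring))
  have e9 : (1 - ε) ^ n * (n : ℝ) ^ n / (E ^ n) ^ 2 ≤ (1 - η) ^ n / (n : ℝ) ^ n * Q ^ 2 := by
    have hnn : (0 : ℝ) < (n : ℝ) ^ n := by positivity
    rw [div_mul_eq_mul_div, div_le_div_iff₀ (by positivity) hnn]
    refine le_of_mul_le_mul_right ?_ (show (0 : ℝ) < N2 ^ 2 by positivity)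
    calc (1 - ε) ^ n * (n : ℝ) ^ n * (n : ℝ) ^ n * N2 ^ 2 = ((1 - ε) ^ n * N2 ^ 2) * ((n : ℝ) ^ n) ^ 2 := by ring
      _ ≤ (1 - η) ^ n * ((E ^ n) ^ 2 * Q ^ 2 * N2 ^ 2) := by gcongr
      _ = _ := by ring
  rw [show (E ^ 2) ^ n = (E ^ n) ^ 2 by rw [← pow_mul, ← pow_mul, mul_comm]]
  refine e9.trans ?_
  gcongr

lemma tauC_le_numTransversals {n : ℕ} (f : Fin n → Equiv.Perm (Fin n)) (A B D : Finset (Fin n))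
    (hA : A = Finset.univ) :
    tauC f A B D ≤ numTransversals n (fun r c => f r c) := by
  unfold tauC numTransversals
  refine Finset.card_le_card_of_surjOn
    (fun σ : Equiv.Perm (Fin n) => Finset.univ.image (fun r => (r, σ r, f r (σ r)))) ?_
  intro M hM
  have hM' := (Finset.mem_filter.mp (Finset.mem_coe.mp hM)).2
  obtain ⟨h1, h2, h3, h4, h5, -, -⟩ := hM'
  have hex : ∀ r : Fin n, ∃ t ∈ M, t.1 = r := by
    intro r
    have hr : r ∈ M.image (fun t => t.1) := by rw [h5, hA]; exact Finset.mem_univ r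
    exact Finset.mem_image.mp hr
  choose t ht htr using hex
  have hinj : Function.Injective (fun r => (t r).2.1) := by
    intro r r' h
    have := h3 _ (ht r) _ (ht r') h
    rw [← htr r, ← htr r', this]
  have hbij := Finite.injective_iff_bijective.mp hinj
  have hval : ∀ r, f r ((t r).2.1) = (t r).2.2 := by
    intro r
    have := h1 _ (ht r)
    rwa [htr r] at this
  refine ⟨Equiv.ofBijective _ hbij, ?_, ?_⟩
  · rw [Finset.mem_coe, Finset.mem_filter]
    refine ⟨Finset.mem_univ _, Finite.injective_iff_bijective.mp ?_⟩
    intro r r' h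
    simp only [Equiv.ofBijective_apply, hval] at h
    have := h4 _ (ht r) _ (ht r') h
    rw [← htr r, ← htr r', this]
  · have key : ∀ r, (r, (t r).2.1, f r ((t r).2.1)) = t r := by
      intro r
      rw [hval r]
      exact Prod.ext (htr r).symm rfl
    ext x
    simp only [Finset.mem_image, Finset.mem_univ, true_and, Equiv.ofBijective_apply, key]
    constructor
    · rintro ⟨r, rfl⟩; exact ht r
    · intro hx
      exact ⟨x.1, h2 _ (ht _) _ hx (htr _)⟩

lemma many_of_good (ε : ℝ) (h0 : 0 < ε) (h1 : ε < 1) : ∀ᶠ n : ℕ in atTop, ∀ f ∈ latP n, GoodL n (ε / 2) f →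
    ((1 - ε) * n / Real.exp 1 ^ 2) ^ n ≤ (numTransversals n (fun r c => f r c) : ℝ) := by
  have hc : 0 < Real.log (1 - ε / 2) - Real.log (1 - ε) := by
    have := Real.log_lt_log (show 0 < 1 - ε by linarith) (show 1 - ε < 1 - ε / 2 by linarith)
    linarith
  set c := Real.log (1 - ε / 2) - Real.log (1 - ε) with hcdef
  filter_upwards [absorb (ε / 2) (by linarith), log_le_mm (c / 962) (by positivity),
    mm_tendsto.eventually_ge_atTop 1000, eventually_ge_atTop 1] with n hab hlog hm hn f hf hgood
  obtain ⟨X, Y, Z, hX, hXY, hXZ, hPM⟩ := hab f hf hgood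
  set m := mm n with hmdef
  obtain ⟨g, hgdef⟩ : ∃ g, g = n / m ^ 4 := ⟨_, rfl⟩
  have hm4 : 0 < m ^ 4 := by positivity
  have hg1 : n ≤ (g + 1) * m ^ 4 := by
    have := Nat.lt_div_mul_add hm4 (a := n)
    rw [← hgdef] at this
    linarith [add_mul g 1 (m ^ 4)]
  have hg2 : g * m ≤ n := by
    have h1 : g * m ^ 4 ≤ n := by rw [hgdef]; exact Nat.div_mul_le_self _ _
    have h2 : m ≤ m ^ 4 := Nat.le_self_pow (by norm_num) m
    exact (Nat.mul_le_mul_left g h2).trans h1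
  have hsum : (g + X.card) * m ≤ 481 * n := by
    rw [add_mul]; omega
  have hle : g + X.card ≤ n := by
    have : (g + X.card) * 1000 ≤ (g + X.card) * m := Nat.mul_le_mul_left _ hm
    omega
  have hn' : (0 : ℝ) < n := by exact_mod_cast hn
  have hm' : (0 : ℝ) < m := by
    have : 0 < m := by omega
    exact_mod_cast this
  have hnum := final_num (n := n) (g := g) (d := n - X.card - g) (h := X.card) hn (η := ε / 2) (ε := ε)
    (by linarith) (by linarith) h1 (by omega) (by
      rw [← hcdef]
      have hl0 : 0 ≤ Real.log n := Real.log_natCast_nonneg n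
      have hl1 : Real.log n ≤ c / 962 * m := by
        refine le_trans ?_ hlog
        refine le_trans ?_ (le_self_pow₀ (show 1 ≤ 1 + Real.log n by linarith) (by norm_num))
        linarith
      have hs : ((X.card : ℝ) + g) * m ≤ 481 * n := by
        have : (((g + X.card) * m : ℕ) : ℝ) ≤ ((481 * n : ℕ) : ℝ) := by exact_mod_cast hsum
        push_cast at this
        linarith
      calc 2 * ((X.card : ℝ) + g) * Real.log n ≤ 2 * ((X.card : ℝ) + g) * (c / 962 * m) :=
            mul_le_mul_of_nonneg_left hl1 (by positivity)
        _ = (((X.card : ℝ) + g) * m) * (2 * c / 962) := by ring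
        _ ≤ (481 * n) * (2 * c / 962) := mul_le_mul_of_nonneg_right hs (by positivity)
        _ = n * c := by ring)
  refine hnum.trans ?_
  have cardc : ∀ S : Finset (Fin n), S.card = X.card → (Sᶜ).card = g + (n - X.card - g) := by
    intro S hS
    rw [Finset.card_compl, Fintype.card_fin, hS]
    omega
  have hlow := count_lower (η := ε / 2) (by linarith) hgood.1 hn X Y Z hPM g hg1 (n - X.card - g) Xᶜ Yᶜ Zᶜ
    disjoint_compl_left disjoint_compl_left disjoint_compl_left (cardc X rfl) (cardc Y hXY.symm) (cardc Z hXZ.symm)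
  refine hlow.trans ?_
  rw [Nat.cast_le]
  refine tauC_le_numTransversals f _ _ _ ?_
  ext x
  simp only [Finset.mem_union, Finset.mem_compl, Finset.mem_univ, iff_true]
  exact (em (x ∈ X)).symm

lemma card_latP_le (n : ℕ) :
    (latP n).card ≤ (Finset.univ.filter (fun L : Fin n → Fin n → Fin n => IsLatin n L)).card := by
  refine Finset.card_le_card_of_injOn (fun f r c => f r c) ?_ ?_
  · intro f hf
    rw [Finset.mem_coe, mem_latP] at hf
    rw [Finset.mem_coe, Finset.mem_filter]
    refine ⟨Finset.mem_univ _, fun r => (f r).bijective, fun c => Finite.injective_iff_bijective.mp ?_⟩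
    intro r r' h
    by_contra hne
    exact hf r r' hne c h
  · intro f _ f' _ h
    funext r
    ext c
    exact congrArg Fin.val (congrFun (congrFun h r) c)

lemma card_few_le (n : ℕ) (η b : ℝ)
    (h : ∀ f ∈ latP n, GoodL n η f → b ≤ (numTransversals n (fun r c => f r c) : ℝ)) :
    (Finset.univ.filter (fun L : Fin n → Fin n → Fin n => IsLatin n L ∧ (numTransversals n L : ℝ) < b)).card
      ≤ ((latP n).filter (fun f => ¬ GoodL n η f)).card := by
  refine Finset.card_le_card_of_surjOn (fun f r c => f r c) ?_
  intro L hL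
  rw [Finset.mem_coe, Finset.mem_filter] at hL
  obtain ⟨-, hL, hb⟩ := hL
  refine ⟨fun r => Equiv.ofBijective _ (hL.1 r), ?_, rfl⟩
  rw [Finset.mem_coe, Finset.mem_filter]
  have hmem : (fun r => Equiv.ofBijective _ (hL.1 r)) ∈ latP n := by
    rw [mem_latP]
    intro r r' hne c he
    exact hne ((hL.2 c).1 he)
  refine ⟨hmem, fun hg => ?_⟩
  exact absurd (h _ hmem hg) (not_le.mpr hb)

/-- Almost all order-`n` Latin squares have at least `((1-ε) n / e²)^n` transversals. -/
theorem almost_all_latin_squares_have_many_transversals :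
    ∀ ε : ℝ, 0 < ε → ∃ n₀ : ℕ, ∀ n : ℕ, n₀ ≤ n →
    ((Finset.univ.filter (fun L : Fin n → Fin n → Fin n => IsLatin n L ∧
        (numTransversals n L : ℝ) < ((1 - ε) * n / Real.exp 1 ^ 2) ^ n)).card : ℝ)
      ≤ ε * ((Finset.univ.filter (fun L : Fin n → Fin n → Fin n => IsLatin n L)).card : ℝ) := by
  intro ε hε
  by_cases h1 : ε < 1
  · refine eventually_atTop.mp ?_
    filter_upwards [many_of_good ε hε h1, good_aas (ε / 2) ε (by linarith) (by linarith) hε] with n hm hg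
    refine le_trans (Nat.cast_le.mpr (card_few_le n (ε / 2) _ hm)) (hg.trans ?_)
    exact mul_le_mul_of_nonneg_left (Nat.cast_le.mpr (card_latP_le n)) hε.le
  · refine ⟨0, fun n _ => ?_⟩
    have hle : (1 : ℝ) ≤ ε := not_lt.mp h1
    refine le_trans (Nat.cast_le.mpr (Finset.card_le_card ?_)) (le_mul_of_one_le_left (Nat.cast_nonneg _) hle)
    intro L hL
    rw [Finset.mem_filter] at hL ⊢
    exact ⟨hL.1, hL.2.1⟩
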